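/- arXiv:1805.08424 — 2 statements merged into one kernel-verified Lean document; each statement's English description precedes it below -/
import Mathlib

section
/- For all α, d₀ > 0 and f, h ∈ ℕ with h ≥ 1 there exist η > 0 and n₀ ∈ ℕ such that the following holds for all n ≥ n₀ and all d ≥ d₀: if G is an n-vertex (η,d)-quasirandom graph, F is a graph with f vertices and h edges, and φ is an edge-colouring of G that is (1+η)·fdn/(2h)-bounded and locally ηn-bounded, then G has an α-decomposition into rainbow α-spanning F-factors. -/
namespace Paper

variable {V : Type*} {W : Type*} {C : Type*}

/-- The set of edges of `G` receiving colour `c` under `φ`. -/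
def colourCls (G : SimpleGraph V) (φ : Sym2 V → C) (c : C) : Set (Sym2 V) :=
  {e | e ∈ G.edgeSet ∧ φ e = c}

/-- `φ` is a (globally) `g`-bounded edge-colouring of `G`:
every colour is used on at most `g` edges. -/
def GBounded (G : SimpleGraph V) (φ : Sym2 V → C) (g : ℝ) : Prop :=
  ∀ c : C, ((colourCls G φ c).ncard : ℝ) ≤ g

/-- `φ` is a locally `l`-bounded edge-colouring of `G`:
every vertex is incident to at most `l` edges of each colour. -/
def LBounded (G : SimpleGraph V) (φ : Sym2 V → C) (l : ℝ) : Prop :=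
  ∀ (v : V) (c : C), (({u | G.Adj v u ∧ φ s(v, u) = c}).ncard : ℝ) ≤ l

/-- A set of edges is rainbow if the colouring is injective on it. -/
def Rainbow (φ : Sym2 V → C) (E : Set (Sym2 V)) : Prop :=
  Set.InjOn φ E

/-- The set of common neighbours `w` of `u` and `v` with `φ(uw) = φ(vw)`. -/
def monoSet (G : SimpleGraph V) (φ : Sym2 V → C) (u v : V) : Set V :=
  {w | G.Adj u w ∧ G.Adj v w ∧ φ s(u, w) = φ s(v, w)}

/-- The monochromatic codegree `c^φ_G(u,v)`. -/
noncomputable def monoCodeg (G : SimpleGraph V) (φ : Sym2 V → C) (u v : V) : ℕ :=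
  (monoSet G φ u v).ncard

/-- Degree of `u` into the set `S`. -/
noncomputable def degIn (G : SimpleGraph V) (u : V) (S : Set V) : ℕ :=
  (G.neighborSet u ∩ S).ncard

/-- Codegree of `u,v` into the set `S`. -/
noncomputable def codegIn (G : SimpleGraph V) (u v : V) (S : Set V) : ℕ :=
  (G.neighborSet u ∩ G.neighborSet v ∩ S).ncard

/-- `G` restricted to `S` is `(ε,d)`-quasirandom: all degrees (within `S`)
are `(d ± ε)|S|` and all but at most `ε|S|²` unordered pairs of distinct
vertices of `S` have codegree (within `S`) equal to `(d² ± ε)|S|`. -/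
def QuasirandomOn (G : SimpleGraph V) (S : Set V) (ε d : ℝ) : Prop :=
  (∀ v ∈ S, |(degIn G v S : ℝ) - d * S.ncard| ≤ ε * S.ncard) ∧
  ((({p : Sym2 V | ∃ u v, p = s(u, v) ∧ u ≠ v ∧ u ∈ S ∧ v ∈ S ∧
        ¬ (|(codegIn G u v S : ℝ) - d ^ 2 * S.ncard| ≤ ε * S.ncard)}).ncard : ℝ)
      ≤ ε * (S.ncard : ℝ) ^ 2)

/-- `G` is `(ε,d)`-quasirandom. -/
def Quasirandom (G : SimpleGraph V) (ε d : ℝ) : Prop :=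
  QuasirandomOn G Set.univ ε d

/-- Edges of `G` with one endpoint in `X` and the other in `Y`. -/
def edgesBetween (G : SimpleGraph V) (X Y : Set V) : Set (Sym2 V) :=
  {e | e ∈ G.edgeSet ∧ ∃ u v, e = s(u, v) ∧ u ∈ X ∧ v ∈ Y}

/-- The pair `(A,B)` is `(ε,d)`-regular in `G`. -/
def RegularPair (G : SimpleGraph V) (A B : Set V) (ε d : ℝ) : Prop :=
  ∀ X ⊆ A, ∀ Y ⊆ B, ε * A.ncard ≤ (X.ncard : ℝ) → ε * B.ncard ≤ (Y.ncard : ℝ) →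
    |((edgesBetween G X Y).ncard : ℝ) / ((X.ncard : ℝ) * (Y.ncard : ℝ)) - d| ≤ ε

/-- The pair `(A,B)` is `(ε,d)`-superregular in `G`. -/
def SuperregularPair (G : SimpleGraph V) (A B : Set V) (ε d : ℝ) : Prop :=
  RegularPair G A B ε d ∧
  (∀ u ∈ A, |(degIn G u B : ℝ) - d * B.ncard| ≤ ε * B.ncard) ∧
  (∀ v ∈ B, |(degIn G v A : ℝ) - d * A.ncard| ≤ ε * A.ncard)

/-- `H` is a copy of `F`: a subgraph of `G` isomorphic to `F`. -/
def IsCopy (F : SimpleGraph W) {G : SimpleGraph V} (H : G.Subgraph) : Prop :=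
  Nonempty (F ≃g H.coe)

/-- `L` is the union of the family `𝒞` of pairwise vertex-disjoint copies of `F`. -/
def IsFactorFrom (F : SimpleGraph W) {G : SimpleGraph V} (L : G.Subgraph)
    (𝒞 : Set G.Subgraph) : Prop :=
  (∀ H ∈ 𝒞, IsCopy F H) ∧
  𝒞.Pairwise (fun H₁ H₂ => Disjoint H₁.verts H₂.verts) ∧
  L = sSup 𝒞

/-- `L` consists of vertex-disjoint copies of `F`. -/
def IsFFactorSub (F : SimpleGraph W) {G : SimpleGraph V} (L : G.Subgraph) : Prop :=
  ∃ 𝒞 : Set G.Subgraph, IsFactorFrom F L 𝒞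

/-- An `ε`-decomposition: pairwise edge-disjoint subgraphs of `G` which together
contain all but at most an `ε`-proportion of the edges of `G`. -/
def ApxDecomp (G : SimpleGraph V) (ε : ℝ) {t : ℕ} (L : Fin t → G.Subgraph) : Prop :=
  (Pairwise fun i j => Disjoint (L i).edgeSet (L j).edgeSet) ∧
  ((G.edgeSet \ ⋃ i, (L i).edgeSet).ncard : ℝ) ≤ ε * (G.edgeSet.ncard : ℝ)

/-- `a(F) ≤ a`, where `a(F) = max {Δ(F), a'(F), a''(F)}`. -/
def AParamLe (F : SimpleGraph W) (a : ℕ) : Prop :=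
  (∀ v, (F.neighborSet v).ncard ≤ a) ∧
  (∀ u v, F.Adj u v →
    (F.neighborSet u).ncard + (F.neighborSet v).ncard - 2 ≤ a) ∧
  (∀ u v w, F.Adj u v → F.Adj v w → u ≠ w →
    (F.neighborSet u).ncard + (F.neighborSet v).ncard + (F.neighborSet w).ncard - 4 ≤ a)

end Paper

open Paper

open Finset in
/-- Expectation of `X S`, where `S ⊆ Ω` contains each element independently with probability `p`. -/
noncomputable def bernExp {κ : Type*} [DecidableEq κ] (Ω : Finset κ) (p : ℝ)
    (X : Finset κ → ℝ) : ℝ :=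
  ∑ S ∈ Ω.powerset, p ^ S.card * (1 - p) ^ (Ω \ S).card * X S

section Bernoulli

open Finset

variable {κ : Type*} [DecidableEq κ] {Ω : Finset κ} {p : ℝ}

theorem bernExp_indicator {A B : Finset κ} (hA : A ⊆ Ω) (hB : B ⊆ Ω) (hAB : Disjoint A B) :
    bernExp Ω p (fun S => if B ⊆ S ∧ Disjoint S A then 1 else 0)
      = p ^ #B * (1 - p) ^ #A := by
  have key := Finset.prod_add (fun i => if i ∈ A then 0 else p)
    (fun i => if i ∈ B then 0 else 1 - p) Ω
  have hL : ∏ i ∈ Ω, ((if i ∈ A then 0 else p) + (if i ∈ B then 0 else 1 - p))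
      = p ^ #B * (1 - p) ^ #A := by
    have : ∀ i ∈ Ω, ((if i ∈ A then 0 else p) + (if i ∈ B then 0 else 1 - p))
        = (if i ∈ B then p else 1) * (if i ∈ A then 1 - p else 1) := by
      intro i _
      by_cases h1 : i ∈ A
      · simp [h1, Finset.disjoint_left.1 hAB h1]
      · by_cases h2 : i ∈ B <;> simp [h1, h2]
    rw [Finset.prod_congr rfl this, Finset.prod_mul_distrib, Finset.prod_ite_mem,
      Finset.prod_ite_mem, inter_eq_right.2 hA, inter_eq_right.2 hB]
    simp
  rw [← hL, key, bernExp]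
  refine Finset.sum_congr rfl fun S hS => ?_
  rw [mem_powerset] at hS
  by_cases h1 : Disjoint S A
  · have e1 : ∏ i ∈ S, (if i ∈ A then 0 else p) = p ^ #S := by
      rw [Finset.prod_congr rfl (g := fun _ => p), prod_const]
      intro i hi
      simp [Finset.disjoint_left.1 h1 hi]
    by_cases h2 : B ⊆ S
    · have e2 : ∏ i ∈ Ω \ S, (if i ∈ B then 0 else 1 - p) = (1 - p) ^ #(Ω \ S) := by
        rw [Finset.prod_congr rfl (g := fun _ => 1 - p), prod_const]
        intro i hi
        have : i ∉ B := fun h => (mem_sdiff.1 hi).2 (h2 h)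
        simp [this]
      rw [e1, e2]; simp [h1, h2]
    · obtain ⟨i, hi, hi'⟩ := not_subset.1 h2
      have e2 : ∏ i ∈ Ω \ S, (if i ∈ B then 0 else 1 - p) = 0 :=
        Finset.prod_eq_zero (mem_sdiff.2 ⟨hB hi, hi'⟩) (by simp [hi])
      rw [e2]; simp [h2]
  · obtain ⟨i, hi, hi'⟩ := not_disjoint_iff.1 h1
    have e1 : ∏ i ∈ S, (if i ∈ A then 0 else p) = 0 :=
      Finset.prod_eq_zero hi (by simp [hi'])
    rw [e1]; simp [h1]

theorem bernExp_avoid {A : Finset κ} (hA : A ⊆ Ω) :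
    bernExp Ω p (fun S => if Disjoint S A then 1 else 0) = (1 - p) ^ #A := by
  simpa using bernExp_indicator (p := p) hA (empty_subset Ω) (disjoint_empty_right A)

theorem bernExp_const (c : ℝ) : bernExp Ω p (fun _ => c) = c := by
  have h : bernExp Ω p (fun _ => 1) = 1 := by
    simpa using bernExp_avoid (p := p) (empty_subset Ω)
  simp only [bernExp, mul_one] at h ⊢
  rw [← Finset.sum_mul, h, one_mul]

theorem bernExp_add (X Y : Finset κ → ℝ) :
    bernExp Ω p (fun S => X S + Y S) = bernExp Ω p X + bernExp Ω p Y := by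
  simp [bernExp, mul_add, Finset.sum_add_distrib]

theorem bernExp_mul_left (c : ℝ) (X : Finset κ → ℝ) :
    bernExp Ω p (fun S => c * X S) = c * bernExp Ω p X := by
  simp only [bernExp, Finset.mul_sum]
  exact Finset.sum_congr rfl fun _ _ => by ring

theorem bernExp_sub (X Y : Finset κ → ℝ) :
    bernExp Ω p (fun S => X S - Y S) = bernExp Ω p X - bernExp Ω p Y := by
  simp [bernExp, mul_sub, Finset.sum_sub_distrib]

theorem bernExp_sum {ι : Type*} (s : Finset ι) (X : ι → Finset κ → ℝ) :
    bernExp Ω p (fun S => ∑ i ∈ s, X i S) = ∑ i ∈ s, bernExp Ω p (X i) := by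
  simp only [bernExp, Finset.mul_sum]
  exact Finset.sum_comm

theorem bernExp_mono (hp : 0 ≤ p) (hp1 : p ≤ 1) {X Y : Finset κ → ℝ} (h : ∀ S ⊆ Ω, X S ≤ Y S) :
    bernExp Ω p X ≤ bernExp Ω p Y :=
  Finset.sum_le_sum fun S hS => mul_le_mul_of_nonneg_left (h S (mem_powerset.1 hS))
    (mul_nonneg (pow_nonneg hp _) (pow_nonneg (sub_nonneg.2 hp1) _))

theorem exists_bernExp_le (hp : 0 ≤ p) (hp1 : p ≤ 1) (X : Finset κ → ℝ) :
    ∃ S ⊆ Ω, bernExp Ω p X ≤ X S := by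
  obtain ⟨S, hS, hmax⟩ := Finset.exists_max_image Ω.powerset X ⟨∅, by simp⟩
  refine ⟨S, mem_powerset.1 hS, ?_⟩
  calc bernExp Ω p X ≤ bernExp Ω p (fun _ => X S) :=
        bernExp_mono hp hp1 fun T hT => hmax T (mem_powerset.2 hT)
    _ = X S := bernExp_const _

end Bernoulli

section Coins

open Finset

variable {κ V : Type*} [DecidableEq κ] {K : V → Finset κ}
  {D : ℕ} {c p θ δ : ℝ}

theorem card_mul_le_card_biUnion_add [DecidableEq V] (hc : 0 ≤ c) (hK : ∀ v, #(K v) = D)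
    (hKK : ∀ v w, v ≠ w → (#(K v ∩ K w) : ℝ) ≤ c) (A : Finset V) :
    (#A : ℝ) * D ≤ #(A.biUnion K) + (#A : ℝ) ^ 2 * c := by
  induction A using Finset.induction_on with
  | empty => simp
  | insert v A hv ih =>
    have h1 : (#(K v ∩ A.biUnion K) : ℝ) ≤ #A * c := by
      rw [Finset.inter_biUnion]
      calc (#(A.biUnion fun w => K v ∩ K w) : ℝ) ≤ ∑ w ∈ A, (#(K v ∩ K w) : ℝ) := by
            exact_mod_cast card_biUnion_le
        _ ≤ ∑ w ∈ A, c := Finset.sum_le_sum fun w hw =>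
            hKK v w (fun h => hv (h ▸ hw))
        _ = #A * c := by simp
    have h2 : (#(K v ∪ A.biUnion K) : ℝ) + #(K v ∩ A.biUnion K) = D + #(A.biUnion K) := by
      rw [← hK v]; exact_mod_cast card_union_add_card_inter _ _
    rw [card_insert_of_notMem hv, biUnion_insert]
    push_cast
    nlinarith [(Nat.cast_nonneg #A : (0 : ℝ) ≤ #A), mul_nonneg (Nat.cast_nonneg (α := ℝ) #A) hc]

/-- Probability that every vertex of `A` avoids all its coins: lower bound. -/
theorem pow_le_bernExp_avoid [Fintype κ] (hp : 0 ≤ p) (hp1 : p ≤ 1) (hK : ∀ v, #(K v) = D) (A : Finset V) :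
    ((1 - p) ^ D) ^ #A ≤
      bernExp univ p (fun S => if Disjoint S (A.biUnion K) then 1 else 0) := by
  rw [bernExp_avoid (subset_univ _), ← pow_mul]
  refine pow_le_pow_of_le_one (by linarith) (by linarith) ?_
  calc #(A.biUnion K) ≤ ∑ v ∈ A, #(K v) := card_biUnion_le
    _ = D * #A := by simp [hK, mul_comm]

/-- Probability that every vertex of `A` avoids all its coins: upper bound. -/
theorem bernExp_avoid_le [Fintype κ] [DecidableEq V] (hp : 0 ≤ p) (hp1 : p ≤ 1) (hc : 0 ≤ c) (hK : ∀ v, #(K v) = D)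
    (hKK : ∀ v w, v ≠ w → (#(K v ∩ K w) : ℝ) ≤ c) (A : Finset V) :
    bernExp univ p (fun S => if Disjoint S (A.biUnion K) then 1 else 0)
      ≤ ((1 - p) ^ D) ^ #A + p * ((#A : ℝ) ^ 2 * c) := by
  rw [bernExp_avoid (subset_univ _), ← pow_mul]
  have h0 : 0 ≤ 1 - p := by linarith
  have h1 : #(A.biUnion K) ≤ D * #A :=
    calc #(A.biUnion K) ≤ ∑ v ∈ A, #(K v) := card_biUnion_le
      _ = D * #A := by simp [hK, mul_comm]
  obtain ⟨k, hk⟩ := Nat.exists_eq_add_of_le h1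
  have h2 : (k : ℝ) ≤ (#A : ℝ) ^ 2 * c := by
    have := card_mul_le_card_biUnion_add hc hK hKK A
    have h3 : (D : ℝ) * #A = #(A.biUnion K) + k := by exact_mod_cast hk
    linarith
  have h3 : 1 - k * p ≤ (1 - p) ^ k := by
    have := one_add_mul_le_pow (a := -p) (by linarith) k
    rw [← sub_eq_add_neg] at this
    linarith
  have h4 : (1 - p) ^ #(A.biUnion K) ≤ 1 := pow_le_one₀ h0 (by linarith)
  have h5 : 0 ≤ (1 - p) ^ #(A.biUnion K) := pow_nonneg h0 _
  rw [hk, pow_add]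
  nlinarith [mul_le_mul_of_nonneg_left h3 h5, mul_le_mul_of_nonneg_left h2 hp,
    mul_le_mul_of_nonneg_left h4 (mul_nonneg (Nat.cast_nonneg (α := ℝ) k) hp)]

/-- Second-moment bound for the number of edges at `v` all of whose other vertices survive. -/
theorem bernExp_degree_tail [Fintype κ] [DecidableEq V] {ι : Type*} {r : ℕ} {τ : ℝ} (hD : 0 < D)
    (hθ : 0 ≤ θ) (hθ1 : θ ≤ 1) (hδ : 0 ≤ δ) (hτ : 0 < τ) (hr : 2 ≤ r)
    (hK : ∀ v, #(K v) = D) (hKK : ∀ v w, v ≠ w → (#(K v ∩ K w) : ℝ) ≤ δ * D)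
    (s : ι → Finset V) (v : V) (E : Finset ι) (hEv : ∀ e ∈ E, v ∈ s e)
    (hEr : ∀ e ∈ E, #(s e) = r) (hED : #E ≤ D)
    (hcod : ∀ w, w ≠ v → (#{e ∈ E | w ∈ s e} : ℝ) ≤ δ * D) :
    bernExp univ (θ / D) (fun S =>
        if (((1 - θ / D) ^ D) ^ (r - 1) + τ) * D <
            ∑ e ∈ E, (if Disjoint S (((s e).erase v).biUnion K) then (1 : ℝ) else 0)
        then 1 else 0)
      ≤ 5 * r ^ 2 * δ / τ ^ 2 := by
  classical
  have hD' : (0 : ℝ) < D := by exact_mod_cast hD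
  have hD1 : (1 : ℝ) ≤ D := by exact_mod_cast hD
  set p := θ / D with hpdef
  have hp : 0 ≤ p := by positivity
  have hp1 : p ≤ 1 := by rw [hpdef, div_le_one hD']; linarith
  have hpD : p * D = θ := by rw [hpdef]; field_simp
  set q := ((1 - p) ^ D) ^ (r - 1) with hq
  have hq0 : 0 ≤ q := pow_nonneg (pow_nonneg (by linarith) _) _
  have hq1 : q ≤ 1 := pow_le_one₀ (pow_nonneg (by linarith) _) (pow_le_one₀ (by linarith) (by linarith))
  set Y : ι → Finset κ → ℝ := fun e S => if Disjoint S (((s e).erase v).biUnion K) then 1 else 0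
    with hY
  set m : ℝ := (#E : ℝ) with hm
  have hm0 : 0 ≤ m := Nat.cast_nonneg _
  have hmD : m ≤ D := by rw [hm]; exact_mod_cast hED
  have hcard : ∀ e ∈ E, #((s e).erase v) = r - 1 := fun e he => by
    rw [card_erase_of_mem (hEv e he), hEr e he]
  have hEY : ∀ e ∈ E, q ≤ bernExp univ p (Y e) := fun e he => by
    have := pow_le_bernExp_avoid hp hp1 hK ((s e).erase v)
    rwa [hcard e he] at this
  have hYY : ∀ e e' S, Y e S * Y e' S =
      if Disjoint S (((s e).erase v ∪ (s e').erase v).biUnion K) then 1 else 0 := by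
    intro e e' S
    simp only [hY, union_biUnion, disjoint_union_right]
    by_cases h1 : Disjoint S (((s e).erase v).biUnion K) <;> simp [h1]
  have hYY1 : ∀ e e', bernExp univ p (fun S => Y e S * Y e' S) ≤ 1 := by
    intro e e'
    calc _ ≤ bernExp univ p (fun _ => (1 : ℝ)) := bernExp_mono hp hp1 fun S _ => by
          rw [hYY]; split_ifs <;> norm_num
      _ = 1 := bernExp_const _
  have hYYd : ∀ e ∈ E, ∀ e' ∈ E, Disjoint ((s e).erase v) ((s e').erase v) →
      bernExp univ p (fun S => Y e S * Y e' S) ≤ q ^ 2 + 4 * r ^ 2 * δ := by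
    intro e he e' he' hd
    have h1 := bernExp_avoid_le hp hp1 (by positivity : 0 ≤ δ * D) hK hKK
      ((s e).erase v ∪ (s e').erase v)
    rw [card_union_of_disjoint hd, hcard e he, hcard e' he', pow_add] at h1
    simp only [hYY]
    refine h1.trans ?_
    have h2 : ((r - 1 + (r - 1) : ℕ) : ℝ) ^ 2 ≤ 4 * r ^ 2 := by
      have : ((r - 1 + (r - 1) : ℕ) : ℝ) ≤ 2 * r := by
        have : r - 1 + (r - 1) ≤ 2 * r := by omega
        exact_mod_cast this
      nlinarith [(Nat.cast_nonneg (r - 1 + (r - 1)) : (0 : ℝ) ≤ _)]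
    have h3 : p * (((r - 1 + (r - 1) : ℕ) : ℝ) ^ 2 * (δ * D)) ≤ 4 * r ^ 2 * δ := by
      calc p * (((r - 1 + (r - 1) : ℕ) : ℝ) ^ 2 * (δ * D))
          = ((r - 1 + (r - 1) : ℕ) : ℝ) ^ 2 * (δ * θ) := by rw [← hpD]; ring
        _ ≤ 4 * r ^ 2 * (δ * 1) := by gcongr
        _ = _ := by ring
    nlinarith
  have hpair : ∀ e ∈ E, ∑ e' ∈ E, bernExp univ p (fun S => Y e S * Y e' S)
      ≤ m * (q ^ 2 + 4 * r ^ 2 * δ) + r * (δ * D) := by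
    intro e he
    have h1 : ∀ e' ∈ E, bernExp univ p (fun S => Y e S * Y e' S) ≤
        (q ^ 2 + 4 * r ^ 2 * δ) + ∑ w ∈ (s e).erase v, (if w ∈ s e' then (1 : ℝ) else 0) := by
      intro e' he'
      by_cases hd : Disjoint ((s e).erase v) ((s e').erase v)
      · exact (hYYd e he e' he' hd).trans
          (le_add_of_nonneg_right (Finset.sum_nonneg fun _ _ => by split_ifs <;> norm_num))
      · obtain ⟨w, hw, hw'⟩ := not_disjoint_iff.1 hd
        have h2 : (1 : ℝ) ≤ ∑ w ∈ (s e).erase v, (if w ∈ s e' then (1 : ℝ) else 0) := by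
          have := Finset.single_le_sum (f := fun w => if w ∈ s e' then (1 : ℝ) else 0)
            (fun _ _ => by split_ifs <;> norm_num) hw
          simpa [mem_of_mem_erase hw'] using this
        have : 0 ≤ q ^ 2 + 4 * r ^ 2 * δ := by positivity
        linarith [hYY1 e e']
    refine (Finset.sum_le_sum h1).trans ?_
    rw [Finset.sum_add_distrib, Finset.sum_const, nsmul_eq_mul, Finset.sum_comm]
    gcongr
    calc ∑ w ∈ (s e).erase v, ∑ e' ∈ E, (if w ∈ s e' then (1 : ℝ) else 0)
        ≤ ∑ w ∈ (s e).erase v, δ * D := Finset.sum_le_sum fun w hw => by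
          have := hcod w (ne_of_mem_erase hw)
          simpa using this
      _ = ((r - 1 : ℕ) : ℝ) * (δ * D) := by simp [hcard e he]
      _ ≤ r * (δ * D) := by
          gcongr
          exact Nat.sub_le _ _
  have hvar : bernExp univ p (fun S => (∑ e ∈ E, Y e S - m * q) ^ 2) ≤ 5 * r ^ 2 * δ * D ^ 2 := by
    have h1 : (fun S => (∑ e ∈ E, Y e S - m * q) ^ 2) = fun S =>
        (∑ e ∈ E, ∑ e' ∈ E, Y e S * Y e' S - (2 * m * q) * ∑ e ∈ E, Y e S) + m ^ 2 * q ^ 2 := by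
      funext S
      rw [← Finset.sum_mul_sum]; ring
    rw [h1, bernExp_add, bernExp_sub, bernExp_mul_left, bernExp_const, bernExp_sum, bernExp_sum]
    simp only [bernExp_sum]
    have h2 : m * q ≤ ∑ e ∈ E, bernExp univ p (Y e) := by
      calc m * q = ∑ e ∈ E, q := by simp [hm]
        _ ≤ _ := Finset.sum_le_sum hEY
    have h3 := Finset.sum_le_sum hpair
    rw [Finset.sum_const, nsmul_eq_mul, ← hm] at h3
    have h4 : (2 * m * q) * (m * q) ≤ (2 * m * q) * ∑ e ∈ E, bernExp univ p (Y e) := by gcongr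
    have hr1 : (1 : ℝ) ≤ r := by exact_mod_cast (by omega : 1 ≤ r)
    have h5 : m ^ 2 * (4 * r ^ 2 * δ) ≤ D ^ 2 * (4 * r ^ 2 * δ) := by gcongr
    have h6 : m * (r * (δ * D)) ≤ D * (r * (δ * D)) := by gcongr
    have h7 : D * (r * (δ * D)) ≤ D * ((r ^ 2 : ℝ) * (δ * D)) := by
      gcongr
      nlinarith
    nlinarith
  have hmark : bernExp univ p (fun S => (τ * D) ^ 2 *
      (if (q + τ) * D < ∑ e ∈ E, Y e S then 1 else 0)) ≤ 5 * r ^ 2 * δ * D ^ 2 := by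
    refine le_trans (bernExp_mono hp hp1 fun S _ => ?_) hvar
    split_ifs with h
    · have h1 : m * q ≤ D * q := by gcongr
      have h2 : τ * D ≤ ∑ e ∈ E, Y e S - m * q := by linarith
      have h3 : 0 ≤ τ * D := by positivity
      nlinarith
    · simpa using sq_nonneg _
  rw [bernExp_mul_left] at hmark
  rw [le_div_iff₀ (by positivity)]
  have hDD : (0 : ℝ) < (D : ℝ) ^ 2 := by positivity
  refine le_of_mul_le_mul_right ?_ hDD
  calc _ = (τ * D) ^ 2 * bernExp univ p (fun S =>
      (if (q + τ) * D < ∑ e ∈ E, Y e S then 1 else 0)) := by ring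
    _ ≤ _ := hmark

end Coins

section Nibble

open Finset

/-- One nibble step: a random matching `M` together with the surviving hypergraph `E'`. -/
theorem exists_nibble_step {ι V : Type*} [Fintype ι] [DecidableEq ι] [Fintype V] [DecidableEq V]
    {r D : ℕ} {θ δ τ a : ℝ} (hD : 0 < D) (hθ : 0 ≤ θ) (hθ1 : θ ≤ 1) (hδ : 0 ≤ δ) (hτ : 0 < τ)
    (hr : 2 ≤ r) (ha : 0 ≤ a) (s : ι → Finset V) (E : Finset ι)
    (hEr : ∀ e ∈ E, #(s e) = r) (hdeg : ∀ v, #{e ∈ E | v ∈ s e} ≤ D)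
    (hcod : ∀ v w, v ≠ w → (#{e ∈ E | v ∈ s e ∧ w ∈ s e} : ℝ) ≤ δ * D) :
    ∃ M ⊆ E, ∃ E' ⊆ E, (M : Set ι).PairwiseDisjoint s ∧
      (∀ e ∈ M, ∀ e' ∈ E', Disjoint (s e) (s e')) ∧
      (∀ v, (#{e ∈ E' | v ∈ s e} : ℝ) ≤ (((1 - θ / D) ^ D) ^ (r - 1) + τ) * D) ∧
      #E * (θ / D * (1 - r * θ) +
          a * (((1 - θ / D) ^ D) ^ r - r * (5 * r ^ 2 * δ / τ ^ 2)))
        ≤ #M + a * #E' := by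
  classical
  have hD' : (0 : ℝ) < D := by exact_mod_cast hD
  have hD1 : (1 : ℝ) ≤ D := by exact_mod_cast hD
  set p := θ / D with hpdef
  have hp : 0 ≤ p := by positivity
  have hp1 : p ≤ 1 := by rw [hpdef, div_le_one hD']; linarith
  have hpD : p * D = θ := by rw [hpdef]; field_simp
  set q := ((1 - p) ^ D) ^ (r - 1) with hq
  have hJ : ∀ v, ∃ J : Finset (Fin D), #J = D - #{e ∈ E | v ∈ s e} := fun v => by
    obtain ⟨J, -, hJ⟩ := Finset.exists_subset_card_eq (s := (univ : Finset (Fin D)))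
      (n := D - #{e ∈ E | v ∈ s e}) (by simp)
    exact ⟨J, hJ⟩
  choose J hJ using hJ
  let K : V → Finset (ι ⊕ (V × Fin D)) := fun v =>
    ({e ∈ E | v ∈ s e} : Finset ι).disjSum ({v} ×ˢ J v)
  have hK : ∀ v, #(K v) = D := fun v => by
    simp only [K, card_disjSum, card_product, card_singleton, one_mul, hJ]
    have := hdeg v
    omega
  have hinl : ∀ e ∈ E, ∀ v, Sum.inl e ∈ K v ↔ v ∈ s e := fun e he v => by
    simp [K, he]
  have hKK : ∀ v w, v ≠ w → (#(K v ∩ K w) : ℝ) ≤ δ * D := fun v w hvw => by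
    refine le_trans ?_ (hcod v w hvw)
    rw [← card_map (Function.Embedding.inl (α := ι) (β := V × Fin D))]
    norm_cast
    refine card_le_card fun x hx => ?_
    rcases x with e | ⟨u, j⟩
    · simp [K] at hx ⊢; tauto
    · simp only [K, mem_inter, inr_mem_disjSum, mem_product, mem_singleton] at hx
      exact absurd (hx.1.1.symm.trans hx.2.1) hvw
  let Y : V → ι → Finset (ι ⊕ (V × Fin D)) → ℝ := fun v e S =>
    if Disjoint S (((s e).erase v).biUnion K) then 1 else 0
  let bad : V → Finset (ι ⊕ (V × Fin D)) → Prop := fun v S =>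
    (q + τ) * D < ∑ e ∈ ({e ∈ E | v ∈ s e} : Finset ι), Y v e S
  have hbad : ∀ v, bernExp univ p (fun S => if bad v S then 1 else 0) ≤ 5 * r ^ 2 * δ / τ ^ 2 := by
    intro v
    refine bernExp_degree_tail hD hθ hθ1 hδ hτ hr hK hKK s v {e ∈ E | v ∈ s e}
      (fun e he => (mem_filter.1 he).2) (fun e he => hEr e (mem_filter.1 he).1) (hdeg v) ?_
    intro w hw
    rw [filter_filter]
    exact hcod v w hw.symm
  let sel : ι → Finset (ι ⊕ (V × Fin D)) → Prop := fun e S =>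
    {Sum.inl e} ⊆ S ∧ Disjoint S (((s e).biUnion K).erase (Sum.inl e))
  let sur : ι → Finset (ι ⊕ (V × Fin D)) → Prop := fun e S => Disjoint S ((s e).biUnion K)
  have hsel : ∀ e ∈ E, θ / D * (1 - r * θ) ≤
      bernExp univ p (fun S => if sel e S then 1 else 0) := by
    intro e he
    rw [bernExp_indicator (subset_univ _) (subset_univ _) (by simp)]
    rw [card_singleton, pow_one]
    refine mul_le_mul_of_nonneg_left ?_ hp
    have h1 : #(((s e).biUnion K).erase (Sum.inl e)) ≤ r * D :=
      calc _ ≤ #((s e).biUnion K) := card_erase_le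
        _ ≤ ∑ v ∈ s e, #(K v) := card_biUnion_le
        _ = r * D := by simp [hK, hEr e he]
    calc 1 - r * θ = 1 + ((r * D : ℕ) : ℝ) * (-p) := by push_cast; rw [← hpD]; ring
      _ ≤ (1 + (-p)) ^ (r * D) := one_add_mul_le_pow (by linarith) _
      _ = (1 - p) ^ (r * D) := by rw [← sub_eq_add_neg]
      _ ≤ _ := pow_le_pow_of_le_one (by linarith) (by linarith) h1
  have hsur : ∀ e ∈ E, ((1 - p) ^ D) ^ r ≤ bernExp univ p (fun S => if sur e S then 1 else 0) := by
    intro e he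
    have := pow_le_bernExp_avoid hp hp1 hK (s e)
    rwa [hEr e he] at this
  have hexp : #E * (p * (1 - r * θ) + a * (((1 - p) ^ D) ^ r - r * (5 * r ^ 2 * δ / τ ^ 2)))
      ≤ bernExp univ p (fun S => ∑ e ∈ E, ((if sel e S then 1 else 0) +
        a * ((if sur e S then 1 else 0) - ∑ v ∈ s e, if bad v S then 1 else 0))) := by
    rw [bernExp_sum]
    rw [← nsmul_eq_mul, ← Finset.sum_const]
    refine Finset.sum_le_sum fun e he => ?_
    rw [bernExp_add, bernExp_mul_left, bernExp_sub, bernExp_sum]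
    have h1 : ∑ v ∈ s e, bernExp univ p (fun S => if bad v S then 1 else 0)
        ≤ r * (5 * r ^ 2 * δ / τ ^ 2) := by
      calc _ ≤ ∑ v ∈ s e, 5 * r ^ 2 * δ / τ ^ 2 := Finset.sum_le_sum fun v _ => hbad v
        _ = _ := by simp [hEr e he]
    have h2 := hsel e he
    have h3 := hsur e he
    gcongr
  obtain ⟨S, -, hS⟩ := exists_bernExp_le (Ω := univ) hp hp1 (fun S => ∑ e ∈ E,
    ((if sel e S then 1 else 0) +
        a * ((if sur e S then 1 else 0) - ∑ v ∈ s e, if bad v S then 1 else 0)))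
  refine ⟨{e ∈ E | sel e S}, filter_subset _ _,
    {e ∈ E | sur e S ∧ ∀ v ∈ s e, ¬ bad v S}, filter_subset _ _, ?_, ?_, ?_, ?_⟩
  · intro e he e' he' hne
    rw [mem_coe, mem_filter] at he he'
    refine Finset.disjoint_left.2 fun v hv hv' => ?_
    have h1 : Sum.inl e' ∈ ((s e).biUnion K).erase (Sum.inl e) :=
      mem_erase.2 ⟨fun h => hne (Sum.inl_injective h).symm,
        mem_biUnion.2 ⟨v, hv, (hinl e' he'.1 v).2 hv'⟩⟩
    exact Finset.disjoint_left.1 he.2.2 (he'.2.1 (mem_singleton_self _)) h1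
  · intro e he e' he'
    simp only [mem_filter] at he he'
    refine Finset.disjoint_left.2 fun v hv hv' => ?_
    exact Finset.disjoint_left.1 he'.2.1 (he.2.1 (mem_singleton_self _))
      (mem_biUnion.2 ⟨v, hv', (hinl e he.1 v).2 hv⟩)
  · intro v
    by_cases hv : ({e ∈ ({e ∈ E | sur e S ∧ ∀ v ∈ s e, ¬ bad v S} : Finset ι) | v ∈ s e}).Nonempty
    · obtain ⟨e, he⟩ := hv
      simp only [mem_filter] at he
      have h1 := not_lt.1 (he.1.2.2 v he.2)
      refine le_trans ?_ h1
      rw [card_eq_sum_ones]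
      push_cast
      rw [Finset.sum_filter, Finset.sum_filter, Finset.sum_filter]
      refine Finset.sum_le_sum fun e' he' => ?_
      by_cases h2 : v ∈ s e'
      · by_cases h3 : sur e' S
        · have h4 : Disjoint S (((s e').erase v).biUnion K) :=
            Disjoint.mono_right (biUnion_subset_biUnion_of_subset_left _ (erase_subset _ _)) h3
          simp only [Y, h2, h4, if_true]
          split_ifs <;> norm_num
        · simp only [h3, h2, false_and, if_false, if_true, Y]
          split_ifs <;> norm_num
      · simp [h2]
    · rw [not_nonempty_iff_eq_empty.1 hv]
      have : 0 ≤ q := pow_nonneg (pow_nonneg (by linarith) _) _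
      simp only [card_empty, Nat.cast_zero]
      positivity
  · refine (hexp.trans hS).trans ?_
    rw [Finset.sum_add_distrib, ← Finset.mul_sum]
    have h1 : ∑ e ∈ E, (if sel e S then (1 : ℝ) else 0) = #{e ∈ E | sel e S} :=
      Finset.sum_boole _ _
    rw [h1]
    gcongr
    rw [card_eq_sum_ones]
    push_cast
    rw [Finset.sum_filter]
    refine Finset.sum_le_sum fun e he => ?_
    have hnn : ∀ v ∈ s e, (0 : ℝ) ≤ if bad v S then 1 else 0 := fun v _ => by
      split_ifs <;> norm_num
    by_cases h2 : sur e S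
    · by_cases h3 : ∀ v ∈ s e, ¬ bad v S
      · have := Finset.sum_nonneg hnn
        rw [if_pos h2, if_pos ⟨h2, h3⟩]
        linarith
      · rw [if_pos h2, if_neg (fun h => h3 h.2)]
        push Not at h3
        obtain ⟨v, hv, hb⟩ := h3
        have := Finset.single_le_sum hnn hv
        rw [if_pos hb] at this
        linarith
    · rw [if_neg h2, if_neg (fun h : sur e S ∧ _ => h2 h.1)]
      linarith [Finset.sum_nonneg hnn]

/-- Every `r`-uniform hypergraph with maximum degree at most `D` and codegrees much smaller
than `D` has a matching with at least `a |E| / D` edges. -/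
def MatchingRatio (r : ℕ) (a : ℝ) : Prop :=
  ∃ δ : ℝ, 0 < δ ∧ ∀ (ι V : Type) [Fintype ι] [DecidableEq ι] [Fintype V] [DecidableEq V]
    (s : ι → Finset V) (E : Finset ι) (D : ℕ),
    (∀ e ∈ E, #(s e) = r) → (∀ v, #{e ∈ E | v ∈ s e} ≤ D) →
    (∀ v w, v ≠ w → (#{e ∈ E | v ∈ s e ∧ w ∈ s e} : ℝ) ≤ δ * D) →
    ∃ M ⊆ E, (M : Set ι).PairwiseDisjoint s ∧ a * #E ≤ D * #M

theorem MatchingRatio.mono {r : ℕ} {a b : ℝ} (h : MatchingRatio r b) (hab : a ≤ b) :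
    MatchingRatio r a := by
  obtain ⟨δ, hδ, H⟩ := h
  refine ⟨δ, hδ, fun ι V _ _ _ _ s E D h1 h2 h3 => ?_⟩
  obtain ⟨M, hM, hM1, hM2⟩ := H ι V s E D h1 h2 h3
  exact ⟨M, hM, hM1, (mul_le_mul_of_nonneg_right hab (Nat.cast_nonneg _)).trans hM2⟩

theorem MatchingRatio.step {r : ℕ} {a θ : ℝ} (hr : 2 ≤ r) (ha : 0 ≤ a) (ha1 : a ≤ 1)
    (hθ : 0 < θ) (hθ1 : θ < 1) (h : MatchingRatio r a) :
    MatchingRatio r (θ * (1 - r * θ) + ((1 - θ) * a - θ ^ 2)) := by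
  obtain ⟨δ', hδ', H⟩ := h
  have hr0 : (0 : ℝ) < r := by exact_mod_cast (by omega : 0 < r)
  set q₀ := (1 - θ) ^ (r - 1) with hq₀
  have hq₀p : 0 < q₀ := pow_pos (by linarith) _
  have hq₀1 : q₀ ≤ 1 := pow_le_one₀ (by linarith) (by linarith)
  set τ := θ ^ 2 * q₀ / 4 with hτ
  have hτp : 0 < τ := by positivity
  set δ := min (min τ (δ' * q₀)) (θ ^ 2 * q₀ * τ ^ 2 / (10 * r ^ 3)) with hδ
  have hδp : 0 < δ := by positivity
  have hδ1 : δ ≤ τ := (min_le_left _ _).trans (min_le_left _ _)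
  have hδ2 : δ ≤ δ' * q₀ := (min_le_left _ _).trans (min_le_right _ _)
  have hδ3 : δ ≤ θ ^ 2 * q₀ * τ ^ 2 / (10 * r ^ 3) := min_le_right _ _
  refine ⟨δ, hδp, fun ι V _ _ _ _ s E D hEr hdeg hcod => ?_⟩
  rcases E.eq_empty_or_nonempty with rfl | ⟨e₀, he₀⟩
  · exact ⟨∅, by simp, by simp, by simp⟩
  have hδD : 1 ≤ δ * D := by
    obtain ⟨v, hv, w, hw, hvw⟩ := Finset.one_lt_card.1 (by rw [hEr e₀ he₀]; omega : 1 < #(s e₀))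
    refine le_trans ?_ (hcod v w hvw)
    have : 0 < #{e ∈ E | v ∈ s e ∧ w ∈ s e} := card_pos.2 ⟨e₀, by simp [he₀, hv, hw]⟩
    exact_mod_cast this
  have hD : 0 < D := by
    rcases Nat.eq_zero_or_pos D with h | h
    · subst h; norm_num at hδD
    · exact h
  have hD' : (0 : ℝ) < D := by exact_mod_cast hD
  have hD1 : (1 : ℝ) ≤ D := by exact_mod_cast hD
  have hp1 : θ / D ≤ 1 := by rw [div_le_one hD']; linarith
  set S := (1 - θ / D) ^ D with hS
  have hSθ : 1 - θ ≤ S := by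
    calc 1 - θ = 1 + (D : ℝ) * (-(θ / D)) := by field_simp; ring
      _ ≤ (1 + (-(θ / D))) ^ D := one_add_mul_le_pow (by linarith) _
      _ = S := by rw [hS, ← sub_eq_add_neg]
  have hS1 : S ≤ 1 := pow_le_one₀ (by linarith) (by linarith [div_nonneg hθ.le hD'.le])
  set q := S ^ (r - 1) with hq
  have hqq : q₀ ≤ q := pow_le_pow_left₀ (by linarith) hSθ _
  have hSr : S ^ r = S * q := by rw [hq, ← pow_succ']; congr 1; omega
  set D₁ := ⌈(q + τ) * D⌉₊ with hD₁
  have hD₁l : (q + τ) * D ≤ D₁ := Nat.le_ceil _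
  have hD₁u : (D₁ : ℝ) ≤ (q + 2 * τ) * D := by
    have := (Nat.ceil_lt_add_one (by positivity : 0 ≤ (q + τ) * D)).le
    nlinarith
  have hD₁p : (0 : ℝ) < D₁ := lt_of_lt_of_le (by positivity) hD₁l
  obtain ⟨M, hM, E', hE', hMd, hMM, hdeg', hcount⟩ := exists_nibble_step (a := a / D₁) hD hθ.le
    hθ1.le hδp.le hτp hr (by positivity) s E hEr hdeg hcod
  obtain ⟨N, hN, hNd, hNc⟩ := H ι V s E' D₁ (fun e he => hEr e (hE' he))
    (fun v => by exact_mod_cast (hdeg' v).trans hD₁l)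
    (fun v w hvw => by
      refine le_trans ?_ ((hcod v w hvw).trans ?_)
      · exact_mod_cast card_le_card (filter_subset_filter _ hE')
      · calc δ * D ≤ δ' * q₀ * D := by gcongr
          _ ≤ δ' * ((q + τ) * D) := by
            rw [mul_assoc]; gcongr; linarith
          _ ≤ δ' * D₁ := by gcongr)
  have hMN : Disjoint M N := Finset.disjoint_left.2 fun e he he' => by
    have h1 := hMM e he e (hN he')
    rw [disjoint_self] at h1
    have h2 := hEr e (hM he)
    rw [h1] at h2
    simp at h2
    omega
  refine ⟨M ∪ N, union_subset hM (hN.trans hE'), ?_, ?_⟩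
  · rw [coe_union]
    refine (Set.pairwiseDisjoint_union).2 ⟨hMd, hNd, fun e he e' he' _ => hMM e he e' (hN he')⟩
  · rw [card_union_of_disjoint hMN]
    push_cast
    have h1 : a / D₁ * #E' ≤ #N := by
      rw [div_mul_eq_mul_div, div_le_iff₀ hD₁p]
      linarith
    have h2 : (D : ℝ) * (#E * (θ / D * (1 - r * θ) +
        a / D₁ * (S ^ r - r * (5 * r ^ 2 * δ / τ ^ 2)))) ≤ D * (#M + #N) := by
      gcongr
      linarith
    refine le_trans ?_ h2
    have h3 : (D : ℝ) * (#E * (θ / D * (1 - r * θ) +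
        a / D₁ * (S ^ r - r * (5 * r ^ 2 * δ / τ ^ 2)))) =
        (θ * (1 - r * θ) + a * (S * q - 5 * r ^ 3 * δ / τ ^ 2) * (D / D₁)) * #E := by
      rw [hSr]; field_simp
    rw [h3]
    gcongr ?_ * _
    gcongr _ + ?_
    have h5 : 5 * r ^ 3 * δ / τ ^ 2 ≤ θ ^ 2 * q₀ / 2 := by
      rw [div_le_iff₀ (by positivity)]
      rw [le_div_iff₀ (by positivity)] at hδ3
      linarith
    have h6 : (1 - θ) * q ≤ S * q := by gcongr
    rw [← mul_div_assoc, le_div_iff₀ hD₁p]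
    set x := 5 * r ^ 3 * δ / τ ^ 2
    have h7 : a * x ≤ 1 * (θ ^ 2 * q₀ / 2) := by gcongr
    have h8 : θ ^ 2 * q₀ ≤ θ ^ 2 * q := by gcongr
    have h9 : a * ((1 - θ) * q) ≤ a * (S * q) := by gcongr
    have h10 : 0 ≤ θ ^ 2 * q₀ := by positivity
    have h11 : (1 - θ) * a ≤ 1 := mul_le_one₀ (by linarith) ha ha1
    have h12 : ((1 - θ) * a - θ ^ 2) * τ ≤ 1 * τ := by
      gcongr; linarith [sq_nonneg θ]
    clear_value x τ q q₀ S
    rcases le_total ((1 - θ) * a - θ ^ 2) 0 with h13 | h13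
    · have h14 : q * D ≤ D₁ := le_trans (by gcongr; linarith) hD₁l
      refine (mul_le_mul_of_nonpos_left h14 h13).trans ?_
      rw [← mul_assoc]
      gcongr ?_ * _
      linarith
    · refine (mul_le_mul_of_nonneg_left hD₁u h13).trans ?_
      rw [← mul_assoc]
      gcongr ?_ * _
      linarith

theorem matchingRatio_of_lt_one {r : ℕ} {a : ℝ} (hr : 2 ≤ r) (ha : a < 1) :
    MatchingRatio r a := by
  rcases le_or_gt a 0 with ha0 | ha0
  · refine ⟨1, one_pos, fun ι V _ _ _ _ s E D _ _ _ => ⟨∅, by simp, by simp, ?_⟩⟩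
    simpa using mul_nonpos_of_nonpos_of_nonneg ha0 (Nat.cast_nonneg _)
  have hr0 : (0 : ℝ) < r := by exact_mod_cast (by omega : 0 < r)
  set θ := (1 - a) / (2 * (r + 1)) with hθ
  have hθ0 : 0 < θ := div_pos (by linarith) (by positivity)
  have hθr : (r + 1) * θ = (1 - a) / 2 := by rw [hθ]; field_simp
  have hθ1 : θ < 1 := by nlinarith
  set b := 1 - (r + 1) * θ with hb
  have hb0 : 0 < b := by rw [hb]; linarith
  have hb1 : b ≤ 1 := by rw [hb]; nlinarith
  have key : ∀ k : ℕ, MatchingRatio r ((1 - (1 - θ) ^ k) * b) := by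
    intro k
    have hk0 : 0 ≤ (1 - θ) ^ k := pow_nonneg (by linarith) k
    have hk1 : (1 - θ) ^ k ≤ 1 := pow_le_one₀ (by linarith) (by linarith)
    induction k with
    | zero =>
      refine ⟨1, one_pos, fun ι V _ _ _ _ s E D _ _ _ => ⟨∅, by simp, by simp, by simp⟩⟩
    | succ k ih =>
      have hk0 : 0 ≤ (1 - θ) ^ k := pow_nonneg (by linarith) k
      have hk1 : (1 - θ) ^ k ≤ 1 := pow_le_one₀ (by linarith) (by linarith)
      have := (ih hk0 hk1).step hr (mul_nonneg (by linarith) hb0.le)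
        (mul_le_one₀ (by linarith) hb0.le hb1) hθ0 hθ1
      convert this using 1
      rw [hb, pow_succ]; ring
  obtain ⟨k, hk⟩ := exists_pow_lt_of_lt_one (show 0 < (1 - a) / 2 by linarith)
    (show 1 - θ < 1 by linarith)
  refine (key k).mono ?_
  have : b = 1 - (1 - a) / 2 := by rw [hb, hθr]
  rw [this]
  nlinarith

end Nibble

section Counting

open Finset Function

variable {ι V : Type*} [Fintype ι] [DecidableEq ι] [Fintype V]

theorem sum_sum_update {R : Type*} [CommSemiring R] (b : ι) (g : (ι → V) → R) :
    ∑ x : ι → V, ∑ y : V, g (update x b y) = Fintype.card V * ∑ x, g x := by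
  have hinv : Function.Involutive
      (fun z : (ι → V) × V => ((update z.1 b z.2, z.1 b) : (ι → V) × V)) := by
    rintro ⟨x, y⟩; simp
  rw [← Fintype.sum_prod_type' (f := fun x y => g (update x b y)),
    Fintype.sum_equiv hinv.toPerm (fun z : (ι → V) × V => g (update z.1 b z.2))
      (fun z => g z.1) (fun z => rfl), Fintype.sum_prod_type]
  simp [Finset.mul_sum]

theorem card_filter_mul_card_le (b : ι) {P Q : (ι → V) → Prop} [DecidablePred P]
    [DecidablePred Q] {k : ℝ}
    (hQ : ∀ x y, Q (update x b y) → Q x) (hPQ : ∀ x, P x → Q x)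
    (hk : ∀ x, Q x → (#{y | P (update x b y)} : ℝ) ≤ k) :
    (#{x | P x} : ℝ) * Fintype.card V ≤ k * #{x | Q x} := by
  have h := sum_sum_update (R := ℝ) b (fun x : ι → V => if P x then (1 : ℝ) else 0)
  rw [Finset.sum_boole, mul_comm] at h
  rw [← h]
  calc ∑ x : ι → V, ∑ y, (if P (update x b y) then (1 : ℝ) else 0)
      ≤ ∑ x : ι → V, k * (if Q x then 1 else 0) := by
        refine Finset.sum_le_sum fun x _ => ?_
        rw [Finset.sum_boole]
        split_ifs with hx
        · simpa using hk x hx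
        · have : ∀ y, ¬ P (update x b y) := fun y hy => hx (hQ x y (hPQ _ hy))
          simp [this]
    _ = _ := by rw [← Finset.mul_sum, Finset.sum_boole]

/-- `g` has cut norm at most `γ |V|²`. -/
def CutNormLE (g : V → V → ℝ) (γ : ℝ) : Prop :=
  ∀ u v : V → ℝ, (∀ y, 0 ≤ u y ∧ u y ≤ 1) → (∀ z, 0 ≤ v z ∧ v z ≤ 1) →
    |∑ y, ∑ z, u y * v z * g y z| ≤ γ * (Fintype.card V : ℝ) ^ 2

theorem CutNormLE.abs_sum_le {g : V → V → ℝ} {γ : ℝ} (hg : CutNormLE g γ)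
    [Nonempty V] {a b : ι} (hab : a ≠ b) {u v : (ι → V) → ℝ}
    (hu : ∀ x, 0 ≤ u x ∧ u x ≤ 1) (hv : ∀ x, 0 ≤ v x ∧ v x ≤ 1)
    (hub : ∀ x y, u (update x b y) = u x) (hva : ∀ x y, v (update x a y) = v x) :
    |∑ x, u x * v x * g (x a) (x b)| ≤ γ * (Fintype.card V : ℝ) ^ Fintype.card ι := by
  have hN : (0 : ℝ) < Fintype.card V := by exact_mod_cast Fintype.card_pos
  have h1 := sum_sum_update (R := ℝ) b (fun x : ι → V => u x * v x * g (x a) (x b))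
  have h2 := sum_sum_update (R := ℝ) a (fun x : ι → V =>
    ∑ z, u (update x b z) * v (update x b z) * g (update x b z a) (update x b z b))
  rw [h1] at h2
  have h3 : ∀ x : ι → V, |∑ y, ∑ z, u (update (update x a y) b z) * v (update (update x a y) b z)
      * g (update (update x a y) b z a) (update (update x a y) b z b)|
      ≤ γ * (Fintype.card V : ℝ) ^ 2 := by
    intro x
    have := hg (fun y => u (update x a y)) (fun z => v (update x b z)) (fun y => hu _)
      (fun z => hv _)
    convert this using 5 with y _ z _
    · rw [hub, update_comm hab, hva]
    · simp [update_of_ne hab]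
  have h4 : (Fintype.card V : ℝ) ^ 2 * |∑ x, u x * v x * g (x a) (x b)| ≤
      (Fintype.card V : ℝ) ^ 2 * (γ * (Fintype.card V : ℝ) ^ Fintype.card ι) := by
    calc (Fintype.card V : ℝ) ^ 2 * |∑ x, u x * v x * g (x a) (x b)|
        = |Fintype.card V * (Fintype.card V * ∑ x, u x * v x * g (x a) (x b))| := by
          rw [abs_mul, abs_mul, Nat.abs_cast]; ring
      _ ≤ ∑ x : ι → V, γ * (Fintype.card V : ℝ) ^ 2 := by
          rw [← h2]
          exact (abs_sum_le_sum_abs _ _).trans (Finset.sum_le_sum fun x _ => h3 x)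
      _ = _ := by simp; ring
  exact le_of_mul_le_mul_left h4 (by positivity)

/-- Weighted counting lemma: in a `[0,1]`-valued kernel close to `d` in cut norm, the weighted
number of maps respecting the pairs in `P` is as in a random kernel. -/
theorem counting_lemma [Nonempty V] {k : ℕ} {A : V → V → ℝ} {d γ : ℝ}
    (hA : ∀ y z, 0 ≤ A y z ∧ A y z ≤ 1) (hd0 : 0 ≤ d) (hd2 : d ≤ 2)
    (hcut : CutNormLE (fun y z => A y z - d) γ) (P : Finset (Fin k × Fin k)) (hP : ∀ p ∈ P, p.1 < p.2)
    (w : (Fin k → V) → ℝ) (hw : ∀ x, 0 ≤ w x ∧ w x ≤ 1)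
    (hwP : ∀ p ∈ P, (∀ x y, w (update x p.1 y) = w x) ∨ (∀ x y, w (update x p.2 y) = w x)) :
    |∑ x, w x * ∏ p ∈ P, A (x p.1) (x p.2) - d ^ #P * ∑ x, w x|
      ≤ (2 ^ #P - 1) * (γ * (Fintype.card V : ℝ) ^ k) := by
  induction P using Finset.induction_on with
  | empty => simp
  | insert p P hp ih =>
    have ih' := ih (fun q hq => hP q (mem_insert_of_mem hq))
      (fun q hq => hwP q (mem_insert_of_mem hq))
    have hp12 := hP p (mem_insert_self _ _)
    have hind : ∀ q ∈ P, (q.1 ≠ p.2 ∧ q.2 ≠ p.2) ∨ (q.1 ≠ p.1 ∧ q.2 ≠ p.1) := by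
      intro q hq
      have h1 := hP q (mem_insert_of_mem hq)
      have h2 : q ≠ p := fun h => hp (h ▸ hq)
      by_contra hcon
      simp only [not_or, not_and_or, not_not] at hcon
      obtain ⟨h3 | h3, h4 | h4⟩ := hcon
      · exact hp12.ne (h4.symm.trans h3)
      · exact absurd h1 (by rw [h3, h4]; exact hp12.not_gt)
      · exact h2 (Prod.ext h4 h3)
      · exact hp12.ne (h4.symm.trans h3)
    have hprod : ∀ (Q : Finset (Fin k × Fin k)) (x : Fin k → V), 0 ≤ ∏ q ∈ Q, A (x q.1) (x q.2) ∧
        ∏ q ∈ Q, A (x q.1) (x q.2) ≤ 1 := fun Q x =>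
      ⟨Finset.prod_nonneg fun q _ => (hA _ _).1,
        Finset.prod_le_one (fun q _ => (hA _ _).1) fun q _ => (hA _ _).2⟩
    let Q₁ : Finset (Fin k × Fin k) := {q ∈ P | q.1 ≠ p.2 ∧ q.2 ≠ p.2}
    let Q₂ : Finset (Fin k × Fin k) := {q ∈ P | ¬ (q.1 ≠ p.2 ∧ q.2 ≠ p.2)}
    have hsplit : ∀ x : Fin k → V, (∏ q ∈ Q₁, A (x q.1) (x q.2)) * ∏ q ∈ Q₂, A (x q.1) (x q.2)
        = ∏ q ∈ P, A (x q.1) (x q.2) := fun x => prod_filter_mul_prod_filter_not _ _ _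
    have hQ₁ : ∀ (x : Fin k → V) (y : V), ∏ q ∈ Q₁, A (update x p.2 y q.1) (update x p.2 y q.2)
        = ∏ q ∈ Q₁, A (x q.1) (x q.2) := fun x y =>
      Finset.prod_congr rfl fun q hq => by
        have := (mem_filter.1 hq).2
        rw [update_of_ne this.1, update_of_ne this.2]
    have hQ₂ : ∀ (x : Fin k → V) (y : V), ∏ q ∈ Q₂, A (update x p.1 y q.1) (update x p.1 y q.2)
        = ∏ q ∈ Q₂, A (x q.1) (x q.2) := fun x y =>
      Finset.prod_congr rfl fun q hq => by
        have h1 := mem_filter.1 hq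
        have := (hind q h1.1).resolve_left h1.2
        rw [update_of_ne this.1, update_of_ne this.2]
    have hmul : ∀ a b : ℝ, (0 ≤ a ∧ a ≤ 1) → (0 ≤ b ∧ b ≤ 1) → 0 ≤ a * b ∧ a * b ≤ 1 :=
      fun a b ha hb => ⟨mul_nonneg ha.1 hb.1, mul_le_one₀ ha.2 hb.1 hb.2⟩
    have herr : |∑ x, (w x * ∏ q ∈ P, A (x q.1) (x q.2)) * (A (x p.1) (x p.2) - d)|
        ≤ γ * (Fintype.card V : ℝ) ^ k := by
      rcases hwP p (mem_insert_self _ _) with h | h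
      · have := hcut.abs_sum_le hp12.ne (u := fun x => ∏ q ∈ Q₁, A (x q.1) (x q.2))
          (v := fun x => w x * ∏ q ∈ Q₂, A (x q.1) (x q.2)) (fun x => hprod _ x)
          (fun x => hmul _ _ (hw x) (hprod _ x)) hQ₁ (fun x y => by rw [h, hQ₂])
        rw [Fintype.card_fin] at this
        convert this using 4 with x
        rw [← hsplit]; ring
      · have := hcut.abs_sum_le hp12.ne (u := fun x => w x * ∏ q ∈ Q₁, A (x q.1) (x q.2))
          (v := fun x => ∏ q ∈ Q₂, A (x q.1) (x q.2)) (fun x => hmul _ _ (hw x) (hprod _ x))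
          (fun x => hprod _ x) (fun x y => by rw [h, hQ₁]) hQ₂
        rw [Fintype.card_fin] at this
        convert this using 4 with x
        rw [← hsplit]; ring
    have heq : ∑ x, w x * ∏ q ∈ insert p P, A (x q.1) (x q.2) - d ^ #(insert p P) * ∑ x, w x
        = ∑ x, (w x * ∏ q ∈ P, A (x q.1) (x q.2)) * (A (x p.1) (x p.2) - d)
          + d * (∑ x, w x * ∏ q ∈ P, A (x q.1) (x q.2) - d ^ #P * ∑ x, w x) := by
      have h1 : ∑ x, w x * ∏ q ∈ insert p P, A (x q.1) (x q.2) =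
          ∑ x, (w x * ∏ q ∈ P, A (x q.1) (x q.2)) * (A (x p.1) (x p.2) - d)
          + d * ∑ x, w x * ∏ q ∈ P, A (x q.1) (x q.2) := by
        rw [Finset.mul_sum, ← Finset.sum_add_distrib]
        refine Finset.sum_congr rfl fun x _ => ?_
        rw [prod_insert hp]; ring
      rw [card_insert_of_notMem hp, h1]; ring
    rw [heq]
    refine (abs_add_le _ _).trans ?_
    rw [abs_mul, abs_of_nonneg hd0, card_insert_of_notMem hp]
    have h1 : d * |∑ x, w x * ∏ q ∈ P, A (x q.1) (x q.2) - d ^ #P * ∑ x, w x| ≤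
      2 * ((2 ^ #P - 1) * (γ * (Fintype.card V : ℝ) ^ k)) := by gcongr
    rw [pow_succ]
    linarith

end Counting

section Quasirandom

open Finset

theorem card_le_two_mul_card_image_mk {V : Type*} [DecidableEq V] (B : Finset (V × V)) :
    #B ≤ 2 * #(B.image fun p => s(p.1, p.2)) := by
  refine card_le_mul_card_image B 2 fun e _ => ?_
  induction e using Sym2.ind with
  | _ a b =>
    refine (card_le_card (t := {(a, b), (b, a)}) fun p hp => ?_).trans card_le_two
    have := (mem_filter.1 hp).2
    rw [Sym2.eq_iff] at this
    simp only [mem_insert, mem_singleton, Prod.ext_iff]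
    exact this

open Classical in
theorem degIn_univ_eq {n : ℕ} (G : SimpleGraph (Fin n)) (v : Fin n) :
    (degIn G v Set.univ : ℝ) = ∑ y, if G.Adj y v then (1 : ℝ) else 0 := by
  rw [Finset.sum_boole, degIn, Set.inter_univ, Set.ncard_eq_toFinset_card']
  congr 2
  ext y
  simp [G.adj_comm]

open Classical in
theorem codegIn_univ_eq {n : ℕ} (G : SimpleGraph (Fin n)) (u v : Fin n) :
    (codegIn G u v Set.univ : ℝ)
      = ∑ y, (if G.Adj y u then (1 : ℝ) else 0) * (if G.Adj y v then 1 else 0) := by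
  have h : ∀ y, (if G.Adj y u then (1 : ℝ) else 0) * (if G.Adj y v then 1 else 0)
      = if G.Adj y u ∧ G.Adj y v then 1 else 0 := fun y => by split_ifs <;> simp_all
  rw [Finset.sum_congr rfl fun y _ => h y, Finset.sum_boole, codegIn, Set.inter_univ, Set.ncard_eq_toFinset_card']
  congr 2
  ext y
  simp [G.adj_comm]

theorem Paper.Quasirandom.abs_degIn_sub_le {n : ℕ} {G : SimpleGraph (Fin n)} {η d : ℝ}
    (hG : Quasirandom G η d) (v : Fin n) : |(degIn G v Set.univ : ℝ) - d * n| ≤ η * n := by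
  simpa [Set.ncard_univ] using hG.1 v (Set.mem_univ v)

theorem Paper.Quasirandom.density_le {n : ℕ} {G : SimpleGraph (Fin n)} {η d : ℝ}
    (hG : Quasirandom G η d) (hn : 0 < n) : d ≤ 1 + η := by
  have h1 := (abs_le.1 (hG.abs_degIn_sub_le ⟨0, hn⟩)).1
  have h2 : (degIn G ⟨0, hn⟩ Set.univ : ℝ) ≤ n := by
    have : degIn G ⟨0, hn⟩ Set.univ ≤ (Set.univ : Set (Fin n)).ncard := Set.ncard_le_ncard (Set.subset_univ _)
    simp only [Set.ncard_univ, Nat.card_eq_fintype_card, Fintype.card_fin] at this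
    exact_mod_cast this
  have hn' : (0 : ℝ) < n := by exact_mod_cast hn
  nlinarith

open Classical in
theorem Paper.Quasirandom.cutNormLE {n : ℕ} {G : SimpleGraph (Fin n)} {η d γ : ℝ}
    (hG : Quasirandom G η d) (hd0 : 0 ≤ d) (hd2 : d ≤ 2) (hγ : 0 ≤ γ)
    (hηγ : 17 * η ≤ γ ^ 2) (hn : 1 ≤ η * n) :
    CutNormLE (fun y z : Fin n => (if G.Adj y z then (1 : ℝ) else 0) - d) γ := by
  have hn0 : (0 : ℝ) ≤ n := Nat.cast_nonneg _
  have hη : 0 < η := by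
    by_contra h
    nlinarith
  set g : Fin n → Fin n → ℝ := fun y z => (if G.Adj y z then (1 : ℝ) else 0) - d with hg
  have hgabs : ∀ y z, |g y z| ≤ 2 := fun y z => by
    rw [hg, abs_le]; dsimp only; split_ifs <;> constructor <;> linarith
  let B : Finset (Fin n × Fin n) := {p | p.1 ≠ p.2 ∧
    ¬ |(codegIn G p.1 p.2 Set.univ : ℝ) - d ^ 2 * n| ≤ η * n}
  have hB : (#B : ℝ) ≤ 2 * (η * n ^ 2) := by
    have h1 := hG.2
    simp only [Set.ncard_univ, Nat.card_eq_fintype_card, Fintype.card_fin, Set.mem_univ,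
      true_and] at h1
    have h2 : #(B.image fun p => s(p.1, p.2)) ≤ {p : Sym2 (Fin n) | ∃ u v, p = s(u, v) ∧ u ≠ v ∧
        ¬ (|(codegIn G u v Set.univ : ℝ) - d ^ 2 * n| ≤ η * n)}.ncard := by
      rw [← Set.ncard_coe_finset]
      refine Set.ncard_le_ncard (fun e he => ?_) (Set.toFinite _)
      obtain ⟨p, hp, rfl⟩ := mem_image.1 he
      have := (mem_filter.1 hp).2
      exact ⟨p.1, p.2, rfl, this.1, this.2⟩
    have h3 := card_le_two_mul_card_image_mk B
    have h4 : (#B : ℝ) ≤ 2 * #(B.image fun p => s(p.1, p.2)) := by exact_mod_cast h3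
    have h5 : (#(B.image fun p => s(p.1, p.2)) : ℝ) ≤ η * n ^ 2 :=
      le_trans (by exact_mod_cast h2) h1
    linarith
  have hcorr : ∀ z z', |∑ y, g y z * g y z'| ≤ 5 * (η * n) +
      4 * n * ((if (z, z') ∈ B then 1 else 0) + if z = z' then 1 else 0) := by
    intro z z'
    have htriv : |∑ y, g y z * g y z'| ≤ 4 * n := by
      calc |∑ y, g y z * g y z'| ≤ ∑ y : Fin n, (4 : ℝ) := by
            refine (abs_sum_le_sum_abs _ _).trans (Finset.sum_le_sum fun y _ => ?_)
            rw [abs_mul]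
            nlinarith [hgabs y z, hgabs y z', abs_nonneg (g y z), abs_nonneg (g y z')]
        _ = 4 * n := by simp [mul_comm]
    by_cases h1 : (z, z') ∈ B
    · rw [if_pos h1]; split_ifs <;> nlinarith
    by_cases h2 : z = z'
    · rw [if_pos h2, if_neg h1]; nlinarith
    rw [if_neg h1, if_neg h2]
    have h3 : |(codegIn G z z' Set.univ : ℝ) - d ^ 2 * n| ≤ η * n := by
      by_contra h
      exact h1 (mem_filter.2 ⟨mem_univ _, h2, h⟩)
    have h4 : ∑ y, g y z * g y z' = codegIn G z z' Set.univ - d * degIn G z Set.univ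
        - d * degIn G z' Set.univ + d ^ 2 * n := by
      rw [degIn_univ_eq, degIn_univ_eq, codegIn_univ_eq, Finset.mul_sum, Finset.mul_sum,
        ← Finset.sum_sub_distrib, ← Finset.sum_sub_distrib]
      have : d ^ 2 * (n : ℝ) = ∑ _y : Fin n, d ^ 2 := by simp [mul_comm]
      rw [this, ← Finset.sum_add_distrib]
      refine Finset.sum_congr rfl fun y _ => ?_
      simp only [hg]; ring
    have h5 := abs_le.1 (hG.abs_degIn_sub_le z)
    have h6 := abs_le.1 (hG.abs_degIn_sub_le z')
    have h7 := abs_le.1 h3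
    have h8 : d * (η * n) ≤ 2 * (η * n) := by gcongr
    rw [h4, abs_le]
    constructor
    · nlinarith [mul_le_mul_of_nonneg_left h5.2 hd0, mul_le_mul_of_nonneg_left h6.2 hd0]
    · nlinarith [mul_le_mul_of_nonneg_left h5.1 hd0, mul_le_mul_of_nonneg_left h6.1 hd0]
  intro u v hu hv
  have hsum : ∑ z, ∑ z', |∑ y, g y z * g y z'| ≤ 17 * η * n ^ 3 := by
    calc ∑ z, ∑ z', |∑ y, g y z * g y z'|
        ≤ ∑ z : Fin n, ∑ z' : Fin n, (5 * (η * n) +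
          4 * n * ((if (z, z') ∈ B then 1 else 0) + if z = z' then 1 else 0)) :=
          Finset.sum_le_sum fun z _ => Finset.sum_le_sum fun z' _ => hcorr z z'
      _ = 5 * (η * n) * n ^ 2 + 4 * n * (#B + n) := by
          have h1 : ∑ z : Fin n, ∑ z' : Fin n, (if (z, z') ∈ B then (1 : ℝ) else 0) = #B := by
            rw [← Fintype.sum_prod_type' (f := fun z z' => if (z, z') ∈ B then (1 : ℝ) else 0)]
            simp
          simp only [Finset.sum_add_distrib, ← Finset.mul_sum, h1]
          simp
          ring
      _ ≤ 17 * η * n ^ 3 := by nlinarith [mul_le_mul_of_nonneg_left hB hn0,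
          mul_le_mul_of_nonneg_left hn (mul_nonneg hn0 hn0)]
  have hmain : (∑ y, ∑ z, u y * v z * g y z) ^ 2 ≤ (γ * (n : ℝ) ^ 2) ^ 2 := by
    have h1 : ∑ y, ∑ z, u y * v z * g y z = ∑ y, u y * ∑ z, v z * g y z := by
      simp [Finset.mul_sum, mul_assoc]
    rw [h1]
    have h2 := Finset.sum_mul_sq_le_sq_mul_sq univ u (fun y => ∑ z, v z * g y z)
    have h3 : ∑ y, u y ^ 2 ≤ n := by
      calc ∑ y, u y ^ 2 ≤ ∑ _y : Fin n, (1 : ℝ) :=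
            Finset.sum_le_sum fun y _ => pow_le_one₀ (hu y).1 (hu y).2
        _ = n := by simp
    have h4 : ∑ y, (∑ z, v z * g y z) ^ 2 ≤ ∑ z, ∑ z', |∑ y, g y z * g y z'| := by
      have : ∑ y, (∑ z, v z * g y z) ^ 2 = ∑ z, ∑ z', v z * v z' * ∑ y, g y z * g y z' := by
        simp_rw [sq, Finset.sum_mul_sum, Finset.mul_sum]
        rw [Finset.sum_comm]
        refine Finset.sum_congr rfl fun z _ => ?_
        rw [Finset.sum_comm]
        refine Finset.sum_congr rfl fun z' _ => Finset.sum_congr rfl fun y _ => by ring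
      rw [this]
      refine Finset.sum_le_sum fun z _ => Finset.sum_le_sum fun z' _ => ?_
      refine (le_abs_self _).trans ?_
      rw [abs_mul, abs_of_nonneg (mul_nonneg (hv z).1 (hv z').1)]
      exact mul_le_of_le_one_left (abs_nonneg _) (mul_le_one₀ (hv z).2 (hv z').1 (hv z').2)
    calc _ ≤ _ := h2
      _ ≤ n * (17 * η * n ^ 3) :=
          mul_le_mul h3 (h4.trans hsum) (Finset.sum_nonneg fun y _ => sq_nonneg _) hn0
      _ = 17 * η * (n ^ 2) ^ 2 := by ring
      _ ≤ γ ^ 2 * (n ^ 2) ^ 2 := by gcongr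
      _ = _ := by ring
  rw [Fintype.card_fin]
  exact abs_le_of_sq_le_sq hmain (by positivity)

end Quasirandom

section Homomorphisms

open Finset Function

variable {V : Type*} {k : ℕ}

/-- `x` maps every pair in `P` to an edge of `G`. -/
def MapsPairs (G : SimpleGraph V) (P : Finset (Fin k × Fin k)) (x : Fin k → V) : Prop :=
  ∀ p ∈ P, G.Adj (x p.1) (x p.2)

open Classical in
/-- The fibre of `π` through `x` contains too many maps sending the pairs in `Q` to edges. -/
def Overloaded [Fintype V] {κ : Type*} (G : SimpleGraph V) (Q : Finset (Fin k × Fin k))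
    (π : (Fin k → V) → κ) (m : ℝ) (x : Fin k → V) : Prop :=
  m * #{y | π y = π x} < #{y | MapsPairs G Q y ∧ π y = π x}

open Classical in
theorem abs_card_mapsPairs_sub_le [Fintype V] [Nonempty V] {G : SimpleGraph V} {d γ : ℝ}
    (hd0 : 0 ≤ d) (hd2 : d ≤ 2)
    (hcut : CutNormLE (fun y z => (if G.Adj y z then (1 : ℝ) else 0) - d) γ)
    (Q : Finset (Fin k × Fin k)) (hQ : ∀ p ∈ Q, p.1 < p.2) (B : Finset (Fin k → V))
    (hB : ∀ p ∈ Q, (∀ x y, update x p.1 y ∈ B ↔ x ∈ B) ∨ (∀ x y, update x p.2 y ∈ B ↔ x ∈ B)) :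
    |(#{x ∈ B | MapsPairs G Q x} : ℝ) - d ^ #Q * #B|
      ≤ (2 ^ #Q - 1) * (γ * (Fintype.card V : ℝ) ^ k) := by
  have h := counting_lemma (A := fun y z => if G.Adj y z then (1 : ℝ) else 0)
    (fun y z => by split_ifs <;> simp) hd0 hd2 hcut Q hQ (fun x => if x ∈ B then (1 : ℝ) else 0)
    (fun x => by split_ifs <;> simp)
    (fun p hp => (hB p hp).imp (fun h x y => by simp only [h]) (fun h x y => by simp only [h]))
  convert h using 3
  · simp_rw [Finset.prod_ite_zero, prod_const_one, ite_mul, one_mul, zero_mul]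
    rw [Finset.sum_ite_mem, univ_inter, Finset.sum_boole]
    congr! 3
  · simp

open Classical in
theorem card_overloaded_le [Fintype V] [Nonempty V] {κ : Type*} {G : SimpleGraph V} {d γ δ : ℝ}
    (hd0 : 0 ≤ d) (hd2 : d ≤ 2) (hγ : 0 ≤ γ)
    (hcut : CutNormLE (fun y z => (if G.Adj y z then (1 : ℝ) else 0) - d) γ)
    (Q : Finset (Fin k × Fin k)) (hQ : ∀ p ∈ Q, p.1 < p.2) (π : (Fin k → V) → κ)
    (hπ : ∀ p ∈ Q, (∀ x y, π (update x p.1 y) = π x) ∨ (∀ x y, π (update x p.2 y) = π x)) :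
    δ * d ^ #Q * #{x | Overloaded G Q π ((1 + δ) * d ^ #Q) x}
      ≤ 2 ^ #Q * (γ * (Fintype.card V : ℝ) ^ k) := by
  set B : Finset (Fin k → V) := {x | Overloaded G Q π ((1 + δ) * d ^ #Q) x} with hBdef
  have hmem : ∀ x y, π y = π x → (y ∈ B ↔ x ∈ B) := fun x y h => by
    rw [hBdef, mem_filter_univ, mem_filter_univ, Overloaded, Overloaded, h]
  have h1 := (abs_le.1 (abs_card_mapsPairs_sub_le hd0 hd2 hcut Q hQ B fun p hp =>
    (hπ p hp).imp (fun h x y => hmem _ _ (h x y)) (fun h x y => hmem _ _ (h x y)))).2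
  have h2 : (1 + δ) * d ^ #Q * #B ≤ (#{x ∈ B | MapsPairs G Q x} : ℝ) := by
    rw [card_eq_sum_card_fiberwise (f := π) (t := B.image π)
        (fun x hx => mem_image_of_mem _ hx),
      card_eq_sum_card_fiberwise (s := {x ∈ B | MapsPairs G Q x}) (f := π) (t := B.image π)
        (fun x hx => mem_image_of_mem _ (filter_subset _ _ hx))]
    push_cast
    rw [Finset.mul_sum]
    refine Finset.sum_le_sum fun c hc => ?_
    obtain ⟨x, hx, rfl⟩ := mem_image.1 hc
    have h3 : Overloaded G Q π ((1 + δ) * d ^ #Q) x := (mem_filter.1 hx).2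
    have h4 : #{y ∈ B | π y = π x} = #{y | π y = π x} := by
      congr 1
      ext y
      simp only [mem_filter, mem_univ, true_and, and_iff_right_iff_imp]
      exact fun hy => (hmem x y hy).2 hx
    have h5 : #{y ∈ {x ∈ B | MapsPairs G Q x} | π y = π x}
        = #{y | MapsPairs G Q y ∧ π y = π x} := by
      congr 1
      ext y
      simp only [mem_filter, mem_univ, true_and]
      exact ⟨fun h => ⟨h.1.2, h.2⟩, fun h => ⟨⟨(hmem x y h.2).2 hx, h.1⟩, h.2⟩⟩
    rw [h4, h5]
    exact h3.le
  have h3 : 0 ≤ γ * (Fintype.card V : ℝ) ^ k := by positivity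
  linarith

end Homomorphisms

section SpreadFamily

open Finset Function

section

variable {ι V : Type*} [Fintype ι] [DecidableEq ι] [Fintype V]

theorem card_apply_mem_mul_le [DecidableEq V] (a : ι) (S : Finset V) :
    (#{x : ι → V | x a ∈ S} : ℝ) * Fintype.card V
      ≤ #S * (Fintype.card V : ℝ) ^ Fintype.card ι := by
  have := card_filter_mul_card_le (P := fun x : ι → V => x a ∈ S) (Q := fun _ => True)
    (k := #S) a (fun _ _ _ => trivial) (fun _ _ => trivial) (fun x _ => by simp)
  simpa using this

theorem card_apply_mem_and_mul_le [DecidableEq V] {a : ι} {Q : (ι → V) → Prop} [DecidablePred Q]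
    (hQ : ∀ x y, Q (update x a y) → Q x) (S : Finset V) :
    (#{x : ι → V | Q x ∧ x a ∈ S} : ℝ) * Fintype.card V ≤ #S * #{x | Q x} := by
  refine card_filter_mul_card_le a hQ (fun _ h => h.1) (fun x _ => ?_)
  exact_mod_cast card_le_card fun y hy => by simpa using (mem_filter.1 hy).2.2

theorem card_apply_eq_apply_mul_le [DecidableEq V] {a b : ι} (hab : a ≠ b) :
    (#{x : ι → V | x a = x b} : ℝ) * Fintype.card V
      ≤ (Fintype.card V : ℝ) ^ Fintype.card ι := by
  have := card_filter_mul_card_le (P := fun x : ι → V => x a = x b) (Q := fun _ => True)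
    (k := 1) b (fun _ _ _ => trivial) (fun _ _ => trivial) (fun x _ => by
      simp [update_of_ne hab, Finset.filter_eq])
  simpa using this

open Classical in
theorem card_adj_colour_mul_le {C : Type*} {G : SimpleGraph V} {φ : Sym2 V → C} {l : ℝ}
    (hφ : LBounded G φ l) {a b : ι} (hab : a ≠ b) (c : (ι → V) → C)
    {Q : (ι → V) → Prop} (hQ : ∀ x y, Q (update x b y) → Q x)
    (hc : ∀ x y, c (update x b y) = c x) :
    (#{x : ι → V | Q x ∧ G.Adj (x a) (x b) ∧ φ s(x a, x b) = c x} : ℝ) * Fintype.card V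
      ≤ l * #{x | Q x} := by
  refine card_filter_mul_card_le b hQ (fun _ h => h.1) (fun x _ => ?_)
  refine le_trans ?_ (hφ (x a) (c x))
  rw [← Set.ncard_coe_finset]
  refine Nat.cast_le.2 (Set.ncard_le_ncard (fun y hy => ?_) (Set.toFinite _))
  have := (mem_filter.1 (mem_coe.1 hy)).2.2
  simpa [update_of_ne hab, hc] using this

end

variable {V C : Type*} {k : ℕ} [Fintype V] [DecidableEq V]

/-- Two distinct increasing pairs: the second has an endpoint avoiding the first. -/
theorem exists_endpoint_notMem {k : ℕ} {p q : Fin k × Fin k} (hp : p.1 < p.2) (hq : q.1 < q.2)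
    (hpq : p ≠ q) : (q.2 ≠ p.1 ∧ q.2 ≠ p.2) ∨ (q.1 ≠ p.1 ∧ q.1 ≠ p.2) := by
  have : p.1 ≠ q.1 ∨ p.2 ≠ q.2 := by
    by_contra h
    push Not at h
    exact hpq (Prod.ext h.1 h.2)
  omega

open Classical in
theorem exists_spread_family [Nonempty V] {G : SimpleGraph V} {φ : Sym2 V → C} {d γ δ η : ℝ}
    (hd0 : 0 < d) (hd2 : d ≤ 2) (hδ : 0 < δ) (hγ : 0 ≤ γ) (hη : 1 ≤ η * Fintype.card V)
    (hcut : CutNormLE (fun y z => (if G.Adj y z then (1 : ℝ) else 0) - d) γ)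
    (hφ : LBounded G φ (η * Fintype.card V))
    (P : Finset (Fin k × Fin k)) (hP : ∀ p ∈ P, p.1 < p.2)
    (hloss : δ * d ^ #P * (2 ^ #P * γ + (k ^ 2 + k ^ 4) * η) + (k + #P) * (2 ^ #P * γ)
      ≤ (δ * d ^ #P) ^ 2) :
    ∃ X : Finset (Fin k → V),
      (∀ x ∈ X, Injective x ∧ MapsPairs G P x ∧
        Set.InjOn (fun p : Fin k × Fin k => φ s(x p.1, x p.2)) P) ∧
      (1 - δ) * d ^ #P * (Fintype.card V : ℝ) ^ k ≤ #X ∧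
      (∀ a v, (#{x ∈ X | x a = v} : ℝ) * Fintype.card V
        ≤ (1 + δ) * d ^ #P * (Fintype.card V : ℝ) ^ k) ∧
      ∀ p ∈ P, ∀ u v, d * (#{x ∈ X | x p.1 = u ∧ x p.2 = v} : ℝ) * (Fintype.card V : ℝ) ^ 2
        ≤ (1 + δ) * d ^ #P * (Fintype.card V : ℝ) ^ k := by
  have hN : (0 : ℝ) < Fintype.card V := by exact_mod_cast Fintype.card_pos
  set N : ℝ := (Fintype.card V : ℝ) with hNdef
  have hNk : 0 < N ^ k := pow_pos hN k
  let o₁ : Fin k → (Fin k → V) → Prop := fun a => Overloaded G P (fun x => x a) ((1 + δ) * d ^ #P)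
  let o₂ : Fin k × Fin k → (Fin k → V) → Prop := fun p =>
    Overloaded G (P.erase p) (fun x => (x p.1, x p.2)) ((1 + δ) * d ^ #(P.erase p))
  let X : Finset (Fin k → V) := {x | Injective x ∧ MapsPairs G P x ∧
    Set.InjOn (fun p : Fin k × Fin k => φ s(x p.1, x p.2)) P ∧ (∀ a, ¬ o₁ a x) ∧ ∀ p ∈ P, ¬ o₂ p x}
  have hX : ∀ x ∈ X, _ := fun x hx => (mem_filter.1 hx).2
  refine ⟨X, fun x hx => ⟨(hX x hx).1, (hX x hx).2.1, (hX x hx).2.2.1⟩, ?_, ?_, ?_⟩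
  · have hhom := (abs_le.1 (abs_card_mapsPairs_sub_le hd0.le hd2 hcut P hP univ
      fun p _ => Or.inl fun x y => by simp)).1
    rw [card_univ, Fintype.card_fun, Fintype.card_fin, Nat.cast_pow, ← hNdef] at hhom
    let U₁ : Finset (Fin k → V) := (univ.filter fun p : Fin k × Fin k => p.1 ≠ p.2).biUnion
      fun p => {x | x p.1 = x p.2}
    let U₂ : Finset (Fin k → V) := (univ.filter fun r : (Fin k × Fin k) × (Fin k × Fin k) =>
      r.2.1 ≠ r.2.2 ∧ r.2.2 ≠ r.1.1 ∧ r.2.2 ≠ r.1.2).biUnion fun r =>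
        {x | True ∧ G.Adj (x r.2.1) (x r.2.2) ∧ φ s(x r.2.1, x r.2.2) = φ s(x r.1.1, x r.1.2)}
    let U₃ : Finset (Fin k → V) := univ.biUnion fun a => {x | o₁ a x}
    let U₄ : Finset (Fin k → V) := P.biUnion fun p => {x | o₂ p x}
    have hcover : ({x | MapsPairs G P x} : Finset (Fin k → V)) ⊆ X ∪ (U₁ ∪ (U₂ ∪ (U₃ ∪ U₄))) := by
      intro x hx
      have hx := (mem_filter.1 hx).2
      by_cases h1 : Injective x
      swap
      · simp only [Injective, not_forall] at h1
        obtain ⟨a, b, h2, h3⟩ := h1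
        refine mem_union_right _ (mem_union_left _ (mem_biUnion.2 ⟨(a, b), ?_, ?_⟩)) <;> simp_all
      by_cases h2 : Set.InjOn (fun p : Fin k × Fin k => φ s(x p.1, x p.2)) P
      swap
      · simp only [Set.InjOn, not_forall] at h2
        obtain ⟨p, hp, q, hq, h3, h4⟩ := h2
        refine mem_union_right _ (mem_union_right _ (mem_union_left _ (mem_biUnion.2 ?_)))
        rcases exists_endpoint_notMem (hP p hp) (hP q hq) h4 with h5 | h5
        · refine ⟨(p, q), mem_filter.2 ⟨mem_univ _, (hP q hq).ne, h5⟩, ?_⟩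
          exact mem_filter.2 ⟨mem_univ _, trivial, hx q hq, h3.symm⟩
        · refine ⟨(p, q.swap), mem_filter.2 ⟨mem_univ _, (hP q hq).ne', h5⟩, ?_⟩
          refine mem_filter.2 ⟨mem_univ _, trivial, (hx q hq).symm, ?_⟩
          rw [Prod.fst_swap, Prod.snd_swap, Sym2.eq_swap]
          exact h3.symm
      by_cases h3 : ∃ a, o₁ a x
      · obtain ⟨a, ha⟩ := h3
        exact mem_union_right _ (mem_union_right _ (mem_union_right _ (mem_union_left _
          (mem_biUnion.2 ⟨a, mem_univ _, mem_filter.2 ⟨mem_univ _, ha⟩⟩))))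
      by_cases h4 : ∃ p ∈ P, o₂ p x
      · obtain ⟨p, hp, h⟩ := h4
        exact mem_union_right _ (mem_union_right _ (mem_union_right _ (mem_union_right _
          (mem_biUnion.2 ⟨p, hp, mem_filter.2 ⟨mem_univ _, h⟩⟩))))
      push Not at h3 h4
      exact mem_union_left _ (mem_filter.2 ⟨mem_univ _, h1, hx, h2, h3, h4⟩)
    have hcard : (#{x : Fin k → V | MapsPairs G P x} : ℝ) ≤ #X + (#U₁ + (#U₂ + (#U₃ + #U₄))) := by
      have := (card_le_card hcover).trans ((card_union_le _ _).trans (Nat.add_le_add_left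
        ((card_union_le _ _).trans (Nat.add_le_add_left ((card_union_le _ _).trans
          (Nat.add_le_add_left (card_union_le _ _) _)) _)) _))
      exact_mod_cast this
    have hU : ∀ {κ : Type} (S : Finset κ) (T : κ → Finset (Fin k → V)) {r : ℝ} (m : ℝ), 0 ≤ m →
        (∀ i ∈ S, m * (#(T i) : ℝ) ≤ r) → m * (#(S.biUnion T) : ℝ) ≤ #S * r := by
      intro κ S T r m hm hT
      calc m * (#(S.biUnion T) : ℝ) ≤ m * ∑ i ∈ S, (#(T i) : ℝ) := by
            gcongr; exact_mod_cast card_biUnion_le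
        _ ≤ ∑ i ∈ S, r := by rw [Finset.mul_sum]; exact Finset.sum_le_sum hT
        _ = _ := by simp
    have hηk : 0 ≤ η * N ^ k :=
      mul_nonneg (nonneg_of_mul_nonneg_left (zero_le_one.trans hη) hN) hNk.le
    have h1 : (#U₁ : ℝ) ≤ k ^ 2 * (η * N ^ k) := by
      have := hU (univ.filter fun p : Fin k × Fin k => p.1 ≠ p.2)
        (fun p => ({x | x p.1 = x p.2} : Finset (Fin k → V))) (r := η * N ^ k) 1 zero_le_one ?_
      · rw [one_mul] at this
        refine this.trans (mul_le_mul_of_nonneg_right ?_ hηk)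
        exact_mod_cast (card_filter_le _ _).trans (by simp [sq])
      · intro p hp
        refine le_of_mul_le_mul_right (a := N) ?_ hN
        have h := card_apply_eq_apply_mul_le (V := V) (mem_filter.1 hp).2
        rw [Fintype.card_fin, ← hNdef] at h
        nlinarith [mul_le_mul_of_nonneg_right hη hNk.le]
    have h2 : (#U₂ : ℝ) ≤ k ^ 4 * (η * N ^ k) := by
      have := hU (univ.filter fun r : (Fin k × Fin k) × (Fin k × Fin k) =>
          r.2.1 ≠ r.2.2 ∧ r.2.2 ≠ r.1.1 ∧ r.2.2 ≠ r.1.2)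
        (fun r => ({x | True ∧ G.Adj (x r.2.1) (x r.2.2) ∧
          φ s(x r.2.1, x r.2.2) = φ s(x r.1.1, x r.1.2)} : Finset (Fin k → V)))
        (r := η * N ^ k) 1 zero_le_one ?_
      · rw [one_mul] at this
        refine this.trans (mul_le_mul_of_nonneg_right ?_ hηk)
        exact_mod_cast (card_filter_le _ _).trans (by simp; apply le_of_eq; ring)
      · intro r hr
        obtain ⟨-, hr1, hr2, hr3⟩ := mem_filter.1 hr
        refine le_of_mul_le_mul_right (a := N) ?_ hN
        have h := card_adj_colour_mul_le hφ hr1 (fun x => φ s(x r.1.1, x r.1.2))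
          (Q := fun _ => True) (fun _ _ _ => trivial)
          (fun x y => by rw [update_of_ne hr2.symm, update_of_ne hr3.symm])
        rw [filter_true, card_univ, Fintype.card_fun, Fintype.card_fin, Nat.cast_pow,
          ← hNdef] at h
        rw [one_mul, mul_right_comm]
        convert h
        rfl
    have h3 : δ * d ^ #P * (#U₃ : ℝ) ≤ k * (2 ^ #P * (γ * N ^ k)) := by
      have := hU univ (fun a => ({x | o₁ a x} : Finset (Fin k → V)))
        (r := 2 ^ #P * (γ * N ^ k)) (δ * d ^ #P) (by positivity) fun a _ =>
          card_overloaded_le hd0.le hd2 hγ hcut P hP (fun x => x a) fun p hp => ?_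
      · simpa using this
      · by_cases h : a = p.1
        · exact Or.inr fun x y => update_of_ne (by rw [h]; exact (hP p hp).ne) _ _
        · exact Or.inl fun x y => update_of_ne h _ _
    have h4 : δ * d ^ #P * (#U₄ : ℝ) ≤ #P * (2 ^ #P * (γ * N ^ k)) := by
      refine hU P (fun p => ({x | o₂ p x} : Finset (Fin k → V))) (δ * d ^ #P) (by positivity)
        fun p hp => ?_
      have h := card_overloaded_le (δ := δ) hd0.le hd2 hγ hcut (P.erase p)
        (fun q hq => hP q (mem_of_mem_erase hq)) (fun x => (x p.1, x p.2)) fun q hq => ?_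
      · have hpc := card_erase_add_one hp
        rw [← hpc, pow_succ, pow_succ]
        have h0 : 0 ≤ 2 ^ #(P.erase p) * (γ * N ^ k) := by positivity
        calc _ = d * (δ * d ^ #(P.erase p) * #{x | o₂ p x}) := by ring
          _ ≤ d * (2 ^ #(P.erase p) * (γ * N ^ k)) := by gcongr
          _ ≤ 2 * (2 ^ #(P.erase p) * (γ * N ^ k)) := by gcongr
          _ = _ := by ring
      · have h5 := exists_endpoint_notMem (hP p hp) (hP q (mem_of_mem_erase hq))
          (ne_of_mem_erase hq).symm
        rcases h5 with h5 | h5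
        · exact Or.inr fun x y => by rw [update_of_ne h5.1.symm, update_of_ne h5.2.symm]
        · exact Or.inl fun x y => by rw [update_of_ne h5.1.symm, update_of_ne h5.2.symm]
    have hR : 0 < δ * d ^ #P := by positivity
    have h5 : (#{x ∈ univ | MapsPairs G P x} : ℝ) = #{x : Fin k → V | MapsPairs G P x} := rfl
    have h6 : δ * d ^ #P * ((1 - δ) * d ^ #P * N ^ k) ≤ δ * d ^ #P * #X := by
      have h7 := mul_le_mul_of_nonneg_left hcard hR.le
      have h8 := mul_le_mul_of_nonneg_left hhom hR.le
      have h9 := mul_le_mul_of_nonneg_right hloss hNk.le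
      have h10 := mul_le_mul_of_nonneg_left h1 hR.le
      have h11 := mul_le_mul_of_nonneg_left h2 hR.le
      have h12 : 0 ≤ δ * d ^ #P * (γ * N ^ k) := by positivity
      rw [h5] at h8
      linarith
    exact le_of_mul_le_mul_left h6 hR
  · intro a v
    by_cases hne : ∃ x ∈ X, x a = v
    swap
    · have : #{x ∈ X | x a = v} = 0 := by
        rw [card_eq_zero, filter_eq_empty_iff]; push Not at hne; exact hne
      rw [this]; simp; positivity
    obtain ⟨x, hx, rfl⟩ := hne
    have h1 : (#{y | MapsPairs G P y ∧ y a = x a} : ℝ)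
        ≤ (1 + δ) * d ^ #P * #{y : Fin k → V | y a = x a} := by
      convert not_lt.1 ((hX x hx).2.2.2.1 a)
      rfl
    have h2 : (#{y ∈ X | y a = x a} : ℝ) ≤ #{y | MapsPairs G P y ∧ y a = x a} := by
      exact_mod_cast card_le_card fun y hy => by
        rw [mem_filter] at hy ⊢
        exact ⟨mem_univ _, (hX y hy.1).2.1, hy.2⟩
    have h3 := card_apply_mem_mul_le a {x a}
    simp only [mem_singleton, card_singleton, Nat.cast_one, one_mul, Fintype.card_fin] at h3
    rw [← hNdef] at h3
    calc _ ≤ (1 + δ) * d ^ #P * #{y : Fin k → V | y a = x a} * N := by gcongr; exact h2.trans h1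
      _ = (1 + δ) * d ^ #P * (#{y : Fin k → V | y a = x a} * N) := by ring
      _ ≤ _ := by gcongr
  · intro p hp u v
    by_cases hne : ∃ x ∈ X, x p.1 = u ∧ x p.2 = v
    swap
    · have : #{x ∈ X | x p.1 = u ∧ x p.2 = v} = 0 := by
        rw [card_eq_zero, filter_eq_empty_iff]; push Not at hne; simpa using hne
      rw [this]; simp; positivity
    obtain ⟨x, hx, rfl, rfl⟩ := hne
    have h1 : (#{y | MapsPairs G (P.erase p) y ∧ (y p.1, y p.2) = (x p.1, x p.2)} : ℝ)
        ≤ (1 + δ) * d ^ #(P.erase p) * #{y : Fin k → V | (y p.1, y p.2) = (x p.1, x p.2)} := by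
      convert not_lt.1 ((hX x hx).2.2.2.2 p hp)
      rfl
    have h2 : (#{y ∈ X | y p.1 = x p.1 ∧ y p.2 = x p.2} : ℝ)
        ≤ #{y | MapsPairs G (P.erase p) y ∧ (y p.1, y p.2) = (x p.1, x p.2)} := by
      exact_mod_cast card_le_card fun y hy => by
        rw [mem_filter] at hy ⊢
        exact ⟨mem_univ _, fun q hq => (hX y hy.1).2.1 q (mem_of_mem_erase hq),
          Prod.ext hy.2.1 hy.2.2⟩
    have h3 := card_apply_mem_mul_le p.1 {x p.1}
    have h4 := card_apply_mem_and_mul_le (a := p.2) (Q := fun y => y p.1 = x p.1)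
      (fun y z h => by rwa [update_of_ne (hP p hp).ne] at h) {x p.2}
    simp only [mem_singleton, card_singleton, Nat.cast_one, one_mul, Fintype.card_fin] at h3 h4
    rw [← hNdef] at h3 h4
    have h5 : #{y : Fin k → V | (y p.1, y p.2) = (x p.1, x p.2)}
        = #{y : Fin k → V | y p.1 = x p.1 ∧ y p.2 = x p.2} := by
      congr 1
      ext y
      simp only [mem_filter, Prod.mk.injEq]
    have hpc := card_erase_add_one hp
    rw [← hpc, pow_succ]
    calc _ ≤ d * ((1 + δ) * d ^ #(P.erase p) *
            #{y : Fin k → V | y p.1 = x p.1 ∧ y p.2 = x p.2}) * N ^ 2 := by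
          refine mul_le_mul_of_nonneg_right (mul_le_mul_of_nonneg_left ?_ hd0.le) (by positivity)
          rw [← h5]
          exact h2.trans h1
      _ = (1 + δ) * (d ^ #(P.erase p) * d) *
            (#{y : Fin k → V | y p.1 = x p.1 ∧ y p.2 = x p.2} * N * N) := by ring
      _ ≤ (1 + δ) * (d ^ #(P.erase p) * d) * N ^ k := by
          gcongr
          exact (mul_le_mul_of_nonneg_right h4 hN.le).trans h3

end SpreadFamily

section PairCounts

open Finset Function

variable {V C : Type*} [Fintype V] {k : ℕ}

theorem card_edge_mul_sq_le [DecidableEq V] {p : Fin k × Fin k} (hp : p.1 < p.2) (e : Sym2 V) :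
    ∃ S : Finset V, #S ≤ 2 ∧ (∀ x : Fin k → V, s(x p.1, x p.2) = e → x p.1 ∈ S ∧ x p.2 ∈ S) ∧
      (#{x : Fin k → V | x p.1 ∈ S ∧ x p.2 ∈ S} : ℝ) * (Fintype.card V : ℝ) ^ 2
        ≤ 4 * (Fintype.card V : ℝ) ^ k := by
  induction e using Sym2.ind with
  | _ u v =>
    have hS : #({u, v} : Finset V) ≤ 2 := card_le_two
    have hS' : (#({u, v} : Finset V) : ℝ) ≤ 2 := by exact_mod_cast hS
    refine ⟨{u, v}, hS, fun x hx => ?_, ?_⟩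
    · rw [Sym2.eq_iff] at hx
      simp only [mem_insert, mem_singleton]
      tauto
    have h1 := card_apply_mem_mul_le p.1 ({u, v} : Finset V)
    have h2 := card_apply_mem_and_mul_le (a := p.2) (Q := fun y => y p.1 ∈ ({u, v} : Finset V))
      (fun y z h => by rwa [update_of_ne hp.ne] at h) {u, v}
    rw [Fintype.card_fin] at h1
    have hN : (0 : ℝ) ≤ Fintype.card V := Nat.cast_nonneg _
    set N : ℝ := (Fintype.card V : ℝ)
    calc _ = _ * N * N := by ring
      _ ≤ 2 * #{x : Fin k → V | x p.1 ∈ ({u, v} : Finset V)} * N := by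
          refine mul_le_mul_of_nonneg_right (h2.trans ?_) hN
          gcongr
      _ = 2 * (#{x : Fin k → V | x p.1 ∈ ({u, v} : Finset V)} * N) := by ring
      _ ≤ 2 * (2 * N ^ k) := by
          exact mul_le_mul_of_nonneg_left (h1.trans (by gcongr)) zero_le_two
      _ = _ := by ring

theorem card_edge_edge_mul_le [DecidableEq V] {p q : Fin k × Fin k} (hp : p.1 < p.2) (hq : q.1 < q.2)
    (hpq : p ≠ q) (e e' : Sym2 V) :
    (#{x : Fin k → V | s(x p.1, x p.2) = e ∧ s(x q.1, x q.2) = e'} : ℝ) *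
      (Fintype.card V : ℝ) ^ 3 ≤ 8 * (Fintype.card V : ℝ) ^ k := by
  obtain ⟨S, -, hS1, hS2⟩ := card_edge_mul_sq_le hp e
  obtain ⟨T, hT, hT1, -⟩ := card_edge_mul_sq_le hq e'
  have hN : (0 : ℝ) ≤ Fintype.card V := Nat.cast_nonneg _
  set N : ℝ := (Fintype.card V : ℝ) with hNdef
  have key : ∀ c : Fin k, c ≠ p.1 → c ≠ p.2 → (∀ x : Fin k → V, s(x q.1, x q.2) = e' → x c ∈ T) →
      (#{x : Fin k → V | s(x p.1, x p.2) = e ∧ s(x q.1, x q.2) = e'} : ℝ) * N ^ 3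
        ≤ 8 * N ^ k := by
    intro c hc1 hc2 hc
    have h1 := card_apply_mem_and_mul_le (a := c) (Q := fun y : Fin k → V => y p.1 ∈ S ∧ y p.2 ∈ S)
      (fun y z h => by rwa [update_of_ne hc1.symm, update_of_ne hc2.symm] at h) T
    rw [← hNdef] at h1
    calc _ ≤ (#{x : Fin k → V | (x p.1 ∈ S ∧ x p.2 ∈ S) ∧ x c ∈ T} : ℝ) * N ^ 3 := by
          refine mul_le_mul_of_nonneg_right (Nat.cast_le.2 (card_le_card fun x hx => ?_))
            (by positivity)
          have h := (mem_filter.1 hx).2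
          exact mem_filter.2 ⟨mem_univ _, hS1 x h.1, hc x h.2⟩
      _ = (#{x : Fin k → V | (x p.1 ∈ S ∧ x p.2 ∈ S) ∧ x c ∈ T} * N) * N ^ 2 := by ring
      _ ≤ (2 * #{x : Fin k → V | x p.1 ∈ S ∧ x p.2 ∈ S}) * N ^ 2 := by
          refine mul_le_mul_of_nonneg_right (h1.trans ?_) (by positivity)
          gcongr
          exact_mod_cast hT
      _ ≤ 2 * (4 * N ^ k) := by rw [mul_assoc]; gcongr
      _ = _ := by ring
  rcases exists_endpoint_notMem hp hq hpq with h | h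
  · exact key q.2 h.1 h.2 fun x hx => (hT1 x hx).2
  · exact key q.1 h.1 h.2 fun x hx => (hT1 x hx).1

theorem card_vertex_vertex_mul_le [DecidableEq V] {a b : Fin k} (hab : a ≠ b) (u v : V) :
    (#{x : Fin k → V | x a = u ∧ x b = v} : ℝ) * (Fintype.card V : ℝ) ^ 2
      ≤ (Fintype.card V : ℝ) ^ k := by
  have h1 := card_apply_mem_mul_le a {u}
  have h2 := card_apply_mem_and_mul_le (a := b) (Q := fun y => y a = u)
    (fun y z h => by rwa [update_of_ne hab] at h) {v}
  simp only [mem_singleton, card_singleton, Nat.cast_one, one_mul, Fintype.card_fin] at h1 h2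
  rw [sq, ← mul_assoc]
  exact (mul_le_mul_of_nonneg_right h2 (Nat.cast_nonneg _)).trans h1

open Classical in
theorem card_and_colour_mul_le {G : SimpleGraph V} {φ : Sym2 V → C} {l : ℝ}
    (hφ : LBounded G φ l) {q : Fin k × Fin k} (hq : q.1 < q.2) (c : C) {Q : (Fin k → V) → Prop}
    (hQ : (∀ x y, Q (update x q.2 y) → Q x) ∨ ∀ x y, Q (update x q.1 y) → Q x) :
    (#{x : Fin k → V | Q x ∧ G.Adj (x q.1) (x q.2) ∧ φ s(x q.1, x q.2) = c} : ℝ) *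
      (Fintype.card V : ℝ) ≤ l * #{x | Q x} := by
  rcases hQ with h | h
  · exact card_adj_colour_mul_le hφ hq.ne (fun _ => c) h (fun _ _ => rfl)
  · have := card_adj_colour_mul_le hφ hq.ne' (fun _ => c) h (fun _ _ => rfl)
    convert this using 7 with x
    · exact G.adj_comm _ _
    · rw [Sym2.eq_swap]

open Classical in
theorem card_vertex_colour_mul_le {G : SimpleGraph V} {φ : Sym2 V → C} {l : ℝ} (hl : 0 ≤ l)
    (hφ : LBounded G φ l) (a : Fin k) {q : Fin k × Fin k} (hq : q.1 < q.2) (v : V) (c : C) :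
    (#{x : Fin k → V | x a = v ∧ G.Adj (x q.1) (x q.2) ∧ φ s(x q.1, x q.2) = c} : ℝ) *
      (Fintype.card V : ℝ) ^ 2 ≤ l * (Fintype.card V : ℝ) ^ k := by
  have h1 := card_apply_mem_mul_le a {v}
  simp only [mem_singleton, card_singleton, Nat.cast_one, one_mul, Fintype.card_fin] at h1
  have h2 := card_and_colour_mul_le hφ hq c (Q := fun x => x a = v) (by
    by_cases h : a = q.2
    · exact Or.inr fun x y hx => by rwa [update_of_ne (h ▸ hq.ne')] at hx
    · exact Or.inl fun x y hx => by rwa [update_of_ne h] at hx)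
  have hN : (0 : ℝ) ≤ Fintype.card V := Nat.cast_nonneg _
  set N : ℝ := (Fintype.card V : ℝ)
  have h3 : (#{x : Fin k → V | x a = v} : ℝ) * N ≤ N ^ k := by
    convert h1
  rw [sq, ← mul_assoc]
  refine (mul_le_mul_of_nonneg_right h2 hN).trans ?_
  rw [mul_assoc]
  exact mul_le_mul_of_nonneg_left h3 hl

open Classical in
/-- The ordered pairs joined by an edge of colour `c`. -/
noncomputable def colourPairs (G : SimpleGraph V) (φ : Sym2 V → C) (c : C) : Finset (V × V) :=
  {r | G.Adj r.1 r.2 ∧ φ s(r.1, r.2) = c}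

theorem mem_colourPairs {G : SimpleGraph V} {φ : Sym2 V → C} {c : C} {r : V × V} :
    r ∈ colourPairs G φ c ↔ G.Adj r.1 r.2 ∧ φ s(r.1, r.2) = c := by
  simp [colourPairs]

theorem card_colourPairs_le {G : SimpleGraph V} {φ : Sym2 V → C} {g : ℝ} (hφ : GBounded G φ g)
    (c : C) : (#(colourPairs G φ c) : ℝ) ≤ 2 * g := by
  classical
  have h1 := card_le_two_mul_card_image_mk (colourPairs G φ c)
  have h2 : #((colourPairs G φ c).image fun p => s(p.1, p.2)) ≤ (colourCls G φ c).ncard := by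
    rw [← Set.ncard_coe_finset]
    refine Set.ncard_le_ncard (fun e he => ?_) (Set.toFinite _)
    obtain ⟨p, hp, rfl⟩ := mem_image.1 he
    exact (mem_filter.1 hp).2
  calc (#(colourPairs G φ c) : ℝ) ≤ 2 * (colourCls G φ c).ncard := by
        exact_mod_cast h1.trans (Nat.mul_le_mul_left _ h2)
    _ ≤ _ := by have := hφ c; gcongr

open Classical in
theorem card_colour_mul_sq_le {G : SimpleGraph V} {φ : Sym2 V → C} {g : ℝ} (hg : GBounded G φ g)
    {p : Fin k × Fin k} (hp : p.1 < p.2) (c : C) :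
    (#{x : Fin k → V | G.Adj (x p.1) (x p.2) ∧ φ s(x p.1, x p.2) = c} : ℝ) *
      (Fintype.card V : ℝ) ^ 2 ≤ 2 * g * (Fintype.card V : ℝ) ^ k := by
  calc _ = (∑ r ∈ colourPairs G φ c, (#{x : Fin k → V | x p.1 = r.1 ∧ x p.2 = r.2} : ℝ)) *
        (Fintype.card V : ℝ) ^ 2 := by
        congr 1
        norm_cast
        rw [card_eq_sum_card_fiberwise (f := fun x => (x p.1, x p.2)) (t := colourPairs G φ c)
          (fun x hx => by simpa [colourPairs] using hx)]
        refine Finset.sum_congr rfl fun r hr => ?_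
        congr 1
        ext x
        simp only [colourPairs, mem_filter, mem_univ, true_and] at hr ⊢
        rw [Prod.ext_iff]
        exact ⟨fun h => h.2, fun h => ⟨by rwa [h.1, h.2], h⟩⟩
    _ ≤ ∑ r ∈ colourPairs G φ c, (Fintype.card V : ℝ) ^ k := by
        rw [Finset.sum_mul]
        refine Finset.sum_le_sum fun r _ => ?_
        convert card_vertex_vertex_mul_le hp.ne r.1 r.2
    _ ≤ _ := by
        rw [Finset.sum_const, nsmul_eq_mul]
        exact mul_le_mul_of_nonneg_right (card_colourPairs_le hg c) (by positivity)

open Classical in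
theorem card_colour_colour_mul_le {G : SimpleGraph V} {φ : Sym2 V → C} {g l : ℝ} (hl : 0 ≤ l)
    (hφ : LBounded G φ l) (hg : GBounded G φ g) {p q : Fin k × Fin k} (hp : p.1 < p.2)
    (hq : q.1 < q.2) (hpq : p ≠ q) (c c' : C) :
    (#{x : Fin k → V | (G.Adj (x p.1) (x p.2) ∧ φ s(x p.1, x p.2) = c) ∧
      G.Adj (x q.1) (x q.2) ∧ φ s(x q.1, x q.2) = c'} : ℝ) * (Fintype.card V : ℝ) ^ 3
      ≤ l * (2 * g * (Fintype.card V : ℝ) ^ k) := by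
  have h1 := card_colour_mul_sq_le hg hp c
  have h2 : (#{x : Fin k → V | (G.Adj (x p.1) (x p.2) ∧ φ s(x p.1, x p.2) = c) ∧
      G.Adj (x q.1) (x q.2) ∧ φ s(x q.1, x q.2) = c'} : ℝ) * (Fintype.card V : ℝ)
      ≤ l * #{x : Fin k → V | G.Adj (x p.1) (x p.2) ∧ φ s(x p.1, x p.2) = c} := by
    convert card_and_colour_mul_le hφ hq c' (Q := fun x => G.Adj (x p.1) (x p.2) ∧ φ s(x p.1, x p.2) = c)
      ((exists_endpoint_notMem hp hq hpq).imp
        (fun h x y hx => by rwa [update_of_ne h.1.symm, update_of_ne h.2.symm] at hx)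
        (fun h x y hx => by rwa [update_of_ne h.1.symm, update_of_ne h.2.symm] at hx)) using 1 <;>
    congr!
  have hN : (0 : ℝ) ≤ Fintype.card V := Nat.cast_nonneg _
  set N : ℝ := (Fintype.card V : ℝ)
  rw [pow_succ', ← mul_assoc]
  refine (mul_le_mul_of_nonneg_right h2 (sq_nonneg N)).trans ?_
  rw [mul_assoc]
  exact mul_le_mul_of_nonneg_left h1 hl

end PairCounts

section CopyHypergraph

open Finset Function

theorem card_univ_product_filter {V : Type*} {k t : ℕ} (X : Finset (Fin k → V)) (p : (Fin k → V) → Prop)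
    [DecidablePred p] :
    #{e ∈ (univ : Finset (Fin t)) ×ˢ X | p e.2} = t * #{x ∈ X | p x} := by
  have : {e ∈ (univ : Finset (Fin t)) ×ˢ X | p e.2} = univ ×ˢ {x ∈ X | p x} := by
    ext e; simp
  rw [this, card_product, card_univ, Fintype.card_fin]

theorem card_univ_product_filter_le {V : Type*} {k t : ℕ} {X : Finset (Fin k → V)} {p : Fin t × (Fin k → V) → Prop}
    {q : (Fin k → V) → Prop} [DecidablePred p] [DecidablePred q] (i : Fin t)
    (h : ∀ e, p e → e.1 = i ∧ q e.2) :
    #{e ∈ (univ : Finset (Fin t)) ×ˢ X | p e} ≤ #{x ∈ X | q x} := by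
  refine card_le_card_of_injOn Prod.snd (fun e he => ?_) fun e he e' he' hee' => ?_
  · simp only [coe_filter, mem_product, mem_univ, true_and, Set.mem_ofPred_eq] at he ⊢
    exact ⟨he.1, (h e he.2).2⟩
  · simp only [coe_filter, Set.mem_ofPred_eq] at he he'
    exact Prod.ext ((h e he.2).1.trans (h e' he'.2).1.symm) hee'

variable {V C : Type*} [DecidableEq V] [DecidableEq C] {k t : ℕ}

/-- The edges, vertices and colours used by the copy `x` placed in the `i`-th factor. -/
def copyLabel (φ : Sym2 V → C) (P : Finset (Fin k × Fin k)) (e : Fin t × (Fin k → V)) :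
    P ⊕ (Fin k ⊕ P) → Sym2 V ⊕ ((Fin t × V) ⊕ (Fin t × C))
  | .inl p => .inl s(e.2 p.1.1, e.2 p.1.2)
  | .inr (.inl a) => .inr (.inl (e.1, e.2 a))
  | .inr (.inr p) => .inr (.inr (e.1, φ s(e.2 p.1.1, e.2 p.1.2)))

/-- The hyperedge of the copy `x` placed in the `i`-th factor. -/
def copySupport (φ : Sym2 V → C) (P : Finset (Fin k × Fin k)) (e : Fin t × (Fin k → V)) :
    Finset (Sym2 V ⊕ ((Fin t × V) ⊕ (Fin t × C))) :=
  univ.image (copyLabel φ P e)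

theorem card_copySupport {φ : Sym2 V → C} {P : Finset (Fin k × Fin k)}
    {e : Fin t × (Fin k → V)} (he : Injective e.2)
    (hφ : Set.InjOn (fun p : Fin k × Fin k => φ s(e.2 p.1, e.2 p.2)) P) :
    #(copySupport φ P e) = #P + (k + #P) := by
  have hinj : Injective (copyLabel φ P e) := by
    rintro (p | a | p) (q | b | q) h
    · have h : s(e.2 p.1.1, e.2 p.1.2) = s(e.2 q.1.1, e.2 q.1.2) := by simpa [copyLabel] using h
      rw [Subtype.ext (hφ p.2 q.2 (congrArg φ h))]
    · simp [copyLabel] at h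
    · simp [copyLabel] at h
    · simp [copyLabel] at h
    · have h : e.2 a = e.2 b := by simpa [copyLabel] using h
      rw [he h]
    · simp [copyLabel] at h
    · simp [copyLabel] at h
    · simp [copyLabel] at h
    · have h : φ s(e.2 p.1.1, e.2 p.1.2) = φ s(e.2 q.1.1, e.2 q.1.2) := by
        simpa [copyLabel] using h
      rw [Subtype.ext (hφ p.2 q.2 h)]
  rw [copySupport, card_image_of_injective _ hinj]
  simp

theorem card_filter_mem_image_le {ι κ W : Type*} [Fintype κ] [DecidableEq W] (E : Finset ι)
    (lab : ι → κ → W) (ξ : W) :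
    #{e ∈ E | ξ ∈ univ.image (lab e)} ≤ ∑ l, #{e ∈ E | lab e l = ξ} := by
  classical
  refine (card_le_card (t := univ.biUnion fun l => {e ∈ E | lab e l = ξ}) fun e he => ?_).trans
    card_biUnion_le
  simp only [mem_filter, mem_image, mem_univ, true_and, mem_biUnion] at he ⊢
  obtain ⟨h1, l, h2⟩ := he
  exact ⟨l, h1, h2⟩

theorem card_filter_mem_mem_image_le {ι κ W : Type*} [Fintype κ] [DecidableEq W] (E : Finset ι)
    (lab : ι → κ → W) (ξ ξ' : W) :
    #{e ∈ E | ξ ∈ univ.image (lab e) ∧ ξ' ∈ univ.image (lab e)}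
      ≤ ∑ l, ∑ l', #{e ∈ E | lab e l = ξ ∧ lab e l' = ξ'} := by
  classical
  rw [← Fintype.sum_prod_type' (f := fun l l' => #{e ∈ E | lab e l = ξ ∧ lab e l' = ξ'})]
  refine (card_le_card (t := univ.biUnion fun l : κ × κ =>
    {e ∈ E | lab e l.1 = ξ ∧ lab e l.2 = ξ'}) fun e he => ?_).trans card_biUnion_le
  simp only [mem_filter, mem_image, mem_univ, true_and, mem_biUnion] at he ⊢
  obtain ⟨h1, ⟨l, h2⟩, l', h3⟩ := he
  exact ⟨(l, l'), h1, h2, h3⟩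

variable [Fintype V]

theorem degree_copyHypergraph_le [Nonempty V] {G : SimpleGraph V} {φ : Sym2 V → C} {d Y η g : ℝ}
    (hd : 0 < d) (hη : 0 ≤ η) (hY : 0 ≤ Y) (hg : GBounded G φ g) {P : Finset (Fin k × Fin k)}
    {X : Finset (Fin k → V)} (hX : ∀ x ∈ X, MapsPairs G P x)
    (hXv : ∀ a v, (#{x ∈ X | x a = v} : ℝ) * Fintype.card V ≤ Y)
    (hXp : ∀ p ∈ P, ∀ u v, d * (#{x ∈ X | x p.1 = u ∧ x p.2 = v} : ℝ) *
      (Fintype.card V : ℝ) ^ 2 ≤ Y)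
    (ht : 2 * #P * (t : ℝ) ≤ k * d * Fintype.card V)
    (hgP : 2 * #P * g ≤ (1 + η) * (k * d * Fintype.card V))
    (ξ : Sym2 V ⊕ ((Fin t × V) ⊕ (Fin t × C))) :
    (#{e ∈ (univ : Finset (Fin t)) ×ˢ X | ξ ∈ copySupport φ P e} : ℝ) * Fintype.card V
      ≤ (1 + η) * (k * Y) := by
  have hN : (0 : ℝ) < Fintype.card V := by exact_mod_cast Fintype.card_pos
  set N : ℝ := (Fintype.card V : ℝ) with hNdef
  have hkY : k * Y ≤ (1 + η) * (k * Y) := by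
    have : 0 ≤ k * Y := by positivity
    nlinarith
  have hdN : 0 < d * N := by positivity
  have h0 := card_filter_mem_image_le ((univ : Finset (Fin t)) ×ˢ X) (copyLabel φ P) ξ
  have h1 : (#{e ∈ (univ : Finset (Fin t)) ×ˢ X | ξ ∈ copySupport φ P e} : ℝ)
      ≤ ∑ l, (#{e ∈ (univ : Finset (Fin t)) ×ˢ X | copyLabel φ P e l = ξ} : ℝ) := by
    exact_mod_cast h0
  refine (mul_le_mul_of_nonneg_right h1 hN.le).trans ?_
  rw [Fintype.sum_sum_type, Fintype.sum_sum_type]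
  rcases ξ with e | ⟨i, v⟩ | ⟨i, c⟩
  · simp only [copyLabel, Sum.inl.injEq, reduceCtorEq, filter_false, card_empty, Nat.cast_zero,
      Finset.sum_const_zero, add_zero]
    refine le_trans ?_ hkY
    have h2 : ∀ p : P, d * N ^ 2 * (#{x ∈ X | s(x p.1.1, x p.1.2) = e} : ℝ) ≤ 2 * Y := by
      intro p
      induction e using Sym2.ind with
      | _ u v =>
        have h3 : (#{x ∈ X | s(x p.1.1, x p.1.2) = s(u, v)} : ℝ)
            ≤ #{x ∈ X | x p.1.1 = u ∧ x p.1.2 = v} + #{x ∈ X | x p.1.1 = v ∧ x p.1.2 = u} := by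
          rw [← Nat.cast_add]
          refine Nat.cast_le.2 ((card_le_card fun x hx => ?_).trans (card_union_le _ _))
          simp only [mem_filter, mem_union, Sym2.eq_iff] at hx ⊢
          tauto
        have h4 := hXp p.1 p.2 u v
        have h5 := hXp p.1 p.2 v u
        nlinarith [mul_le_mul_of_nonneg_left h3 (by positivity : 0 ≤ d * N ^ 2)]
    refine le_of_mul_le_mul_left (a := d * N) ?_ hdN
    calc d * N * ((∑ p : P, (#{x ∈ (univ : Finset (Fin t)) ×ˢ X |
            s(x.2 p.1.1, x.2 p.1.2) = e} : ℝ)) * N)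
        = t * ∑ p : P, d * N ^ 2 * (#{x ∈ X | s(x p.1.1, x p.1.2) = e} : ℝ) := by
          rw [← Finset.mul_sum]
          have h3 : ∀ p : P, (#{x ∈ (univ : Finset (Fin t)) ×ˢ X | s(x.2 p.1.1, x.2 p.1.2) = e} : ℝ)
              = t * #{x ∈ X | s(x p.1.1, x p.1.2) = e} := fun p => by
            exact_mod_cast card_univ_product_filter X (fun x => s(x p.1.1, x p.1.2) = e)
          rw [Finset.sum_congr rfl fun p _ => h3 p, ← Finset.mul_sum]
          ring
      _ ≤ t * ∑ p : P, 2 * Y :=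
          mul_le_mul_of_nonneg_left (Finset.sum_le_sum fun p _ => h2 p) (Nat.cast_nonneg _)
      _ = (2 * #P * t) * Y := by simp; ring
      _ ≤ (k * d * N) * Y := by gcongr
      _ = _ := by ring
  · simp only [copyLabel, Sum.inl.injEq, Sum.inr.injEq, reduceCtorEq, filter_false, card_empty,
      Nat.cast_zero, Finset.sum_const_zero, add_zero, zero_add]
    refine le_trans ?_ hkY
    rw [Finset.sum_mul]
    calc _ ≤ ∑ a : Fin k, Y := by
          refine Finset.sum_le_sum fun a _ => le_trans ?_ (hXv a v)
          refine mul_le_mul_of_nonneg_right (Nat.cast_le.2 ?_) hN.le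
          exact card_univ_product_filter_le i fun e he => by simpa using he
      _ = _ := by simp
  · simp only [copyLabel, Sum.inr.injEq, reduceCtorEq, filter_false, card_empty,
      Nat.cast_zero, Finset.sum_const_zero, zero_add]
    refine le_of_mul_le_mul_left (a := d * N) ?_ hdN
    have h2 : ∀ p : P, d * N ^ 2 * (#{x ∈ X | φ s(x p.1.1, x p.1.2) = c} : ℝ) ≤ 2 * g * Y := by
      intro p
      calc d * N ^ 2 * (#{x ∈ X | φ s(x p.1.1, x p.1.2) = c} : ℝ)
          = d * N ^ 2 * ∑ r ∈ colourPairs G φ c,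
            (#{x ∈ X | x p.1.1 = r.1 ∧ x p.1.2 = r.2} : ℝ) := by
            congr 1
            norm_cast
            rw [card_eq_sum_card_fiberwise (f := fun x => (x p.1.1, x p.1.2))
              (t := colourPairs G φ c) (fun x hx => by
                have := mem_filter.1 (mem_coe.1 hx)
                exact mem_colourPairs.2 ⟨hX x this.1 p.1 p.2, this.2⟩)]
            refine Finset.sum_congr rfl fun r hr => ?_
            congr 1
            ext x
            rw [mem_colourPairs] at hr
            simp only [mem_filter, Prod.ext_iff]
            exact ⟨fun h => ⟨h.1.1, h.2⟩, fun h => ⟨⟨h.1, by rw [h.2.1, h.2.2]; exact hr.2⟩, h.2⟩⟩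
        _ ≤ ∑ r ∈ colourPairs G φ c, Y := by
            rw [Finset.mul_sum]
            refine Finset.sum_le_sum fun r _ => (le_of_eq ?_).trans (hXp p.1 p.2 r.1 r.2)
            ring
        _ ≤ _ := by
            rw [Finset.sum_const, nsmul_eq_mul]
            exact mul_le_mul_of_nonneg_right (card_colourPairs_le hg c) hY
    calc _ ≤ d * N * ((∑ p : P, (#{x ∈ X | φ s(x p.1.1, x p.1.2) = c} : ℝ)) * N) := by
          gcongr with p
          exact card_univ_product_filter_le i fun e he => by simpa using he
      _ = ∑ p : P, d * N ^ 2 * (#{x ∈ X | φ s(x p.1.1, x p.1.2) = c} : ℝ) := by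
          rw [← Finset.mul_sum]; ring
      _ ≤ ∑ p : P, 2 * g * Y := Finset.sum_le_sum fun p _ => h2 p
      _ = (2 * #P * g) * Y := by simp; ring
      _ ≤ ((1 + η) * (k * d * N)) * Y := by gcongr
      _ = _ := by ring

end CopyHypergraph

section CopyHypergraph

open Finset Function

variable {V C : Type*} [DecidableEq V] [DecidableEq C] [Fintype V] {k t : ℕ}

theorem card_copyLabel_eq_and_eq_mul_le [Nonempty V] {G : SimpleGraph V} {φ : Sym2 V → C}
    {η g : ℝ} (hk : 1 ≤ k) (hη : 1 ≤ η * Fintype.card V)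
    (hφ : LBounded G φ (η * Fintype.card V)) (hg : GBounded G φ g)
    {P : Finset (Fin k × Fin k)} (hP : ∀ p ∈ P, p.1 < p.2)
    {X : Finset (Fin k → V)} (hX : ∀ x ∈ X, MapsPairs G P x)
    (ht : (t : ℝ) ≤ k * Fintype.card V) (hgN : g ≤ 4 * k * Fintype.card V)
    {ξ ξ' : Sym2 V ⊕ ((Fin t × V) ⊕ (Fin t × C))} (hξ : ξ ≠ ξ') (l l' : P ⊕ (Fin k ⊕ P)) :
    (#{e ∈ (univ : Finset (Fin t)) ×ˢ X | copyLabel φ P e l = ξ ∧ copyLabel φ P e l' = ξ'} : ℝ) *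
      Fintype.card V ≤ 8 * k * η * (Fintype.card V : ℝ) ^ k := by
  classical
  have hN : (0 : ℝ) < Fintype.card V := by exact_mod_cast Fintype.card_pos
  have hk' : (1 : ℝ) ≤ k := by exact_mod_cast hk
  set N : ℝ := (Fintype.card V : ℝ) with hNdef
  have hη0 : 0 < η := by
    by_contra h
    nlinarith
  have hNk : 0 < N ^ k := by positivity
  have cancel : ∀ m : ℝ, m * N ^ 2 ≤ 8 * k * (η * N) * N ^ k → m * N ≤ 8 * k * η * N ^ k :=
    fun m hm => le_of_mul_le_mul_right (a := N) (by nlinarith) hN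
  have hkη : 1 ≤ k * (η * N) := by nlinarith
  have empty : ∀ (Q : Fin t × (Fin k → V) → Prop) [DecidablePred Q], (∀ z, ¬ Q z) →
      (#{z ∈ (univ : Finset (Fin t)) ×ˢ X | Q z} : ℝ) * N ≤ 8 * k * η * N ^ k := by
    intro Q _ hQ
    rw [filter_false_of_mem fun z _ => hQ z]
    simp only [card_empty, Nat.cast_zero, zero_mul]
    positivity
  have hedge : ∀ (p : P) (e : Sym2 V) (i : Fin t) (Q : Fin t × (Fin k → V) → Prop)
      [DecidablePred Q], (∀ z, Q z → s(z.2 p.1.1, z.2 p.1.2) = e ∧ z.1 = i) →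
      (#{z ∈ (univ : Finset (Fin t)) ×ˢ X | Q z} : ℝ) * N ≤ 8 * k * η * N ^ k := by
    intro p e i Q _ hQ
    obtain ⟨S, -, hS, hS'⟩ := card_edge_mul_sq_le (k := k) (hP p.1 p.2) e
    have h1 : #{z ∈ (univ : Finset (Fin t)) ×ˢ X | Q z}
        ≤ #{x : Fin k → V | x p.1.1 ∈ S ∧ x p.1.2 ∈ S} :=
      (card_univ_product_filter_le i fun z hz => ⟨(hQ z hz).2, hS _ (hQ z hz).1⟩).trans
        (card_le_card (filter_subset_filter _ (subset_univ X)))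
    refine cancel _ ?_
    calc _ ≤ (#{x : Fin k → V | x p.1.1 ∈ S ∧ x p.1.2 ∈ S} : ℝ) * N ^ 2 := by gcongr
      _ ≤ 4 * N ^ k := hS'
      _ ≤ _ := by gcongr; linarith
  have hmixed : ∀ (p : P) (a : Fin k) (i : Fin t) (v : V) (c : C)
      (Q : Fin t × (Fin k → V) → Prop) [DecidablePred Q],
      (∀ z, Q z → z.1 = i ∧ z.2 a = v ∧ φ s(z.2 p.1.1, z.2 p.1.2) = c) →
      (#{z ∈ (univ : Finset (Fin t)) ×ˢ X | Q z} : ℝ) * N ≤ 8 * k * η * N ^ k := by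
    intro p a i v c Q _ hQ
    refine cancel _ ?_
    calc _ ≤ (#{x : Fin k → V | x a = v ∧ G.Adj (x p.1.1) (x p.1.2) ∧
              φ s(x p.1.1, x p.1.2) = c} : ℝ) * N ^ 2 := by
          gcongr
          refine (card_univ_product_filter_le i (q := fun x => x a = v ∧
            φ s(x p.1.1, x p.1.2) = c) hQ).trans (card_le_card fun x hx => ?_)
          rw [mem_filter] at hx
          simp only [mem_filter, mem_univ, true_and]
          exact ⟨hx.2.1, hX x hx.1 p.1 p.2, hx.2.2⟩
      _ ≤ η * N * N ^ k := by
          convert card_vertex_colour_mul_le (by linarith) hφ a (hP p.1 p.2) v c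
      _ ≤ _ := by
          have : 0 < η * N := by positivity
          exact mul_le_mul_of_nonneg_right
            (le_mul_of_one_le_left this.le (by linarith)) hNk.le
  rcases ξ with e | ⟨i, v⟩ | ⟨i, c⟩ <;> rcases ξ' with e' | ⟨i', v'⟩ | ⟨i', c'⟩ <;>
    rcases l with p | a | p <;> rcases l' with q | b | q <;>
    first
    | (refine empty _ fun z => ?_; simp [copyLabel]; done)
    | skip
  · by_cases hpq : p = q
    · refine empty _ fun z hz => hξ ?_
      subst hpq
      exact hz.1.symm.trans hz.2
    · have h1 := card_edge_edge_mul_le (hP p.1 p.2) (hP q.1 q.2) (Subtype.coe_ne_coe.2 hpq) e e'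
      refine cancel _ (le_of_mul_le_mul_right (a := N) ?_ hN)
      calc _ = t * ((#{x ∈ X | s(x p.1.1, x p.1.2) = e ∧ s(x q.1.1, x q.1.2) = e'} : ℝ) * N ^ 3) := by
            have : (#{z ∈ (univ : Finset (Fin t)) ×ˢ X | copyLabel φ P z (.inl p) = .inl e ∧
                copyLabel φ P z (.inl q) = .inl e'} : ℝ)
                = t * #{x ∈ X | s(x p.1.1, x p.1.2) = e ∧ s(x q.1.1, x q.1.2) = e'} := by
              simp only [copyLabel, Sum.inl.injEq]
              exact_mod_cast card_univ_product_filter X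
                (fun x => s(x p.1.1, x p.1.2) = e ∧ s(x q.1.1, x q.1.2) = e')
            rw [this]; ring
        _ ≤ (k * N) * (8 * N ^ k) := by
            refine mul_le_mul ht (le_trans ?_ h1) (by positivity) (by positivity)
            gcongr
            exact subset_univ X
        _ ≤ _ := by
            have : 0 ≤ k * N * (8 * N ^ k) := by positivity
            nlinarith
  · refine hedge p e i' _ fun z hz => ?_
    simp only [copyLabel, Sum.inl.injEq, Sum.inr.injEq, Prod.mk.injEq] at hz
    exact ⟨hz.1, hz.2.1⟩
  · refine hedge p e i' _ fun z hz => ?_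
    simp only [copyLabel, Sum.inl.injEq, Sum.inr.injEq, Prod.mk.injEq] at hz
    exact ⟨hz.1, hz.2.1⟩
  · refine hedge q e' i _ fun z hz => ?_
    simp only [copyLabel, Sum.inl.injEq, Sum.inr.injEq, Prod.mk.injEq] at hz
    exact ⟨hz.2, hz.1.1⟩
  · by_cases hab : a = b
    · refine empty _ fun z hz => hξ ?_
      subst hab
      exact hz.1.symm.trans hz.2
    refine cancel _ ?_
    calc _ ≤ (#{x : Fin k → V | x a = v ∧ x b = v'} : ℝ) * N ^ 2 := by
          gcongr
          refine (card_univ_product_filter_le i (q := fun x => x a = v ∧ x b = v')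
            fun z hz => ?_).trans (card_le_card (filter_subset_filter _ (subset_univ X)))
          simp only [copyLabel, Sum.inl.injEq, Sum.inr.injEq, Prod.mk.injEq] at hz
          exact ⟨hz.1.1, hz.1.2, hz.2.2⟩
      _ ≤ N ^ k := card_vertex_vertex_mul_le hab v v'
      _ ≤ _ := le_mul_of_one_le_left hNk.le (by linarith)
  · refine hmixed q a i v c' _ fun z hz => ?_
    simp only [copyLabel, Sum.inl.injEq, Sum.inr.injEq, Prod.mk.injEq] at hz
    exact ⟨hz.1.1, hz.1.2, hz.2.2⟩
  · refine hedge q e' i _ fun z hz => ?_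
    simp only [copyLabel, Sum.inl.injEq, Sum.inr.injEq, Prod.mk.injEq] at hz
    exact ⟨hz.2, hz.1.1⟩
  · refine hmixed p b i v' c _ fun z hz => ?_
    simp only [copyLabel, Sum.inl.injEq, Sum.inr.injEq, Prod.mk.injEq] at hz
    exact ⟨hz.1.1, hz.2.2, hz.1.2⟩
  · by_cases hpq : p = q
    · refine empty _ fun z hz => hξ ?_
      subst hpq
      exact hz.1.symm.trans hz.2
    have h1 := card_colour_colour_mul_le (by linarith) hφ hg (hP p.1 p.2) (hP q.1 q.2)
      (Subtype.coe_ne_coe.2 hpq) c c'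
    refine cancel _ (le_of_mul_le_mul_right (a := N) ?_ hN)
    calc _ ≤ (#{x : Fin k → V | (G.Adj (x p.1.1) (x p.1.2) ∧ φ s(x p.1.1, x p.1.2) = c) ∧
              G.Adj (x q.1.1) (x q.1.2) ∧ φ s(x q.1.1, x q.1.2) = c'} : ℝ) * N ^ 3 := by
          rw [mul_assoc, ← pow_succ]
          gcongr
          refine (card_univ_product_filter_le i (q := fun x => φ s(x p.1.1, x p.1.2) = c ∧
            φ s(x q.1.1, x q.1.2) = c') fun z hz => ?_).trans (card_le_card fun x hx => ?_)
          · simp only [copyLabel, Sum.inr.injEq, Prod.mk.injEq] at hz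
            exact ⟨hz.1.1, hz.1.2, hz.2.2⟩
          · rw [mem_filter] at hx
            simp only [mem_filter, mem_univ, true_and]
            exact ⟨⟨hX x hx.1 p.1 p.2, hx.2.1⟩, hX x hx.1 q.1 q.2, hx.2.2⟩
      _ ≤ η * N * (2 * g * N ^ k) := by convert h1
      _ ≤ η * N * (2 * (4 * k * N) * N ^ k) := by gcongr
      _ = _ := by ring

theorem codegree_copyHypergraph_le [Nonempty V] {G : SimpleGraph V} {φ : Sym2 V → C}
    {η g : ℝ} (hk : 1 ≤ k) (hη : 1 ≤ η * Fintype.card V)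
    (hφ : LBounded G φ (η * Fintype.card V)) (hg : GBounded G φ g)
    {P : Finset (Fin k × Fin k)} (hP : ∀ p ∈ P, p.1 < p.2)
    {X : Finset (Fin k → V)} (hX : ∀ x ∈ X, MapsPairs G P x)
    (ht : (t : ℝ) ≤ k * Fintype.card V) (hgN : g ≤ 4 * k * Fintype.card V)
    {ξ ξ' : Sym2 V ⊕ ((Fin t × V) ⊕ (Fin t × C))} (hξ : ξ ≠ ξ') :
    (#{e ∈ (univ : Finset (Fin t)) ×ˢ X | ξ ∈ copySupport φ P e ∧ ξ' ∈ copySupport φ P e} : ℝ) *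
      Fintype.card V ≤ (k + 2 * #P) ^ 2 * (8 * k * η * (Fintype.card V : ℝ) ^ k) := by
  have h0 : (#{e ∈ (univ : Finset (Fin t)) ×ˢ X | ξ ∈ copySupport φ P e ∧
      ξ' ∈ copySupport φ P e} : ℝ) ≤ ∑ l, ∑ l', (#{e ∈ (univ : Finset (Fin t)) ×ˢ X |
        copyLabel φ P e l = ξ ∧ copyLabel φ P e l' = ξ'} : ℝ) := by
    exact_mod_cast card_filter_mem_mem_image_le ((univ : Finset (Fin t)) ×ˢ X) (copyLabel φ P) ξ ξ'
  refine (mul_le_mul_of_nonneg_right h0 (Nat.cast_nonneg _)).trans ?_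
  simp_rw [Finset.sum_mul]
  refine (Finset.sum_le_sum fun l _ => Finset.sum_le_sum fun l' _ =>
    card_copyLabel_eq_and_eq_mul_le hk hη hφ hg hP hX ht hgN hξ l l').trans (le_of_eq ?_)
  simp
  ring

end CopyHypergraph

section Packing

open Finset Function

theorem exists_spread_parameters (k h : ℕ) {c δ : ℝ} (hc : 0 < c) (hδ : 0 < δ) :
    ∃ γ η₀ : ℝ, 0 < γ ∧ 0 < η₀ ∧ 17 * η₀ ≤ γ ^ 2 ∧ ∀ η q : ℝ, 0 ≤ η → η ≤ η₀ → c ≤ q → q ≤ 2 ^ h →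
      δ * q * (2 ^ h * γ + ((k : ℝ) ^ 2 + (k : ℝ) ^ 4) * η) + (k + h) * (2 ^ h * γ)
        ≤ (δ * q) ^ 2 := by
  set B : ℝ := δ * 2 ^ h * (2 ^ h + ((k : ℝ) ^ 2 + (k : ℝ) ^ 4)) + (k + h) * 2 ^ h with hB
  have hBpos : 0 < B := by positivity
  set γ : ℝ := min 1 ((δ * c) ^ 2 / B) with hγ
  have hγpos : 0 < γ := by positivity
  have hγ1 : γ ≤ 1 := min_le_left _ _
  have hγB : γ * B ≤ (δ * c) ^ 2 := (le_div_iff₀ hBpos).1 (min_le_right _ _)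
  refine ⟨γ, γ ^ 2 / 17, hγpos, by positivity, by linarith, fun η q hη hη' hcq hq => ?_⟩
  have hηγ : η ≤ γ := by nlinarith
  have hq0 : 0 < q := hc.trans_le hcq
  calc _ ≤ δ * 2 ^ h * (2 ^ h * γ + ((k : ℝ) ^ 2 + (k : ℝ) ^ 4) * γ) + (k + h) * (2 ^ h * γ) := by
        gcongr
    _ = γ * B := by rw [hB]; ring
    _ ≤ (δ * c) ^ 2 := hγB
    _ ≤ _ := by gcongr

theorem exists_packing_of_fintype {k h : ℕ} (hk : 2 ≤ k) (hh : 1 ≤ h) {d₀ ε : ℝ} (hd₀ : 0 < d₀)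
    (hε : 0 < ε) (hε1 : ε ≤ 1) :
    ∃ η₀ : ℝ, 0 < η₀ ∧ ∀ η : ℝ, 0 < η → η ≤ η₀ → ∃ n₀ : ℕ, ∀ n : ℕ, n₀ ≤ n → ∀ d : ℝ, d₀ ≤ d →
    ∀ G : SimpleGraph (Fin n), Quasirandom G η d →
    ∀ P : Finset (Fin k × Fin k), (∀ p ∈ P, p.1 < p.2) → #P = h →
    ∀ (C : Type) [Fintype C] (φ : Sym2 (Fin n) → C),
      GBounded G φ ((1 + η) * ((k : ℝ) * d * n) / (2 * (h : ℝ))) → LBounded G φ (η * n) →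
    ∀ t : ℕ, 2 * (h : ℝ) * t ≤ k * d * n →
      ∃ M : Finset (Fin t × (Fin k → Fin n)),
        (∀ e ∈ M, Injective e.2 ∧ MapsPairs G P e.2 ∧
          Set.InjOn (fun p : Fin k × Fin k => φ s(e.2 p.1, e.2 p.2)) P) ∧
        (M : Set (Fin t × (Fin k → Fin n))).Pairwise
          (fun e e' => ∀ l l', copyLabel φ P e l ≠ copyLabel φ P e' l') ∧
        (1 - ε) * (t * n) ≤ k * (#M : ℝ) := by
  classical
  have hk0 : (2 : ℝ) ≤ k := by exact_mod_cast hk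
  have hh0 : (1 : ℝ) ≤ h := by exact_mod_cast hh
  set c : ℝ := (min d₀ 1) ^ h with hc
  have hcpos : 0 < c := by positivity
  have hc1 : c ≤ 1 := pow_le_one₀ (by positivity) (min_le_right _ _)
  set δ : ℝ := ε / 8 with hδ
  have hδpos : 0 < δ := by positivity
  obtain ⟨γ, η₁, hγ, hη₁, hγη, hloss⟩ := exists_spread_parameters k h hcpos hδpos
  obtain ⟨δ', hδ', hnib⟩ := matchingRatio_of_lt_one (r := h + (k + h)) (a := 1 - ε / 4)
    (by omega) (by linarith)
  refine ⟨min (min 1 η₁) (min (ε / 8) (δ' * c / (8 * (k + 2 * h) ^ 2))), by positivity,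
    fun η hη hηle => ?_⟩
  simp only [le_min_iff] at hηle
  obtain ⟨⟨hη1, hηη₁⟩, hηε, hηδ'⟩ := hηle
  refine ⟨⌈1 / (η * c)⌉₊ + 1, fun n hn d hd G hG P hP hPh C _ φ hg hl t ht => ?_⟩
  have hn0 : 0 < n := by omega
  have hnR : (0 : ℝ) < n := by exact_mod_cast hn0
  have : Nonempty (Fin n) := ⟨⟨0, hn0⟩⟩
  have hηcn : 1 ≤ η * c * n := by
    have h1 : 1 / (η * c) ≤ n := (Nat.le_ceil _).trans (by exact_mod_cast (by omega : ⌈1 / (η * c)⌉₊ ≤ n))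
    rw [div_le_iff₀ (by positivity)] at h1
    linarith
  have hηn : 1 ≤ η * n := hηcn.trans (by
    have : 0 ≤ η * n * (1 - c) := by have := sub_nonneg.2 hc1; positivity
    linarith)
  have hdpos : 0 < d := hd₀.trans_le hd
  have hd2 : d ≤ 2 := (hG.density_le hn0).trans (by linarith)
  have hcq : c ≤ d ^ h := pow_le_pow_left₀ (by positivity) ((min_le_left _ _).trans hd) _
  have hcut := hG.cutNormLE hdpos.le hd2 hγ.le (by linarith) hηn
  obtain ⟨X, hX1, hX2, hX3, hX4⟩ := exists_spread_family (k := k) (G := G) (φ := φ) hdpos hd2 hδpos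
    hγ.le (by simpa using hηn) (by convert hcut) (by simpa using hl) P hP (by
      rw [hPh]
      exact hloss η (d ^ h) hη.le hηη₁ hcq (pow_le_pow_left₀ hdpos.le hd2 _))
  simp only [Fintype.card_fin, hPh] at hX2 hX3 hX4
  set q : ℝ := d ^ h with hq
  have hqpos : 0 < q := by positivity
  set Y : ℝ := (1 + δ) * q * (n : ℝ) ^ k with hY
  have hYpos : 0 < Y := by positivity
  have hnk : (n : ℝ) * n ≤ (n : ℝ) ^ k := by
    rw [← sq]
    exact pow_le_pow_right₀ (by exact_mod_cast hn0) hk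
  have hYn : (n : ℝ) ≤ η * k * Y := by
    have h1 : (n : ℝ) ≤ η * c * (n * n) := by
      rw [← mul_assoc]
      exact le_mul_of_one_le_left hnR.le hηcn
    have h2 : η * c * (n * n) ≤ η * q * (n : ℝ) ^ k := by gcongr
    have h3 : 1 ≤ k * (1 + δ) := one_le_mul_of_one_le_of_one_le (by linarith) (by linarith)
    have h4 : 0 ≤ η * q * (n : ℝ) ^ k := by positivity
    calc (n : ℝ) ≤ η * q * (n : ℝ) ^ k := h1.trans h2
      _ ≤ (k * (1 + δ)) * (η * q * (n : ℝ) ^ k) := le_mul_of_one_le_left h4 h3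
      _ = _ := by rw [hY]; ring
  set g : ℝ := (1 + η) * ((k : ℝ) * d * n) / (2 * (h : ℝ)) with hgdef
  have hgh : 2 * (h : ℝ) * g = (1 + η) * (k * d * n) := by rw [hgdef]; field_simp
  have hkdn : (k : ℝ) * d * n ≤ 2 * (k * n) := by
    calc (k : ℝ) * d * n = d * (k * n) := by ring
      _ ≤ 2 * (k * n) := by gcongr
  have hdeg := degree_copyHypergraph_le (t := t) (X := X) hdpos hη.le hYpos.le hg
    (fun x hx => (hX1 x hx).2.1) (by simpa using hX3) (by simpa using hX4)
    (by simpa [hPh] using ht) (by simpa [hPh] using hgh.le)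
  have hcodeg := fun ξ ξ' hξ => codegree_copyHypergraph_le (t := t) (X := X) (ξ := ξ) (ξ' := ξ')
    (by omega) (by simpa using hηn) (by simpa using hl) hg hP (fun x hx => (hX1 x hx).2.1)
    (by
      rw [Fintype.card_fin]
      have : (t : ℝ) ≤ h * t := le_mul_of_one_le_left (Nat.cast_nonneg _) hh0
      linarith)
    (by
      rw [Fintype.card_fin]
      have h1 : g ≤ h * g := le_mul_of_one_le_left (by positivity) hh0
      have h2 : (1 + η) * (k * d * n) ≤ 2 * (k * d * n) :=
        mul_le_mul_of_nonneg_right (by linarith) (by positivity)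
      have h3 : 0 ≤ (k : ℝ) * n := by positivity
      linarith) hξ
  simp only [Fintype.card_fin, hPh] at hdeg hcodeg
  set D : ℕ := ⌈(1 + η) * (k * Y) / n⌉₊ with hD
  have hDle : (1 + η) * (k * Y) ≤ D * n := (div_le_iff₀ hnR).1 (Nat.le_ceil _)
  have hDge : (D : ℝ) * n ≤ (1 + 2 * η) * (k * Y) := by
    have h1 : (D : ℝ) < (1 + η) * (k * Y) / n + 1 := Nat.ceil_lt_add_one (by positivity)
    have h2 : (D : ℝ) * n ≤ ((1 + η) * (k * Y) / n + 1) * n := by gcongr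
    rw [add_mul, div_mul_cancel₀ _ hnR.ne'] at h2
    linarith
  obtain ⟨M, hM1, hM2, hM3⟩ := hnib (Fin t × (Fin k → Fin n)) _ (copySupport φ P)
    ((univ : Finset (Fin t)) ×ˢ X) D
    (fun e he => by
      have := hX1 e.2 (mem_product.1 he).2
      rw [card_copySupport this.1 this.2.2, hPh])
    (fun ξ => by
      have := (hdeg ξ).trans hDle
      exact_mod_cast le_of_mul_le_mul_right this hnR)
    (fun ξ ξ' hξ => by
      refine le_of_mul_le_mul_right ((hcodeg ξ ξ' hξ).trans ?_) hnR
      rw [le_div_iff₀ (by positivity)] at hηδ'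
      have h1 : (k : ℝ) * (c * n ^ k) ≤ D * n := by
        refine le_trans ?_ hDle
        have h2 : c * (n : ℝ) ^ k ≤ Y := by
          rw [hY]
          gcongr
          exact hcq.trans (le_mul_of_one_le_left hqpos.le (by linarith))
        have h3 : (k : ℝ) * (c * n ^ k) ≤ k * Y := by gcongr
        have : 0 ≤ η * (k * Y) := by positivity
        linarith
      calc ((k : ℝ) + 2 * h) ^ 2 * (8 * k * η * n ^ k)
          = (η * (8 * (k + 2 * h) ^ 2)) * (k * n ^ k) := by ring
        _ ≤ (δ' * c) * (k * n ^ k) := by gcongr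
        _ = δ' * (k * (c * n ^ k)) := by ring
        _ ≤ δ' * (D * n) := by gcongr
        _ = _ := by ring)
  refine ⟨M, fun e he => hX1 e.2 (mem_product.1 (hM1 he)).2, fun e he e' he' hee' l l' hll' => ?_, ?_⟩
  · refine disjoint_left.1 (hM2 he he' hee') (mem_image_of_mem _ (mem_univ l)) ?_
    rw [hll']
    exact mem_image_of_mem _ (mem_univ l')
  · rw [card_product, card_univ, Fintype.card_fin] at hM3
    push_cast at hM3
    have h1 : (1 - ε / 4) * (1 - δ) * (t * n) * (q * n ^ k) ≤
        (1 + 2 * η) * (1 + δ) * (k * #M) * (q * n ^ k) := by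
      calc (1 - ε / 4) * (1 - δ) * (t * n) * (q * n ^ k)
          = (1 - ε / 4) * (t * ((1 - δ) * q * n ^ k)) * n := by ring
        _ ≤ (1 - ε / 4) * (t * #X) * n := by
            have : 0 ≤ 1 - ε / 4 := by linarith
            gcongr
        _ ≤ D * #M * n := by gcongr
        _ = (D * n) * #M := by ring
        _ ≤ ((1 + 2 * η) * (k * Y)) * #M := by gcongr
        _ = _ := by rw [hY]; ring
    have h2 := le_of_mul_le_mul_right h1 (by positivity)
    have htn : (0 : ℝ) ≤ t * n := by positivity
    have h3 : (1 - ε) * ((1 + 2 * η) * (1 + δ)) ≤ (1 - ε / 4) * (1 - δ) := by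
      have h4 : (1 + 2 * η) * (1 + δ) ≤ (1 + ε / 4) * (1 + ε / 8) := by
        rw [hδ]; gcongr; linarith
      have h5 : (1 - ε) * ((1 + 2 * η) * (1 + δ)) ≤ (1 - ε) * ((1 + ε / 4) * (1 + ε / 8)) :=
        mul_le_mul_of_nonneg_left h4 (by linarith)
      refine h5.trans ?_
      rw [hδ]
      have : 0 ≤ ε / 4 + 3 / 8 * ε ^ 2 + ε ^ 3 / 32 := by positivity
      linarith
    refine le_of_mul_le_mul_left (a := (1 + 2 * η) * (1 + δ)) ?_ (by positivity)
    linarith [mul_le_mul_of_nonneg_right h3 htn]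

theorem exists_packing {k h : ℕ} (hk : 2 ≤ k) (hh : 1 ≤ h) {d₀ ε : ℝ} (hd₀ : 0 < d₀)
    (hε : 0 < ε) (hε1 : ε ≤ 1) :
    ∃ η₀ : ℝ, 0 < η₀ ∧ ∀ η : ℝ, 0 < η → η ≤ η₀ → ∃ n₀ : ℕ, ∀ n : ℕ, n₀ ≤ n → ∀ d : ℝ, d₀ ≤ d →
    ∀ G : SimpleGraph (Fin n), Quasirandom G η d →
    ∀ P : Finset (Fin k × Fin k), (∀ p ∈ P, p.1 < p.2) → #P = h →
    ∀ (C : Type) (φ : Sym2 (Fin n) → C),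
      GBounded G φ ((1 + η) * ((k : ℝ) * d * n) / (2 * (h : ℝ))) → LBounded G φ (η * n) →
    ∀ t : ℕ, 2 * (h : ℝ) * t ≤ k * d * n →
      ∃ M : Finset (Fin t × (Fin k → Fin n)),
        (∀ e ∈ M, Injective e.2 ∧ MapsPairs G P e.2 ∧
          Set.InjOn (fun p : Fin k × Fin k => φ s(e.2 p.1, e.2 p.2)) P) ∧
        (M : Set (Fin t × (Fin k → Fin n))).Pairwise
          (fun e e' => ∀ l l', copyLabel φ P e l ≠ copyLabel φ P e' l') ∧
        (1 - ε) * (t * n) ≤ k * (#M : ℝ) := by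
  obtain ⟨η₀, hη₀, H⟩ := exists_packing_of_fintype hk hh hd₀ hε hε1
  refine ⟨η₀, hη₀, fun η hη hη' => ?_⟩
  obtain ⟨n₀, H⟩ := H η hη hη'
  refine ⟨n₀, fun n hn d hd G hG P hP hPh C φ hg hl t ht => ?_⟩
  have : Fintype (Set.range φ) := Fintype.ofFinite _
  obtain ⟨M, hM1, hM2, hM3⟩ := H n hn d hd G hG P hP hPh (Set.range φ) (Set.rangeFactorization φ)
    (fun c => by
      convert hg c using 4 with
      ext e
      simp [colourCls, Set.rangeFactorization, Subtype.ext_iff])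
    (fun v c => by
      convert hl v c using 4 with u
      simp [Set.rangeFactorization, Subtype.ext_iff]) t ht
  have hlab : ∀ (e : Fin t × (Fin k → Fin n)) l, copyLabel φ P e l =
      Sum.map id (Sum.map id (Prod.map id Subtype.val))
        (copyLabel (Set.rangeFactorization φ) P e l) := by
    rintro e (p | a | p) <;> rfl
  refine ⟨M, fun e he => ⟨(hM1 e he).1, (hM1 e he).2.1, fun p hp q hq hpq =>
    (hM1 e he).2.2 hp hq (Subtype.ext hpq)⟩, fun e he e' he' hee' l l' hll' => ?_, hM3⟩
  rw [hlab, hlab] at hll'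
  exact hM2 he he' hee' l l' ((injective_id.sumMap (injective_id.sumMap
    (injective_id.prodMap Subtype.val_injective))) hll')

end Packing

section Factor

open Finset Function

variable {V C : Type*} {k : ℕ}

open Classical in
/-- The edges of `F`, each recorded once as an increasing pair of vertices. -/
noncomputable def edgePairs (F : SimpleGraph (Fin k)) : Finset (Fin k × Fin k) :=
  {p | p.1 < p.2 ∧ F.Adj p.1 p.2}

theorem mem_edgePairs {F : SimpleGraph (Fin k)} {p : Fin k × Fin k} :
    p ∈ edgePairs F ↔ p.1 < p.2 ∧ F.Adj p.1 p.2 := by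
  simp [edgePairs]

theorem image_edgePairs (F : SimpleGraph (Fin k)) :
    (fun p : Fin k × Fin k => s(p.1, p.2)) '' edgePairs F = F.edgeSet := by
  ext e
  induction e using Sym2.ind with
  | _ a b =>
    simp only [Set.mem_image, SetLike.mem_coe, mem_edgePairs, Prod.exists, SimpleGraph.mem_edgeSet]
    constructor
    · rintro ⟨p, q, ⟨-, h⟩, he⟩
      rwa [← SimpleGraph.mem_edgeSet, ← he]
    · intro h
      rcases lt_or_gt_of_ne h.ne with hab | hab
      · exact ⟨a, b, ⟨hab, h⟩, rfl⟩
      · exact ⟨b, a, ⟨hab, h.symm⟩, Sym2.eq_swap⟩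

theorem injOn_edgePairs (F : SimpleGraph (Fin k)) :
    Set.InjOn (fun p : Fin k × Fin k => s(p.1, p.2)) (edgePairs F) := by
  intro p hp q hq hpq
  have hp := (mem_edgePairs.1 (mem_coe.1 hp)).1
  have hq := (mem_edgePairs.1 (mem_coe.1 hq)).1
  rcases Sym2.eq_iff.1 hpq with h | h
  · exact Prod.ext h.1 h.2
  · rw [h.1, h.2] at hp
    exact absurd hp hq.not_gt

theorem card_edgePairs (F : SimpleGraph (Fin k)) : #(edgePairs F) = F.edgeSet.ncard := by
  rw [← image_edgePairs, (injOn_edgePairs F).ncard_image, Set.ncard_coe_finset]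

/-- The edges of `V` used by the map `x`. -/
def edgeImage (P : Finset (Fin k × Fin k)) (x : Fin k → V) : Set (Sym2 V) :=
  (fun p : Fin k × Fin k => s(x p.1, x p.2)) '' P

theorem exists_isCopy {F : SimpleGraph (Fin k)} {G : SimpleGraph V} {x : Fin k → V}
    (hx : Injective x) (hG : MapsPairs G (edgePairs F) x) :
    ∃ H : G.Subgraph, IsCopy F H ∧ H.verts = Set.range x ∧ H.edgeSet = edgeImage (edgePairs F) x := by
  have hadj : ∀ {a b}, F.Adj a b → G.Adj (x a) (x b) := by
    intro a b h
    rcases lt_or_gt_of_ne h.ne with hab | hab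
    · exact hG (a, b) (mem_edgePairs.2 ⟨hab, h⟩)
    · exact (hG (b, a) (mem_edgePairs.2 ⟨hab, h.symm⟩)).symm
  let f : F.Copy G := ⟨⟨x, hadj⟩, hx⟩
  refine ⟨f.toSubgraph, ⟨f.isoToSubgraph⟩, ?_, ?_⟩
  · simp [SimpleGraph.Copy.toSubgraph, f, Set.image_univ]
  · rw [SimpleGraph.Copy.toSubgraph, SimpleGraph.Subgraph.edgeSet_map,
      SimpleGraph.Subgraph.edgeSet_top, ← image_edgePairs, edgeImage, Set.image_image]
    rfl

theorem exists_isFFactorSub {F : SimpleGraph (Fin k)} {G : SimpleGraph V} (S : Finset (Fin k → V))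
    (hS : ∀ x ∈ S, Injective x ∧ MapsPairs G (edgePairs F) x)
    (hdisj : (S : Set (Fin k → V)).Pairwise fun x y => ∀ a b, x a ≠ y b) :
    ∃ L : G.Subgraph, IsFFactorSub F L ∧ L.verts.ncard = k * #S ∧
      L.edgeSet = ⋃ x ∈ S, edgeImage (edgePairs F) x := by
  classical
  have h : ∀ x : S, ∃ H : G.Subgraph, IsCopy F H ∧ H.verts = Set.range x.1 ∧
      H.edgeSet = edgeImage (edgePairs F) x.1 := fun x => exists_isCopy (hS x x.2).1 (hS x x.2).2
  choose H hH1 hH2 hH3 using h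
  refine ⟨sSup (Set.range H), ⟨Set.range H, ?_, ?_, rfl⟩, ?_, ?_⟩
  · rintro _ ⟨x, rfl⟩
    exact hH1 x
  · rintro _ ⟨x, rfl⟩ _ ⟨y, rfl⟩ hxy
    have hne : x.1 ≠ y.1 := fun h => hxy (congrArg H (Subtype.ext h))
    rw [hH2, hH2, Set.disjoint_left]
    rintro _ ⟨a, rfl⟩ ⟨b, hb⟩
    exact hdisj x.2 y.2 hne a b hb.symm
  · have hv : (sSup (Set.range H)).verts = (S.biUnion fun x => univ.image x : Finset V) := by
      ext v
      simp [SimpleGraph.Subgraph.verts_sSup, hH2]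
    rw [hv, Set.ncard_coe_finset, card_biUnion, Finset.sum_congr rfl fun x hx =>
      card_image_of_injective _ (hS x hx).1]
    · simp [mul_comm]
    · intro x hx y hy hxy
      simp only [disjoint_left, mem_image, mem_univ, true_and]
      rintro _ ⟨a, rfl⟩ ⟨b, hb⟩
      exact hdisj hx hy hxy a b hb.symm
  · ext e
    simp [SimpleGraph.Subgraph.edgeSet_sSup, hH3]

end Factor

section Decomposition

open Finset Function

theorem exists_rainbow_factors {V C : Type*} {k t : ℕ} {F : SimpleGraph (Fin k)}
    {G : SimpleGraph V} {φ : Sym2 V → C} (M : Finset (Fin t × (Fin k → V)))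
    (hM : ∀ e ∈ M, Injective e.2 ∧ MapsPairs G (edgePairs F) e.2 ∧
      Set.InjOn (fun p : Fin k × Fin k => φ s(e.2 p.1, e.2 p.2)) (edgePairs F))
    (hdisj : (M : Set (Fin t × (Fin k → V))).Pairwise
      (fun e e' => ∀ l l', copyLabel φ (edgePairs F) e l ≠ copyLabel φ (edgePairs F) e' l')) :
    ∃ (m : Fin t → ℕ) (L : Fin t → G.Subgraph),
      (∀ i, IsFFactorSub F (L i) ∧ Rainbow φ (L i).edgeSet ∧ (L i).verts.ncard = k * m i ∧
        (L i).edgeSet.ncard = F.edgeSet.ncard * m i) ∧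
      (Pairwise fun i j => Disjoint (L i).edgeSet (L j).edgeSet) ∧ #M = ∑ i, m i := by
  classical
  set S : Fin t → Finset (Fin k → V) := fun i => {e ∈ M | e.1 = i}.image Prod.snd with hS
  have hmem : ∀ {i x}, x ∈ S i ↔ (i, x) ∈ M := by
    intro i x
    simp only [hS, mem_image, mem_filter, Prod.exists, exists_eq_right]
  have hedge : ∀ {i j x y}, x ∈ S i → y ∈ S j → (i, x) ≠ (j, y) → ∀ p ∈ edgePairs F,
      ∀ q ∈ edgePairs F, s(x p.1, x p.2) ≠ s(y q.1, y q.2) := by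
    intro i j x y hx hy hne p hp q hq h
    exact hdisj (hmem.1 hx) (hmem.1 hy) hne (.inl ⟨p, hp⟩) (.inl ⟨q, hq⟩) (by simp [copyLabel, h])
  have hfac := fun i => exists_isFFactorSub (F := F) (G := G) (S i)
    (fun x hx => ⟨(hM _ (hmem.1 hx)).1, (hM _ (hmem.1 hx)).2.1⟩)
    (fun x hx y hy hxy a b h => hdisj (hmem.1 hx) (hmem.1 hy)
      (fun h => hxy (Prod.ext_iff.1 h).2) (.inr (.inl a)) (.inr (.inl b)) (by simp [copyLabel, h]))
  choose L hL1 hL2 hL3 using hfac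
  refine ⟨fun i => #(S i), L, fun i => ⟨hL1 i, ?_, hL2 i, ?_⟩, fun i j hij => ?_, ?_⟩
  · rw [hL3]
    intro e he e' he' hee'
    simp only [Set.mem_iUnion, edgeImage, Set.mem_image, mem_coe] at he he'
    obtain ⟨x, hx, p, hp, rfl⟩ := he
    obtain ⟨y, hy, q, hq, rfl⟩ := he'
    by_cases hxy : x = y
    · subst hxy
      rw [(hM _ (hmem.1 hx)).2.2 hp hq hee']
    · exact absurd (by simp [copyLabel, hee']) (hdisj (hmem.1 hx) (hmem.1 hy)
        (fun h => hxy (Prod.ext_iff.1 h).2) (.inr (.inr ⟨p, hp⟩)) (.inr (.inr ⟨q, hq⟩)))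
  · have h1 : (L i).edgeSet = ((S i).biUnion fun x =>
        (edgePairs F).image fun p => s(x p.1, x p.2) : Finset (Sym2 V)) := by
      rw [hL3]
      simp [edgeImage]
    rw [h1, Set.ncard_coe_finset, card_biUnion, Finset.sum_congr rfl fun x hx =>
      card_image_of_injOn fun p hp q hq h => (hM _ (hmem.1 hx)).2.2 hp hq (congrArg φ h)]
    · simp [mul_comm, card_edgePairs]
    · intro x hx y hy hxy
      simp only [disjoint_left, mem_image]
      rintro _ ⟨p, hp, rfl⟩ ⟨q, hq, h⟩
      exact hedge hx hy (fun h => hxy (Prod.ext_iff.1 h).2) p hp q hq h.symm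
  · change Disjoint _ _
    rw [hL3, hL3, Set.disjoint_left]
    intro e he he'
    simp only [Set.mem_iUnion, edgeImage, Set.mem_image, mem_coe] at he he'
    obtain ⟨x, hx, p, hp, rfl⟩ := he
    obtain ⟨y, hy, q, hq, h⟩ := he'
    exact hedge hx hy (fun h => hij (Prod.ext_iff.1 h).1) p hp q hq h.symm
  · rw [card_eq_sum_card_fiberwise (f := Prod.fst) (t := univ) (fun _ _ => mem_coe.2 (mem_univ _))]
    refine Finset.sum_congr rfl fun i _ => (card_image_of_injOn fun e he e' he' h => ?_).symm
    exact Prod.ext ((mem_filter.1 (mem_coe.1 he)).2.trans (mem_filter.1 (mem_coe.1 he')).2.symm) h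

theorem sum_filter_large_ge {t : ℕ} {α ε n : ℝ} (hα : 0 < α) (x : Fin t → ℝ)
    (hx : ∀ i, x i ≤ n) (hsum : (1 - ε) * (t * n) ≤ ∑ i, x i) :
    (1 - ε - ε / α) * (t * n) ≤ ∑ i with (1 - α) * n ≤ x i, x i := by
  have h1 : ∑ i, (x i - (n - x i) / α) ≤ ∑ i with (1 - α) * n ≤ x i, x i := by
    rw [Finset.sum_filter]
    refine Finset.sum_le_sum fun i _ => ?_
    split_ifs with h
    · have := div_nonneg (sub_nonneg.2 (hx i)) hα.le
      linarith
    · have h2 : n ≤ (n - x i) / α := by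
        rw [le_div_iff₀ hα]
        linarith
      linarith [hx i]
  refine le_trans ?_ h1
  rw [Finset.sum_sub_distrib, ← Finset.sum_div, Finset.sum_sub_distrib]
  simp only [sum_const, card_univ, Fintype.card_fin, nsmul_eq_mul]
  have h3 : (t * n - ∑ i, x i) / α ≤ ε / α * (t * n) := by
    rw [div_mul_eq_mul_div]
    gcongr
    linarith
  linarith

theorem two_mul_ncard_edgeSet_le {n : ℕ} {G : SimpleGraph (Fin n)} {η d : ℝ}
    (hG : Quasirandom G η d) : 2 * (G.edgeSet.ncard : ℝ) ≤ (d + η) * (n * n) := by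
  classical
  have h1 : (2 * G.edgeSet.ncard : ℝ) = ∑ v, (degIn G v Set.univ : ℝ) := by
    rw [← SimpleGraph.coe_edgeFinset, Set.ncard_coe_finset]
    have := G.sum_degrees_eq_twice_card_edges
    have h2 : ∀ v, degIn G v Set.univ = G.degree v := fun v => by
      simp [degIn, Set.ncard_eq_toFinset_card', ← SimpleGraph.card_neighborFinset_eq_degree,
        SimpleGraph.neighborFinset_eq_filter]
    simp only [h2]
    exact_mod_cast this.symm
  calc _ = ∑ v, (degIn G v Set.univ : ℝ) := h1
    _ ≤ ∑ _v : Fin n, (d + η) * n := Finset.sum_le_sum fun v _ => by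
        linarith [(abs_le.1 (hG.abs_degIn_sub_le v)).2]
    _ = _ := by
        simp
        ring

theorem apxDecomp_reindex {V : Type*} [Finite V] {G : SimpleGraph V} {t : ℕ} {α : ℝ}
    {L : Fin t → G.Subgraph} (hL : Pairwise fun i j => Disjoint (L i).edgeSet (L j).edgeSet)
    (I : Finset (Fin t))
    (hI : (1 - α) * (G.edgeSet.ncard : ℝ) ≤ ∑ i ∈ I, ((L i).edgeSet.ncard : ℝ)) :
    ApxDecomp G α fun j : Fin #I => L (I.equivFin.symm j) := by
  classical
  have := Fintype.ofFinite V
  refine ⟨fun i j hij => hL fun h => hij (I.equivFin.symm.injective (Subtype.ext h)), ?_⟩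
  have h1 : (⋃ j : Fin #I, (L (I.equivFin.symm j)).edgeSet)
      = (I.biUnion fun i => (L i).edgeSet.toFinset : Finset (Sym2 V)) := by
    ext e
    simp only [Set.mem_iUnion, coe_biUnion, mem_coe, Set.coe_toFinset, exists_prop]
    exact ⟨fun ⟨j, hj⟩ => ⟨_, (I.equivFin.symm j).2, hj⟩,
      fun ⟨i, hi, h⟩ => ⟨I.equivFin ⟨i, hi⟩, by simpa using h⟩⟩
  have h2 : ((⋃ j : Fin #I, (L (I.equivFin.symm j)).edgeSet).ncard : ℝ)
      = ∑ i ∈ I, ((L i).edgeSet.ncard : ℝ) := by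
    rw [h1, Set.ncard_coe_finset, card_biUnion fun i _ j _ hij => by
      simpa [Set.disjoint_toFinset] using hL hij]
    simp [Set.ncard_eq_toFinset_card']
  have h3 := Set.ncard_sdiff_add_ncard_of_subset (s := ⋃ j : Fin #I, (L (I.equivFin.symm j)).edgeSet)
    (t := G.edgeSet) (Set.iUnion_subset fun j => (L _).edgeSet_subset) (Set.toFinite _)
  have h4 : ((G.edgeSet \ ⋃ j : Fin #I, (L (I.equivFin.symm j)).edgeSet).ncard : ℝ) +
      (⋃ j : Fin #I, (L (I.equivFin.symm j)).edgeSet).ncard = G.edgeSet.ncard := by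
    exact_mod_cast h3
  linarith

theorem exists_approx_decomposition {α d₀ : ℝ} (hα : 0 < α) (hα1 : α ≤ 1 / 2) (hd₀ : 0 < d₀)
    {f h : ℕ} (hf : 2 ≤ f) (hh : 1 ≤ h) :
    ∃ η : ℝ, 0 < η ∧ ∃ n₀ : ℕ, ∀ n : ℕ, n₀ ≤ n → ∀ d : ℝ, d₀ ≤ d →
    ∀ G : SimpleGraph (Fin n), Quasirandom G η d →
    ∀ F : SimpleGraph (Fin f), F.edgeSet.ncard = h →
    ∀ φ : Sym2 (Fin n) → ℕ,
      GBounded G φ ((1 + η) * ((f : ℝ) * d * n) / (2 * (h : ℝ))) →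
      LBounded G φ (η * n) →
      ∃ (t : ℕ) (L : Fin t → G.Subgraph),
        ApxDecomp G α L ∧
        ∀ i, IsFFactorSub F (L i) ∧ Rainbow φ (L i).edgeSet ∧
          (1 - α) * n ≤ ((L i).verts.ncard : ℝ) := by
  have hf0 : (2 : ℝ) ≤ f := by exact_mod_cast hf
  have hh0 : (1 : ℝ) ≤ h := by exact_mod_cast hh
  obtain ⟨η₀, hη₀, H⟩ := exists_packing hf hh hd₀ (ε := α ^ 2 / 8) (by positivity) (by nlinarith)
  set η : ℝ := min η₀ (α / 4 * d₀) with hη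
  have hηpos : 0 < η := by positivity
  obtain ⟨n₀, H⟩ := H η hηpos (min_le_left _ _)
  refine ⟨η, hηpos, max n₀ ⌈2 * h / (α / 4 * (f * d₀))⌉₊, fun n hn d hd G hG F hF φ hg hl => ?_⟩
  have hdpos : 0 < d := hd₀.trans_le hd
  have hn1 : 2 * h ≤ α / 4 * (f * d * n) := by
    have h1 : 2 * h / (α / 4 * (f * d₀)) ≤ n :=
      (Nat.le_ceil _).trans (by exact_mod_cast (le_max_right _ _).trans hn)
    rw [div_le_iff₀ (by positivity)] at h1
    calc (2 * h : ℝ) ≤ n * (α / 4 * (f * d₀)) := h1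
      _ ≤ n * (α / 4 * (f * d)) := by gcongr
      _ = _ := by ring
  have hη1 : η ≤ α / 4 * d := (min_le_right _ _).trans (by gcongr)
  set t : ℕ := ⌊(f * d * n) / (2 * h)⌋₊ with ht
  have ht1 : 2 * (h : ℝ) * t ≤ f * d * n := by
    have := Nat.floor_le (a := (f * d * n) / (2 * (h : ℝ))) (by positivity)
    rw [← ht, le_div_iff₀ (by positivity)] at this
    linarith
  have ht2 : f * d * n - 2 * h ≤ 2 * (h : ℝ) * t := by
    have := Nat.lt_floor_add_one ((f * d * n) / (2 * (h : ℝ)))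
    rw [← ht, div_lt_iff₀ (by positivity)] at this
    linarith
  obtain ⟨M, hM1, hM2, hM3⟩ := H n ((le_max_left _ _).trans hn) d hd G hG (edgePairs F)
    (fun p hp => (mem_edgePairs.1 hp).1) ((card_edgePairs F).trans hF) ℕ φ hg hl t ht1
  obtain ⟨m, L, hL1, hL2, hL3⟩ := exists_rainbow_factors M hM1 hM2
  have hsum := sum_filter_large_ge (α := α) (ε := α ^ 2 / 8) (n := n) hα (fun i => (f * m i : ℝ))
    (fun i => by
      have h1 : (L i).verts.ncard ≤ n := by
        simpa using Set.ncard_le_card (L i).verts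
      rw [(hL1 i).2.2.1] at h1
      exact_mod_cast h1)
    (by
      rw [hL3] at hM3
      push_cast at hM3
      rwa [← Finset.mul_sum])
  set I : Finset (Fin t) := {i | (1 - α) * n ≤ (f * m i : ℝ)} with hI
  rw [← Finset.mul_sum] at hsum
  refine ⟨#I, fun j => L (I.equivFin.symm j), apxDecomp_reindex hL2 I ?_, fun j =>
    ⟨(hL1 _).1, (hL1 _).2.1, ?_⟩⟩
  · have hE := two_mul_ncard_edgeSet_le hG
    simp only [(hL1 _).2.2.2, hF, Nat.cast_mul, ← Finset.mul_sum]
    set S : ℝ := ∑ i ∈ I, (m i : ℝ) with hS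
    have h1 : (1 - α / 4) * (t * n) ≤ f * S := by
      refine le_trans ?_ hsum
      have h2 : α ^ 2 / 8 / α = α / 8 := by field_simp
      rw [h2]
      refine mul_le_mul_of_nonneg_right ?_ (by positivity)
      nlinarith
    have hα4 : 0 ≤ 1 - α / 4 := by linarith
    have h3 : (1 - α) * (f * ((d + η) * (n * n))) ≤ 2 * h * (f * S) := by
      calc (1 - α) * (f * ((d + η) * (n * n)))
          ≤ (1 - α) * (f * ((d + α / 4 * d) * (n * n))) := by
            have : 0 ≤ 1 - α := by linarith
            gcongr
        _ = ((1 - α) * (1 + α / 4)) * (f * d * n * n) := by ring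
        _ ≤ ((1 - α / 4) * (1 - α / 4)) * (f * d * n * n) := by
            refine mul_le_mul_of_nonneg_right ?_ (by positivity)
            nlinarith
        _ = (1 - α / 4) * ((f * d * n - α / 4 * (f * d * n)) * n) := by ring
        _ ≤ (1 - α / 4) * ((2 * h * t) * n) := by
            gcongr
            linarith
        _ = 2 * h * ((1 - α / 4) * (t * n)) := by ring
        _ ≤ _ := by gcongr
    refine le_of_mul_le_mul_left (a := 2 * (f : ℝ)) ?_ (by positivity)
    calc 2 * (f : ℝ) * ((1 - α) * G.edgeSet.ncard)
        = (1 - α) * (f * (2 * G.edgeSet.ncard)) := by ring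
      _ ≤ (1 - α) * (f * ((d + η) * (n * n))) := by
          have : 0 ≤ 1 - α := by linarith
          gcongr
      _ ≤ 2 * h * (f * S) := h3
      _ = _ := by ring
  · rw [(hL1 _).2.2.1]
    have := (mem_filter.1 (I.equivFin.symm j).2).2
    exact_mod_cast this

end Decomposition

/-- Theorem 1.4: approximate decomposition of a quasirandom graph into rainbow
almost-spanning `F`-factors. -/
theorem stmt_3 :
    ∀ α d₀ : ℝ, 0 < α → 0 < d₀ →
    ∀ f h : ℕ, 1 ≤ h →
    ∃ η : ℝ, 0 < η ∧ ∃ n₀ : ℕ, ∀ n : ℕ, n₀ ≤ n → ∀ d : ℝ, d₀ ≤ d →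
    ∀ G : SimpleGraph (Fin n), Quasirandom G η d →
    ∀ F : SimpleGraph (Fin f), F.edgeSet.ncard = h →
    ∀ φ : Sym2 (Fin n) → ℕ,
      GBounded G φ ((1 + η) * ((f : ℝ) * d * n) / (2 * (h : ℝ))) →
      LBounded G φ (η * n) →
      ∃ (t : ℕ) (L : Fin t → G.Subgraph),
        ApxDecomp G α L ∧
        ∀ i, IsFFactorSub F (L i) ∧ Rainbow φ (L i).edgeSet ∧
          (1 - α) * n ≤ ((L i).verts.ncard : ℝ) := by
  intro α d₀ hα hd₀ f h hh
  by_cases hf : 2 ≤ f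
  · obtain ⟨η, hη, n₀, H⟩ := exists_approx_decomposition (α := min α (1 / 2)) (by positivity)
      (min_le_right _ _) hd₀ hf hh
    refine ⟨η, hη, n₀, fun n hn d hd G hG F hF φ hg hl => ?_⟩
    obtain ⟨t, L, hL, hL'⟩ := H n hn d hd G hG F hF φ hg hl
    refine ⟨t, L, ⟨hL.1, hL.2.trans ?_⟩, fun i => ⟨(hL' i).1, (hL' i).2.1, le_trans ?_ (hL' i).2.2⟩⟩
    · gcongr
      exact min_le_left _ _
    · gcongr
      exact min_le_left _ _
  · refine ⟨1, one_pos, 0, fun n _ d _ G _ F hF => ?_⟩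
    have : Subsingleton (Fin f) := Fin.subsingleton_iff_le_one.2 (by omega)
    have hF0 : F = ⊥ := Subsingleton.elim _ _
    simp [hF0] at hF
    omega
end

section
/- For all d, α ∈ (0,1] and r ∈ ℕ there exists ε₀ > 0 such that for every 0 < ε ≤ ε₀ there exists n₀ ∈ ℕ with the following property for all n ≥ n₀: (i) if G is an n-vertex (ε,d)-quasirandom graph, then the irregularity graph Ir_G(ε^{1/10},d) has maximum degree at most ε^{1/10}·n; (ii) if G is a graph with a vertex partition 𝒱 = (V₁,…,V_r) such that n ≤ |V_i| ≤ α⁻¹n for each i ∈ [r] and G[V_i,V_j] is (ε,d)-superregular for all i ≠ j ∈ [r], then the graph Ir_{G,𝒱}(ε^{1/10},d) has maximum degree at most ε^{1/10}·n. -/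
open Paper

namespace Paper

open Finset

variable {V : Type*}

lemma card_filter_ordered_le_two_mul_ncard [Fintype V] [DecidableEq V] (S : Set (Sym2 V))
    [DecidablePred fun p : V × V => s(p.1, p.2) ∈ S] :
    #{p : V × V | s(p.1, p.2) ∈ S} ≤ 2 * S.ncard := by
  classical
  have himg : (image (fun p : V × V => s(p.1, p.2)) {p : V × V | s(p.1, p.2) ∈ S}).card
      ≤ S.ncard := by
    rw [← Set.ncard_coe_finset]
    refine Set.ncard_le_ncard ?_ (Set.toFinite _)
    intro e he
    simp only [coe_image, Set.mem_image, mem_coe, mem_filter] at he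
    obtain ⟨p, hp, rfl⟩ := he
    exact hp.2
  refine (card_le_mul_card_image (f := fun p : V × V => s(p.1, p.2)) _ 2 ?_).trans
    (Nat.mul_le_mul_left 2 himg)
  intro e he
  induction e with
  | h a b =>
    refine (card_le_card (t := {(a, b), (b, a)}) ?_).trans card_le_two
    intro p hp
    have := (mem_filter.1 hp).2
    rw [Sym2.eq_iff] at this
    rcases p with ⟨x, y⟩
    simpa [Prod.ext_iff] using this

/-- The `0`-`1` adjacency function of a graph. -/
noncomputable def adjIndicator (G : SimpleGraph V) (u w : V) : ℝ :=
  open Classical in if G.Adj u w then 1 else 0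

lemma degIn_eq_sum (G : SimpleGraph V) (u : V) (S : Finset V) :
    (degIn G u (S : Set V) : ℝ) = ∑ w ∈ S, adjIndicator G u w := by
  classical
  have : (G.neighborSet u ∩ (S : Set V)) = ((S.filter fun w => G.Adj u w : Finset V) : Set V) := by
    ext w; simp [and_comm]
  rw [degIn, this, Set.ncard_coe_finset]
  simp [adjIndicator]

lemma codegIn_eq_sum (G : SimpleGraph V) (u v : V) (S : Finset V) :
    (codegIn G u v (S : Set V) : ℝ) = ∑ w ∈ S, adjIndicator G u w * adjIndicator G v w := by
  classical
  have : (G.neighborSet u ∩ G.neighborSet v ∩ (S : Set V))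
      = ((S.filter fun w => G.Adj u w ∧ G.Adj v w : Finset V) : Set V) := by
    ext w; simp; tauto
  rw [codegIn, this, Set.ncard_coe_finset]
  simp [adjIndicator, ← ite_and, and_comm]

lemma codegIn_le_ncard [Finite V] (G : SimpleGraph V) (u v : V) (S : Set V) :
    codegIn G u v S ≤ S.ncard :=
  Set.ncard_le_ncard Set.inter_subset_right (Set.toFinite _)

/-- In a quasirandom graph, the degrees into any vertex set have small variance. -/
lemma Quasirandom.sum_sq_deviation_le [Fintype V] {G : SimpleGraph V} {ε d : ℝ}
    (hd : 0 < d) (hd1 : d ≤ 1) (hε : 0 < ε) (hn : 1 ≤ ε * Fintype.card V)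
    (hG : Quasirandom G ε d) (A : Finset V) :
    ∑ w, (∑ u ∈ A, adjIndicator G u w - d * #A) ^ 2 ≤ 6 * ε * (Fintype.card V : ℝ) ^ 3 := by
  classical
  obtain ⟨hdeg, hcod⟩ := hG
  set n : ℝ := (Fintype.card V : ℝ) with hn_def
  have hn0 : 0 ≤ n := Nat.cast_nonneg _
  have huniv : ((Set.univ : Set V).ncard : ℝ) = n := by
    rw [Set.ncard_univ, Nat.card_eq_fintype_card]
  rw [huniv] at hdeg hcod
  set B : Set (Sym2 V) := {p : Sym2 V | ∃ u v, p = s(u, v) ∧ u ≠ v ∧ u ∈ Set.univ ∧ v ∈ Set.univ ∧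
        ¬ (|(codegIn G u v Set.univ : ℝ) - d ^ 2 * n| ≤ ε * n)}
  have hdeg_sum : ∀ u, ∑ w, adjIndicator G u w = degIn G u Set.univ := fun u => by
    simpa using (degIn_eq_sum G u univ).symm
  have hcod_sum : ∀ u v, ∑ w, adjIndicator G u w * adjIndicator G v w
      = codegIn G u v Set.univ := fun u v => by
    simpa using (codegIn_eq_sum G u v univ).symm
  have hexpand : ∑ w, (∑ u ∈ A, adjIndicator G u w - d * #A) ^ 2
      = ∑ p ∈ A ×ˢ A, ((codegIn G p.1 p.2 Set.univ : ℝ) - d * degIn G p.1 Set.univ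
          - d * degIn G p.2 Set.univ + d ^ 2 * n) := by
    have : ∀ w, (∑ u ∈ A, adjIndicator G u w - d * #A) ^ 2
        = ∑ p ∈ A ×ˢ A, (adjIndicator G p.1 w - d) * (adjIndicator G p.2 w - d) := by
      intro w
      rw [sum_product]
      dsimp only
      rw [← sum_mul_sum, sum_sub_distrib, sum_const, nsmul_eq_mul]
      ring
    simp_rw [this]
    rw [sum_comm]
    refine sum_congr rfl fun p _ => ?_
    rw [← hcod_sum, ← hdeg_sum, ← hdeg_sum]
    have : d ^ 2 * n = ∑ _w : V, d ^ 2 := by simp [hn_def, mul_comm]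
    rw [this, mul_sum, mul_sum, ← sum_sub_distrib, ← sum_sub_distrib, ← sum_add_distrib]
    exact sum_congr rfl fun w _ => by ring
  have hterm : ∀ p : V × V, (codegIn G p.1 p.2 Set.univ : ℝ) - d * degIn G p.1 Set.univ
          - d * degIn G p.2 Set.univ + d ^ 2 * n
        ≤ 3 * ε * n + ((if s(p.1, p.2) ∈ B then n else 0) + (if p.1 = p.2 then n else 0)) := by
    rintro ⟨u, v⟩
    have h1 := (abs_le.1 (hdeg u trivial)).1
    have h2 := (abs_le.1 (hdeg v trivial)).1
    have h1' := mul_le_mul_of_nonneg_left h1 hd.le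
    have h2' := mul_le_mul_of_nonneg_left h2 hd.le
    have h3 : d * (ε * n) ≤ ε * n := mul_le_of_le_one_left (by positivity) hd1
    have h4 : (codegIn G u v Set.univ : ℝ) ≤ n := by
      rw [← huniv]; exact_mod_cast codegIn_le_ncard G u v _
    have h5 : 0 ≤ d ^ 2 * n := by positivity
    have h6 : 0 ≤ ε * n := by positivity
    dsimp only
    split_ifs with hB he he
    · nlinarith
    · nlinarith
    · nlinarith
    · have hgood : |(codegIn G u v Set.univ : ℝ) - d ^ 2 * n| ≤ ε * n := by
        by_contra hbad
        exact hB ⟨u, v, rfl, he, trivial, trivial, hbad⟩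
      have := (abs_le.1 hgood).2
      nlinarith
  have hnonneg : ∀ p : V × V,
      0 ≤ 3 * ε * n + ((if s(p.1, p.2) ∈ B then n else 0) + (if p.1 = p.2 then n else 0)) := by
    intro p
    split_ifs <;> positivity
  have hB2 : ((#{p : V × V | s(p.1, p.2) ∈ B} : ℕ) : ℝ) ≤ 2 * (ε * n ^ 2) := by
    have := card_filter_ordered_le_two_mul_ncard B
    have : ((#{p : V × V | s(p.1, p.2) ∈ B} : ℕ) : ℝ) ≤ 2 * (B.ncard : ℝ) := by exact_mod_cast this
    linarith
  have hdiag : ∑ p : V × V, (if p.1 = p.2 then n else 0) = n * n := by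
    rw [Fintype.sum_prod_type]
    simp [hn_def]
  rw [hexpand]
  calc _ ≤ ∑ p ∈ A ×ˢ A, (3 * ε * n
            + ((if s(p.1, p.2) ∈ B then n else 0) + (if p.1 = p.2 then n else 0))) :=
        sum_le_sum fun p _ => hterm p
    _ ≤ ∑ p : V × V, (3 * ε * n
            + ((if s(p.1, p.2) ∈ B then n else 0) + (if p.1 = p.2 then n else 0))) :=
        sum_le_sum_of_subset_of_nonneg (subset_univ _) fun p _ _ => hnonneg p
    _ = n * n * (3 * ε * n) + (#{p : V × V | s(p.1, p.2) ∈ B} * n + n * n) := by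
        rw [sum_add_distrib, sum_add_distrib, hdiag, ← sum_filter, sum_const, sum_const]
        simp [hn_def]
    _ ≤ 6 * ε * n ^ 3 := by
        have h1 := mul_le_mul_of_nonneg_right hB2 hn0
        have h2 := mul_le_mul_of_nonneg_right hn (mul_nonneg hn0 hn0)
        nlinarith

/-- In a quasirandom graph, few vertices have a codegree with `v` that deviates from `d * deg v`
in a fixed direction. -/
lemma Quasirandom.card_le_of_codegree_deviation [Fintype V] {G : SimpleGraph V} {ε d η s : ℝ}
    (hd : 0 < d) (hd1 : d ≤ 1) (hη : 0 < η) (hεη : ε = η ^ 10)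
    (hn : 1 ≤ ε * Fintype.card V) (hG : Quasirandom G ε d) (hs : s ^ 2 = 1) (v : V)
    (A : Finset V)
    (hA : ∀ u ∈ A, η / 2 * Fintype.card V
      ≤ s * ((codegIn G u v Set.univ : ℝ) - d * degIn G v Set.univ)) :
    (#A : ℝ) ≤ 5 * η ^ 4 * Fintype.card V := by
  classical
  have hε : 0 < ε := hεη ▸ by positivity
  have hvar := hG.sum_sq_deviation_le hd hd1 hε hn A
  set n : ℝ := (Fintype.card V : ℝ) with hn_def
  have hn0 : 0 < n := by
    by_contra h
    nlinarith [mul_nonneg hε.le (neg_nonneg.2 (not_lt.1 h))]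
  have hsum : ∑ w, adjIndicator G v w * (∑ u ∈ A, adjIndicator G u w - d * #A)
      = ∑ u ∈ A, ((codegIn G u v Set.univ : ℝ) - d * degIn G v Set.univ) := by
    have h1 := fun u => codegIn_eq_sum G u v univ
    have h2 := degIn_eq_sum G v univ
    rw [coe_univ] at h2
    simp only [coe_univ] at h1
    simp_rw [h1, sum_sub_distrib, mul_sub, sum_sub_distrib, h2, mul_sum, sum_const, nsmul_eq_mul,
      mul_sum]
    rw [sum_comm]
    congr 1
    · exact sum_congr rfl fun _ _ => sum_congr rfl fun _ _ => mul_comm _ _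
    · exact sum_congr rfl fun _ _ => by ring
  have hind : ∑ w, adjIndicator G v w ^ 2 ≤ n := by
    calc _ ≤ ∑ _w : V, (1 : ℝ) := sum_le_sum fun w _ => by
          unfold adjIndicator; split_ifs <;> norm_num
      _ = n := by simp [hn_def]
  have hCS := sum_mul_sq_le_sq_mul_sq univ (fun w => adjIndicator G v w)
    (fun w => ∑ u ∈ A, adjIndicator G u w - d * #A)
  have hbound : (∑ u ∈ A, ((codegIn G u v Set.univ : ℝ) - d * degIn G v Set.univ)) ^ 2
      ≤ n * (6 * ε * n ^ 3) := by
    rw [← hsum]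
    exact hCS.trans (mul_le_mul hind hvar (sum_nonneg fun _ _ => sq_nonneg _) hn0.le)
  have hlow : #A * (η / 2 * n)
      ≤ s * ∑ u ∈ A, ((codegIn G u v Set.univ : ℝ) - d * degIn G v Set.univ) := by
    rw [mul_sum, ← nsmul_eq_mul]
    exact card_nsmul_le_sum _ _ _ hA
  have hsq := pow_le_pow_left₀ (by positivity) hlow 2
  rw [mul_pow s, hs, one_mul] at hsq
  have hfin : (#A * (η / 2 * n)) ^ 2 ≤ (5 * η ^ 4 * n * (η / 2 * n)) ^ 2 := by
    refine (hsq.trans hbound).trans ?_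
    rw [hεη]
    have : 0 ≤ η ^ 10 * n ^ 4 := by positivity
    nlinarith
  have := le_of_sq_le_sq hfin (by positivity)
  exact le_of_mul_le_mul_right this (by positivity)

lemma ncard_edgesBetween_of_disjoint (G : SimpleGraph V) {X Y : Finset V}
    (hXY : Disjoint X Y) :
    ((edgesBetween G X Y).ncard : ℝ) = ∑ u ∈ X, (degIn G u Y : ℝ) := by
  classical
  have himg : edgesBetween G (X : Set V) Y
      = (((X ×ˢ Y).filter fun p => G.Adj p.1 p.2).image
          (fun p : V × V => s(p.1, p.2)) : Finset (Sym2 V)) := by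
    ext e
    simp only [edgesBetween, Set.mem_ofPred_eq, coe_image, Set.mem_image, mem_coe, mem_filter,
      mem_product, Prod.exists]
    constructor
    · rintro ⟨he, u, v, rfl, hu, hv⟩
      exact ⟨u, v, ⟨⟨hu, hv⟩, he⟩, rfl⟩
    · rintro ⟨u, v, ⟨⟨hu, hv⟩, he⟩, rfl⟩
      exact ⟨he, u, v, rfl, hu, hv⟩
  rw [himg, Set.ncard_coe_finset, card_image_of_injOn]
  · simp_rw [degIn_eq_sum, adjIndicator]
    rw [← sum_product', card_filter]
    push_cast
    rfl
  · rintro ⟨a, b⟩ hab ⟨a', b'⟩ hab' h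
    simp only [coe_filter, mem_product, Set.mem_ofPred_eq] at hab hab'
    rcases Sym2.eq_iff.1 h with h | h
    · exact Prod.ext h.1 h.2
    · exact absurd ((show a = b' from h.1) ▸ hab'.1.2) (disjoint_left.1 hXY hab.1.1)

/-- In a regular pair `(P, Q)`, fewer than `ε|P|` vertices of `P` have a codegree into `Q`
with `v` deviating from `d²|Q|` in a fixed direction, when `v` has the right degree into `Q`. -/
lemma RegularPair.card_lt_of_codegree_deviation [Fintype V] {G : SimpleGraph V} {P Q : Set V}
    {ε d η s : ℝ} (hd1 : d ≤ 1) (hε : 0 < ε) (hεd : 2 * ε ≤ d)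
    (hεη : 3 * ε ≤ η) (hPQ : Disjoint P Q) (hP : 0 < (P.ncard : ℝ)) (hQ : 0 < (Q.ncard : ℝ))
    (hreg : RegularPair G P Q ε d) {v : V}
    (hv : |(degIn G v Q : ℝ) - d * Q.ncard| ≤ ε * Q.ncard) (hs : s = 1 ∨ s = -1)
    (A : Finset V) (hAP : (A : Set V) ⊆ P)
    (hA : ∀ u ∈ A, η * Q.ncard < s * ((codegIn G u v Q : ℝ) - d ^ 2 * Q.ncard)) :
    (#A : ℝ) < ε * P.ncard := by
  classical
  by_contra! hcon
  set q : ℝ := (Q.ncard : ℝ)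
  have hApos : (0 : ℝ) < #A := lt_of_lt_of_le (by positivity) hcon
  set Y : Finset V := (G.neighborSet v ∩ Q).toFinite.toFinset with hY
  have hYc : (Y : Set V) = G.neighborSet v ∩ Q := Set.Finite.coe_toFinset _
  have hYdeg : ((Y : Set V).ncard : ℝ) = degIn G v Q := by rw [hYc, degIn]
  have hYsub : (Y : Set V) ⊆ Q := hYc ▸ Set.inter_subset_right
  obtain ⟨hv1, hv2⟩ := abs_le.1 hv
  set m : ℝ := (degIn G v Q : ℝ)
  have hm : ε * q ≤ m := by nlinarith
  have hmpos : 0 < m := lt_of_lt_of_le (by positivity) hm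
  have hdisj : Disjoint A Y := by
    rw [← disjoint_coe]
    exact hPQ.mono hAP hYsub
  have h := hreg A hAP Y hYsub (by rwa [Set.ncard_coe_finset]) (by rwa [hYdeg])
  have hcodeg : ∀ u, degIn G u (Y : Set V) = codegIn G u v Q := fun u => by
    rw [hYc, degIn, codegIn, Set.inter_assoc]
  rw [ncard_edgesBetween_of_disjoint G hdisj, hYdeg, Set.ncard_coe_finset] at h
  simp_rw [hcodeg] at h
  rw [div_sub' (by positivity), abs_div, abs_of_pos (show 0 < (#A : ℝ) * m by positivity),
    div_le_iff₀ (by positivity)] at h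
  have hlow : #A * (η * q) < s * (∑ u ∈ A, (codegIn G u v Q : ℝ) - #A * (d ^ 2 * q)) := by
    have : ∑ u ∈ A, (codegIn G u v Q : ℝ) - #A * (d ^ 2 * q)
        = ∑ u ∈ A, ((codegIn G u v Q : ℝ) - d ^ 2 * q) := by
      rw [sum_sub_distrib, sum_const, nsmul_eq_mul]
    rw [this, mul_sum, ← nsmul_eq_mul, ← sum_const]
    exact sum_lt_sum_of_nonempty (card_pos.1 (by exact_mod_cast hApos)) hA
  set T : ℝ := ∑ u ∈ A, (codegIn G u v Q : ℝ)
  have hsle : s * (T - #A * (d ^ 2 * q)) ≤ |T - #A * (d ^ 2 * q)| := by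
    rcases hs with rfl | rfl
    · exact (one_mul _).trans_le (le_abs_self _)
    · exact (neg_one_mul _).trans_le (neg_le_abs _)
  have hsplit : |T - #A * (d ^ 2 * q)| ≤ |T - #A * m * d| + #A * (d * |m - d * q|) := by
    have : T - #A * (d ^ 2 * q) = (T - #A * m * d) + #A * (d * (m - d * q)) := by ring
    rw [this]
    refine (abs_add_le _ _).trans_eq ?_
    rw [abs_mul (#A : ℝ), abs_mul d, abs_of_pos hApos, abs_of_pos (show 0 < d by linarith)]
  have hd0 : 0 < d := by linarith
  have h1 : d * |m - d * q| ≤ ε * q :=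
    (mul_le_of_le_one_left (abs_nonneg _) hd1).trans hv
  have h2 : m ≤ 2 * q := by
    have hε1 : ε ≤ 1 := by linarith
    nlinarith
  have h3 : ε * (#A * m) ≤ #A * (2 * ε * q) := by
    have := mul_le_mul_of_nonneg_left h2 (mul_nonneg hε.le hApos.le)
    linarith
  have h4 : #A * (η * q) < #A * (3 * ε * q) := by
    have := mul_le_mul_of_nonneg_left h1 hApos.le
    linarith
  have h5 := lt_of_mul_lt_mul_left h4 hApos.le
  nlinarith

lemma Quasirandom.ncard_irregular_le [Fintype V] {G : SimpleGraph V} {ε d η : ℝ}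
    (hd : 0 < d) (hd1 : d ≤ 1) (hη : 0 < η) (hη1 : η ≤ 1 / 10) (hεη : ε = η ^ 10)
    (hn : 1 ≤ ε * Fintype.card V) (hG : Quasirandom G ε d) (v : V) :
    ({u : V | u ≠ v ∧ ¬ (|(codegIn G u v Set.univ : ℝ) - d ^ 2 * Fintype.card V|
      ≤ η * Fintype.card V)}.ncard : ℝ) ≤ η * Fintype.card V := by
  classical
  have hε : 0 < ε := hεη ▸ by positivity
  have hv := hG.1 v trivial
  rw [Set.ncard_univ, Nat.card_eq_fintype_card] at hv
  have hkey := fun s hs => hG.card_le_of_codegree_deviation (s := s) hd hd1 hη hεη hn hs v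
  set n : ℝ := (Fintype.card V : ℝ)
  have hn0 : 0 ≤ n := Nat.cast_nonneg _
  have hεle : ε ≤ η / 2 := by
    have : η ^ 9 ≤ (1 / 10) ^ 9 := pow_le_pow_left₀ hη.le hη1 9
    have h2 : ε = η * η ^ 9 := by rw [hεη]; ring
    rw [h2]
    nlinarith
  obtain ⟨hv1, hv2⟩ := abs_le.1 hv
  have h1 := mul_le_mul_of_nonneg_left hv1 hd.le
  have h2 := mul_le_mul_of_nonneg_left hv2 hd.le
  have h3 : d * (ε * n) ≤ η / 2 * n :=
    (mul_le_of_le_one_left (by positivity) hd1).trans (mul_le_mul_of_nonneg_right hεle hn0)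
  have hpos := hkey 1 (by norm_num) {u | η * n < (codegIn G u v Set.univ : ℝ) - d ^ 2 * n} (by
    intro u hu
    have := (mem_filter.1 hu).2
    nlinarith)
  have hneg := hkey (-1) (by norm_num)
    {u | (codegIn G u v Set.univ : ℝ) - d ^ 2 * n < -(η * n)} (by
    intro u hu
    have := (mem_filter.1 hu).2
    nlinarith)
  have hsub : {u : V | u ≠ v ∧ ¬ (|(codegIn G u v Set.univ : ℝ) - d ^ 2 * n| ≤ η * n)}
      ⊆ ((({u | η * n < (codegIn G u v Set.univ : ℝ) - d ^ 2 * n} : Finset V)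
        ∪ ({u | (codegIn G u v Set.univ : ℝ) - d ^ 2 * n < -(η * n)} : Finset V) :
          Finset V) : Set V) := by
    rintro u ⟨-, hu⟩
    rw [not_le, lt_abs] at hu
    simp only [coe_union, coe_filter, mem_univ, true_and, Set.mem_union, Set.mem_ofPred_eq]
    exact hu.imp id fun h => by linarith
  have hle := (Set.ncard_le_ncard hsub (Set.toFinite _)).trans
    ((Set.ncard_coe_finset _).le.trans (card_union_le _ _))
  have hle' : ({u : V | u ≠ v ∧ ¬ (|(codegIn G u v Set.univ : ℝ) - d ^ 2 * n| ≤ η * n)}.ncard : ℝ)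
      ≤ (#{u | η * n < (codegIn G u v Set.univ : ℝ) - d ^ 2 * n} : ℝ)
        + (#{u | (codegIn G u v Set.univ : ℝ) - d ^ 2 * n < -(η * n)} : ℝ) := by
    exact_mod_cast hle
  have h4 : η ^ 3 ≤ (1 / 10) ^ 3 := pow_le_pow_left₀ hη.le hη1 3
  have h5 : 5 * η ^ 4 * n ≤ η / 2 * n := by
    refine mul_le_mul_of_nonneg_right ?_ hn0
    have : 5 * η ^ 4 = 5 * η * η ^ 3 := by ring
    rw [this]
    nlinarith
  linarith

lemma ncard_irregular_le_of_superregular [Fintype V] {G : SimpleGraph V} {r : ℕ}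
    {𝒱 : Fin r → Set V} {ε d η M : ℝ} (hd1 : d ≤ 1) (hε : 0 < ε)
    (hεd : 2 * ε ≤ d) (hεη : 3 * ε ≤ η) (hpart : ∀ x, ∃! i, x ∈ 𝒱 i)
    (hpos : ∀ i, 0 < ((𝒱 i).ncard : ℝ)) (hM : ∀ i, ((𝒱 i).ncard : ℝ) ≤ M)
    (hsup : ∀ i j, i ≠ j → SuperregularPair G (𝒱 i) (𝒱 j) ε d) (v : V) :
    ({u : V | u ≠ v ∧ ∃ k, u ∉ 𝒱 k ∧ v ∉ 𝒱 k ∧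
      ¬ (|(codegIn G u v (𝒱 k) : ℝ) - d ^ 2 * ((𝒱 k).ncard : ℝ)|
        ≤ η * ((𝒱 k).ncard : ℝ))}.ncard : ℝ) ≤ 2 * (r : ℝ) ^ 2 * (ε * M) := by
  classical
  obtain ⟨i, hi, -⟩ := hpart v
  have hM0 : 0 ≤ M := (hpos i).le.trans (hM i)
  let A : ℝ → Fin r × Fin r → Finset V := fun s p =>
    {u | u ∈ 𝒱 p.1 ∧ p.1 ≠ p.2 ∧ v ∉ 𝒱 p.2 ∧ η * ((𝒱 p.2).ncard : ℝ)
      < s * ((codegIn G u v (𝒱 p.2) : ℝ) - d ^ 2 * ((𝒱 p.2).ncard : ℝ))}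
  have hA : ∀ s, s = 1 ∨ s = -1 → ∀ p, (#(A s p) : ℝ) ≤ ε * M := by
    rintro s hs ⟨j, k⟩
    by_cases hjk : j ≠ k ∧ v ∉ 𝒱 k
    · have hik : i ≠ k := fun h => hjk.2 (h ▸ hi)
      have hdisj : Disjoint (𝒱 j) (𝒱 k) := Set.disjoint_left.2 fun x hx hx' =>
        hjk.1 ((hpart x).unique hx hx')
      refine le_trans (le_of_lt ?_) (mul_le_mul_of_nonneg_left (hM j) hε.le)
      refine (hsup j k hjk.1).1.card_lt_of_codegree_deviation hd1 hε hεd hεη hdisj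
        (hpos j) (hpos k) ((hsup i k hik).2.1 v hi) hs _ ?_ ?_
      · intro u hu
        exact (mem_filter.1 hu).2.1
      · intro u hu
        exact (mem_filter.1 hu).2.2.2.2
    · have : A s (j, k) = ∅ := filter_eq_empty_iff.2 fun u _ hu => hjk ⟨hu.2.1, hu.2.2.1⟩
      rw [this, card_empty, Nat.cast_zero]
      positivity
  have hsub : {u : V | u ≠ v ∧ ∃ k, u ∉ 𝒱 k ∧ v ∉ 𝒱 k ∧
      ¬ (|(codegIn G u v (𝒱 k) : ℝ) - d ^ 2 * ((𝒱 k).ncard : ℝ)| ≤ η * ((𝒱 k).ncard : ℝ))}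
      ⊆ ((univ.biUnion fun p => A 1 p ∪ A (-1) p : Finset V) : Set V) := by
    rintro u ⟨-, k, huk, hvk, hu⟩
    obtain ⟨j, hj, -⟩ := hpart u
    have hjk : j ≠ k := fun h => huk (h ▸ hj)
    rw [not_le, lt_abs] at hu
    refine mem_coe.2 (mem_biUnion.2 ⟨(j, k), mem_univ _, mem_union.2 ?_⟩)
    refine hu.imp (fun h => ?_) fun h => ?_ <;>
      refine mem_filter.2 ⟨mem_univ _, hj, hjk, hvk, by linarith⟩
  have hle := (Set.ncard_le_ncard hsub (Set.toFinite _)).trans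
    ((Set.ncard_coe_finset _).le.trans card_biUnion_le)
  refine (Nat.cast_le.2 hle).trans ?_
  rw [Nat.cast_sum]
  calc _ ≤ ∑ _p : Fin r × Fin r, 2 * (ε * M) := sum_le_sum fun p _ => by
        have h1 := hA 1 (Or.inl rfl) p
        have h2 := hA (-1) (Or.inr rfl) p
        have h3 : ((#(A 1 p ∪ A (-1) p) : ℕ) : ℝ) ≤ #(A 1 p) + #(A (-1) p) := by
          exact_mod_cast card_union_le _ _
        linarith
    _ = 2 * (r : ℝ) ^ 2 * (ε * M) := by
        simp; ring

end Paper

/-- Lemma 2.5: maximum degree of the irregularity graphs `Ir_G(ε^{1/10},d)` and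
`Ir_{G,𝒱}(ε^{1/10},d)`. -/
theorem stmt_7 :
    ∀ d α : ℝ, 0 < d → d ≤ 1 → 0 < α → α ≤ 1 → ∀ r : ℕ,
    ∃ ε₀ : ℝ, 0 < ε₀ ∧ ∀ ε : ℝ, 0 < ε → ε ≤ ε₀ →
    ∃ n₀ : ℕ, ∀ n : ℕ, n₀ ≤ n →
      -- (i): quasirandom graphs
      ((∀ G : SimpleGraph (Fin n), Quasirandom G ε d →
        ∀ v : Fin n,
          (({u : Fin n | u ≠ v ∧
              ¬ (|(codegIn G u v Set.univ : ℝ) - d ^ 2 * n| ≤ ε ^ ((1 : ℝ)/10) * n)}).ncard : ℝ)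
            ≤ ε ^ ((1 : ℝ)/10) * n) ∧
      -- (ii): partitions into superregular pairs
      (∀ (N : ℕ) (G : SimpleGraph (Fin N)) (𝒱 : Fin r → Set (Fin N)),
        (∀ x, ∃! i, x ∈ 𝒱 i) →
        (∀ i, (n : ℝ) ≤ ((𝒱 i).ncard : ℝ) ∧ ((𝒱 i).ncard : ℝ) ≤ α⁻¹ * n) →
        (∀ i j, i ≠ j → SuperregularPair G (𝒱 i) (𝒱 j) ε d) →
        ∀ v : Fin N,
          (({u : Fin N | u ≠ v ∧ ∃ k, u ∉ 𝒱 k ∧ v ∉ 𝒱 k ∧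
              ¬ (|(codegIn G u v (𝒱 k) : ℝ) - d ^ 2 * ((𝒱 k).ncard : ℝ)|
                  ≤ ε ^ ((1 : ℝ)/10) * ((𝒱 k).ncard : ℝ))}).ncard : ℝ)
            ≤ ε ^ ((1 : ℝ)/10) * n)) := by
  intro d α hd hd1 hα hα1 r
  have hr : (0 : ℝ) < 2 * ((r : ℝ) + 1) ^ 2 := by positivity
  set η₀ : ℝ := min (1 / 10) (min (d / 2) (α / (2 * ((r : ℝ) + 1) ^ 2))) with hη₀
  have hη₀pos : 0 < η₀ := by positivity
  refine ⟨η₀ ^ 10, by positivity, fun ε hε hεle => ⟨⌈ε⁻¹⌉₊ + 1, fun n hn => ?_⟩⟩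
  have hnε : ε⁻¹ ≤ (n : ℝ) :=
    (Nat.le_ceil _).trans (by exact_mod_cast (Nat.le_succ _).trans hn)
  have hn1 : 1 ≤ ε * n := by
    have := mul_le_mul_of_nonneg_left hnε hε.le
    rwa [mul_inv_cancel₀ hε.ne'] at this
  have hnpos : (0 : ℝ) < n := lt_of_lt_of_le (by positivity) hnε
  set η : ℝ := ε ^ ((1 : ℝ) / 10) with hη_def
  have hη : 0 < η := by positivity
  have hεη : ε = η ^ 10 := by
    rw [hη_def, ← Real.rpow_natCast, ← Real.rpow_mul hε.le]
    norm_num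
  have hηle : η ≤ η₀ := le_of_pow_le_pow_left₀ (by norm_num) hη₀pos.le (hεη ▸ hεle)
  have hη1 : η ≤ 1 / 10 := hηle.trans (min_le_left _ _)
  have hηd : η ≤ d / 2 := hηle.trans ((min_le_right _ _).trans (min_le_left _ _))
  have hηα : η ≤ α / (2 * ((r : ℝ) + 1) ^ 2) :=
    hηle.trans ((min_le_right _ _).trans (min_le_right _ _))
  have hεsq : ε ≤ η * η := by
    rw [hεη, ← pow_two]
    exact pow_le_pow_of_le_one hη.le (by linarith) (by norm_num)
  refine ⟨fun G hG v => ?_, fun N G 𝒱 hpart hsize hsup v => ?_⟩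
  · have := hG.ncard_irregular_le hd hd1 hη hη1 hεη (by simpa using hn1) v
    simpa using this
  · refine (ncard_irregular_le_of_superregular hd1 hε (by nlinarith) (by nlinarith)
      hpart (fun i => hnpos.trans_le (hsize i).1)
      (fun i => (hsize i).2) hsup v).trans ?_
    rw [le_div_iff₀ hr] at hηα
    have h1 : 2 * (r : ℝ) ^ 2 * (η * η) ≤ η * α := by
      have h2 : η * (2 * (r : ℝ) ^ 2) ≤ η * (2 * ((r : ℝ) + 1) ^ 2) := by
        gcongr
        linarith
      nlinarith
    calc 2 * (r : ℝ) ^ 2 * (ε * (α⁻¹ * n))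
        ≤ 2 * (r : ℝ) ^ 2 * (η * η * (α⁻¹ * n)) := by gcongr
      _ = 2 * (r : ℝ) ^ 2 * (η * η) * (α⁻¹ * n) := by ring
      _ ≤ η * α * (α⁻¹ * n) := by gcongr
      _ = η * n := by field_simp
end
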